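/- Let u ∈ C¹(Ω) be a weak solution of −div(A(x)∇u) = u in Ω, i.e. ∫_Ω ⟨A(x)∇u, ∇φ⟩ dx = ∫_Ω u φ dx for every φ ∈ C_c^∞(Ω). If u ∈ L^p(Ω) for some exponent p with 0 < p < 2n/(n−1), then u ≡ 0 in Ω. -/

import Mathlib

open MeasureTheory Metric Filter

noncomputable section

abbrev En (n : ℕ) := EuclideanSpace ℝ (Fin n)

/-- The exterior domain `Ω = {x ∈ ℝⁿ : |x| > 1}`. -/
def OmegaExt (n : ℕ) : Set (En n) := {x | 1 < ‖x‖}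

/-- The quadratic/bilinear form `⟨M ξ, η⟩`. -/
def quadForm {n : ℕ} (M : Matrix (Fin n) (Fin n) ℝ) (ξ η : En n) : ℝ :=
  ∑ i, M.mulVec (fun j => ξ j) i * η i

/-- The conformal factor `μ(x) = ⟨A(x)∇r, ∇r⟩ = ⟨A(x)x, x⟩ / |x|²`. -/
def muA {n : ℕ} (A : En n → Matrix (Fin n) (Fin n) ℝ) (x : En n) : ℝ :=
  quadForm (A x) x x / ‖x‖ ^ 2

/-- The vector field `Z(x) = r(x) A(x)∇r(x) / μ(x) = A(x)x / μ(x)`. -/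
def Zvec {n : ℕ} (A : En n → Matrix (Fin n) (Fin n) ℝ) (x : En n) : En n :=
  (muA A x)⁻¹ • (WithLp.toLp 2 ((A x).mulVec (fun j => x j)) : En n)

/-- The derivative of `f` along `Z`: `Zf = ⟨Z, ∇f⟩`. -/
def Zd {n : ℕ} (A : En n → Matrix (Fin n) (Fin n) ℝ) (f : En n → ℝ) (x : En n) : ℝ :=
  ∑ i, Zvec A x i * gradient f x i

/-- Surface integral over the sphere `{|x| = ρ}` w.r.t. the `(n-1)`-dimensional
Hausdorff measure. -/
def sphInt (n : ℕ) (ρ : ℝ) (f : En n → ℝ) : ℝ :=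
  ∫ x in sphere (0 : En n) ρ, f x ∂(μH[(n : ℝ) - 1])

/-- Structural hypotheses on `A`: symmetry, `C¹` entries on `Ω`, uniform ellipticity
`λ|ξ|² ≤ ⟨A(x)ξ,ξ⟩ ≤ λ⁻¹|ξ|²`, and the decay `|x||∇B(x)| + |B(x)| ≤ C|x|^{-α}`
where `B = A - Iₙ` (entrywise). -/
def EllipticDecay {n : ℕ} (A : En n → Matrix (Fin n) (Fin n) ℝ) (lam α C : ℝ) : Prop :=
  (∀ x ∈ OmegaExt n, (A x).IsSymm) ∧
  (∀ i j, ContDiffOn ℝ 1 (fun x => A x i j) (OmegaExt n)) ∧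
  (∀ x ∈ OmegaExt n, ∀ ξ : En n,
      lam * ‖ξ‖ ^ 2 ≤ quadForm (A x) ξ ξ ∧ quadForm (A x) ξ ξ ≤ lam⁻¹ * ‖ξ‖ ^ 2) ∧
  (∀ x ∈ OmegaExt n, ∀ i j,
      ‖x‖ * ‖gradient (fun y => (A y - 1) i j) x‖ + |(A x - 1) i j| ≤ C * ‖x‖ ^ (-α))

/-- `u ∈ C¹(Ω)` is a weak solution of `-div(A∇u) = u` in `Ω`, i.e.
`∫_Ω ⟨A∇u, ∇φ⟩ = ∫_Ω u φ` for every test function `φ ∈ C_c^∞(Ω)`. -/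
def WeakSol {n : ℕ} (A : En n → Matrix (Fin n) (Fin n) ℝ) (u : En n → ℝ) : Prop :=
  ContDiffOn ℝ 1 u (OmegaExt n) ∧
  ∀ φ : En n → ℝ, ContDiff ℝ (⊤ : ℕ∞) φ → HasCompactSupport φ → tsupport φ ⊆ OmegaExt n →
    (∫ x in OmegaExt n, ∑ i, (A x).mulVec (fun j => gradient u x j) i * gradient φ x i) =
    ∫ x in OmegaExt n, u x * φ x


/-! ### Partial derivatives -/

def pd {n : ℕ} (i : Fin n) (f : En n → ℝ) (x : En n) : ℝ :=
  fderiv ℝ f x (EuclideanSpace.single i (1 : ℝ))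

section pdsec
variable {n : ℕ} {i j : Fin n} {f g : En n → ℝ} {x : En n}

lemma gradient_coord (f : En n → ℝ) (x : En n) (i : Fin n) : gradient f x i = pd i f x := by
  have h : inner ℝ (gradient f x) (EuclideanSpace.single i (1 : ℝ)) = pd i f x := by
    rw [pd, gradient, InnerProductSpace.toDual_symm_apply]
  rw [← h, EuclideanSpace.inner_single_right]
  simp

lemma pd_congr (h : f =ᶠ[nhds x] g) : pd i f x = pd i g x := by
  rw [pd, pd, h.fderiv_eq]

lemma pd_add (hf : DifferentiableAt ℝ f x) (hg : DifferentiableAt ℝ g x) :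
    pd i (fun y => f y + g y) x = pd i f x + pd i g x := by
  simp only [pd]; rw [fderiv_fun_add hf hg]; rfl

lemma pd_sub (hf : DifferentiableAt ℝ f x) (hg : DifferentiableAt ℝ g x) :
    pd i (fun y => f y - g y) x = pd i f x - pd i g x := by
  simp only [pd]; rw [fderiv_fun_sub hf hg]; rfl

lemma pd_mul (hf : DifferentiableAt ℝ f x) (hg : DifferentiableAt ℝ g x) :
    pd i (fun y => f y * g y) x = pd i f x * g x + f x * pd i g x := by
  simp only [pd]; rw [fderiv_fun_mul hf hg]
  simp; ring

lemma pd_const (c : ℝ) : pd i (fun _ => c) x = 0 := by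
  simp [pd]

lemma pd_const_mul (c : ℝ) (hf : DifferentiableAt ℝ f x) :
    pd i (fun y => c * f y) x = c * pd i f x := by
  rw [pd_mul (by fun_prop) hf, pd_const]; ring

lemma pd_sum {ι : Type*} (s : Finset ι) {F : ι → En n → ℝ}
    (hf : ∀ k ∈ s, DifferentiableAt ℝ (F k) x) :
    pd i (fun y => ∑ k ∈ s, F k y) x = ∑ k ∈ s, pd i (F k) x := by
  simp only [pd]; rw [fderiv_fun_sum hf]; simp

lemma pd_sum_mul {ι : Type*} (s : Finset ι) {F G : ι → En n → ℝ}
    (hf : ∀ k, DifferentiableAt ℝ (F k) x) (hg : ∀ k, DifferentiableAt ℝ (G k) x) :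
    pd i (fun y => ∑ k ∈ s, F k y * G k y) x = ∑ k ∈ s, (pd i (F k) x * G k x + F k x * pd i (G k) x) := by
  rw [pd_sum s (F := fun k y => F k y * G k y) (fun k _ => (hf k).mul (hg k))]
  exact Finset.sum_congr rfl fun k _ => pd_mul (hf k) (hg k)

lemma pd_coord (i j : Fin n) (x : En n) : pd i (fun y : En n => y j) x = if j = i then 1 else 0 := by
  have : (fun y : En n => y j) = (EuclideanSpace.proj j : En n →L[ℝ] ℝ) := by ext; simp
  rw [pd, this, ContinuousLinearMap.fderiv]
  simp

lemma diff_coord (j : Fin n) (x : En n) : DifferentiableAt ℝ (fun y : En n => y j) x := by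
  have : (fun y : En n => y j) = (EuclideanSpace.proj j : En n →L[ℝ] ℝ) := by ext; simp
  rw [this]; exact ContinuousLinearMap.differentiableAt _

lemma contDiff_coord {k : WithTop ℕ∞} (j : Fin n) : ContDiff ℝ k (fun y : En n => y j) := by
  have : (fun y : En n => y j) = (EuclideanSpace.proj j : En n →L[ℝ] ℝ) := by ext; simp
  rw [this]; exact ContinuousLinearMap.contDiff _

lemma pd_comp {φ : ℝ → ℝ} {φ' : ℝ} (hφ : HasDerivAt φ φ' (f x)) (hf : DifferentiableAt ℝ f x) :
    pd i (fun y => φ (f y)) x = φ' * pd i f x := by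
  have := (hφ.comp_hasFDerivAt x hf.hasFDerivAt).fderiv
  simp only [pd]
  rw [show (fun y => φ (f y)) = φ ∘ f from rfl, this]
  simp

lemma pd_normsq (i : Fin n) (x : En n) : pd i (fun y : En n => ‖y‖ ^ 2) x = 2 * x i := by
  have := (hasStrictFDerivAt_norm_sq x).hasFDerivAt.fderiv
  rw [pd, this]
  simp [EuclideanSpace.inner_single_right]

lemma contDiff_normsq {k : WithTop ℕ∞} : ContDiff ℝ k (fun y : En n => ‖y‖ ^ 2) := contDiff_norm_sq ℝ

lemma normsq_eq (x : En n) : ‖x‖ ^ 2 = ∑ i, x i ^ 2 := by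
  rw [EuclideanSpace.norm_sq_eq]; simp

lemma ContDiffAt.pd1 (h : ContDiffAt ℝ 2 f x) : ContDiffAt ℝ 1 (pd i f) x := by
  have := h.fderiv_right (m := 1) (by norm_num)
  exact this.clm_apply contDiffAt_const

lemma ContDiffAt.pd0 (h : ContDiffAt ℝ 1 f x) : ContinuousAt (pd i f) x := by
  have := (h.fderiv_right (m := 0) (by norm_num)).continuousAt
  exact this.clm_apply continuousAt_const

lemma ContDiff.pdk {k : WithTop ℕ∞} (h : ContDiff ℝ (k + 1) f) : ContDiff ℝ k (pd i f) := by
  have := h.fderiv_right (m := k) le_rfl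
  exact this.clm_apply contDiff_const

lemma ContDiff.pdT (h : ContDiff ℝ (⊤ : ℕ∞) f) : ContDiff ℝ (⊤ : ℕ∞) (pd i f) := by
  have := h.fderiv_right (m := (⊤ : ℕ∞)) (by simp)
  exact this.clm_apply contDiff_const

lemma pd_comm (h : ContDiffAt ℝ 2 f x) : pd i (pd j f) x = pd j (pd i f) x := by
  have hs : IsSymmSndFDerivAt ℝ f x := h.isSymmSndFDerivAt (by simp)
  have hd : DifferentiableAt ℝ (fderiv ℝ f) x :=
    (h.fderiv_right (m := 1) (by norm_num)).differentiableAt (by norm_num)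
  have key : ∀ a b : Fin n, pd a (pd b f) x =
      fderiv ℝ (fderiv ℝ f) x (EuclideanSpace.single a 1) (EuclideanSpace.single b 1) := by
    intro a b
    rw [pd, show pd b f = fun y => fderiv ℝ f y (EuclideanSpace.single b 1) from rfl,
      fderiv_clm_apply hd (by fun_prop)]
    simp
  rw [key, key, hs.eq]

lemma tsupport_pd : tsupport (pd i f) ⊆ tsupport f :=
  tsupport_fderiv_apply_subset ℝ _

lemma pd_zero_of_notMem (h : x ∉ tsupport f) : pd i f x = 0 :=
  image_eq_zero_of_notMem_tsupport (fun h' => h (tsupport_pd h'))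

lemma contDiff_of_supp {k : WithTop ℕ∞} (h : ∀ x ∈ tsupport f, ContDiffAt ℝ k f x) :
    ContDiff ℝ k f := by
  rw [contDiff_iff_contDiffAt]
  intro x
  by_cases hx : x ∈ tsupport f
  · exact h x hx
  · have : f =ᶠ[nhds x] fun _ => 0 := notMem_tsupport_iff_eventuallyEq.1 hx
    exact contDiffAt_const.congr_of_eventuallyEq this

lemma continuous_of_supp (h : ∀ x ∈ tsupport f, ContinuousAt f x) : Continuous f :=
  continuous_of_tsupport h

lemma integral_pd_zero (hf : ContDiff ℝ 1 f) (hc : HasCompactSupport f) : ∫ x, pd i f x = 0 := by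
  have h1 : Continuous (pd i f) := (hf.pdk (k := 0)).continuous
  have hc1 : HasCompactSupport (pd i f) := hc.mono' (subset_tsupport _ |>.trans tsupport_pd)
  have := integral_mul_fderiv_eq_neg_fderiv_mul_of_integrable (μ := (volume : Measure (En n)))
    (f := fun _ => (1 : ℝ)) (g := f) (v := EuclideanSpace.single i 1)
    (by simp) (by simp only [one_mul]; exact h1.integrable_of_hasCompactSupport hc1)
    (by simpa using hf.continuous.integrable_of_hasCompactSupport hc)
    (fun x _ => by fun_prop) (fun x _ => hf.differentiable (by norm_num) x)
  simp only [one_mul, fderiv_fun_const, Pi.zero_apply, zero_apply, zero_mul,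
    integral_zero, neg_zero] at this
  exact this

end pdsec

lemma isOpen_OmegaExt (n : ℕ) : IsOpen (OmegaExt n) := isOpen_lt continuous_const continuous_norm

/-! ### The Rellich-type divergence identity -/

section identity
variable {n : ℕ}

def gv (A : En n → Matrix (Fin n) (Fin n) ℝ) (v : En n → ℝ) (i : Fin n) (x : En n) : ℝ :=
  ∑ j, A x i j * pd j v x

def Lop (A : En n → Matrix (Fin n) (Fin n) ℝ) (v : En n → ℝ) (x : En n) : ℝ :=
  ∑ i, pd i (gv A v i) x

def Nv (A : En n → Matrix (Fin n) (Fin n) ℝ) (i : Fin n) (x : En n) : ℝ :=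
  ∑ j, A x i j * x j

def Ef (A : En n → Matrix (Fin n) (Fin n) ℝ) (v : En n → ℝ) (x : En n) : ℝ :=
  ∑ i, gv A v i x * pd i v x

def Vf (A : En n → Matrix (Fin n) (Fin n) ℝ) (v : En n → ℝ) (x : En n) : ℝ :=
  ∑ i, Nv A i x * pd i v x

def mf (A : En n → Matrix (Fin n) (Fin n) ℝ) (x : En n) : ℝ :=
  ∑ i, Nv A i x * x i

def Df (A : En n → Matrix (Fin n) (Fin n) ℝ) (x : En n) : ℝ :=
  ∑ i, pd i (Nv A i) x

def Tf (A : En n → Matrix (Fin n) (Fin n) ℝ) (v : En n → ℝ) (x : En n) : ℝ :=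
  ∑ i, ∑ k, gv A v i x * pd i (Nv A k) x * pd k v x

def Sf (A : En n → Matrix (Fin n) (Fin n) ℝ) (v : En n → ℝ) (x : En n) : ℝ :=
  ∑ l, Nv A l x * ∑ i, ∑ j, pd l (fun y => A y i j) x * pd i v x * pd j v x

def Mf (A : En n → Matrix (Fin n) (Fin n) ℝ) (x : En n) : ℝ :=
  ∑ i, Nv A i x * pd i (mf A) x

/-- The field whose divergence is integrated. -/
def Pf (A : En n → Matrix (Fin n) (Fin n) ℝ) (v H β : En n → ℝ) (c : ℝ) (i : Fin n) (x : En n) : ℝ :=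
  2 * H x * Vf A v x * gv A v i x - H x * Ef A v x * Nv A i x + 2 * c * H x * v x * gv A v i x
    + H x * Nv A i x * (β x ^ 2 * mf A x + 1) * v x ^ 2

variable {A : En n → Matrix (Fin n) (Fin n) ℝ} {v H β : En n → ℝ} {x : En n}

lemma cd_gv (hA : ∀ i j, ContDiffAt ℝ 1 (fun y => A y i j) x) (hv : ContDiffAt ℝ 2 v x) (i : Fin n) :
    ContDiffAt ℝ 1 (gv A v i) x :=
  ContDiffAt.sum fun j _ => (hA i j).mul hv.pd1

lemma cd_Nv (hA : ∀ i j, ContDiffAt ℝ 1 (fun y => A y i j) x) (i : Fin n) :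
    ContDiffAt ℝ 1 (Nv A i) x :=
  ContDiffAt.sum fun j _ => (hA i j).mul (contDiff_coord j).contDiffAt

lemma cd_Ef (hA : ∀ i j, ContDiffAt ℝ 1 (fun y => A y i j) x) (hv : ContDiffAt ℝ 2 v x) :
    ContDiffAt ℝ 1 (Ef A v) x :=
  ContDiffAt.sum fun j _ => (cd_gv hA hv j).mul hv.pd1

lemma cd_Vf (hA : ∀ i j, ContDiffAt ℝ 1 (fun y => A y i j) x) (hv : ContDiffAt ℝ 2 v x) :
    ContDiffAt ℝ 1 (Vf A v) x :=
  ContDiffAt.sum fun j _ => (cd_Nv hA j).mul hv.pd1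

lemma cd_mf (hA : ∀ i j, ContDiffAt ℝ 1 (fun y => A y i j) x) :
    ContDiffAt ℝ 1 (mf A) x :=
  ContDiffAt.sum fun j _ => (cd_Nv hA j).mul (contDiff_coord j).contDiffAt

lemma cd_Pf (hA : ∀ i j, ContDiffAt ℝ 1 (fun y => A y i j) x) (hv : ContDiffAt ℝ 2 v x)
    (hH : ContDiffAt ℝ 1 H x) (hβ : ContDiffAt ℝ 1 β x) (c : ℝ) (i : Fin n) :
    ContDiffAt ℝ 1 (Pf A v H β c i) x := by
  have h1 := cd_gv hA hv i
  have h2 := cd_Nv hA i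
  have h3 := cd_Ef hA hv
  have h4 := cd_Vf hA hv
  have h5 := cd_mf hA
  have h6 : ContDiffAt ℝ 1 v x := hv.of_le (by norm_num)
  unfold Pf
  fun_prop

lemma sum_x_gv (hs : (A x).IsSymm) : ∑ i, x i * gv A v i x = Vf A v x := by
  simp only [gv, Vf, Nv, Finset.mul_sum, Finset.sum_mul]
  rw [Finset.sum_comm]
  refine Finset.sum_congr rfl fun i _ => Finset.sum_congr rfl fun j _ => ?_
  rw [← hs.apply i j]; ring

lemma pd_Vf (hA : ∀ i j, ContDiffAt ℝ 1 (fun y => A y i j) x) (hv : ContDiffAt ℝ 2 v x) (i : Fin n) :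
    pd i (Vf A v) x = ∑ k, pd i (Nv A k) x * pd k v x + ∑ k, Nv A k x * pd i (pd k v) x := by
  have h2 := fun k => (cd_Nv hA k).differentiableAt (by norm_num)
  have h3 := fun k => (hv.pd1 (i := k)).differentiableAt (by norm_num)
  unfold Vf
  rw [pd_sum_mul _ h2 h3, ← Finset.sum_add_distrib]

lemma pd_Ef (hA : ∀ i j, ContDiffAt ℝ 1 (fun y => A y i j) x) (hv : ContDiffAt ℝ 2 v x)
    (hs : (A x).IsSymm) (l : Fin n) :
    pd l (Ef A v) x = ∑ i, ∑ j, pd l (fun y => A y i j) x * pd i v x * pd j v x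
      + 2 * ∑ k, gv A v k x * pd l (pd k v) x := by
  have h1 := fun k => (cd_gv hA hv k).differentiableAt (by norm_num)
  have h3 := fun k => (hv.pd1 (i := k)).differentiableAt (by norm_num)
  have h4 := fun i j => (hA i j).differentiableAt (by norm_num)
  have e1 : pd l (Ef A v) x = ∑ k, (pd l (gv A v k) x * pd k v x + gv A v k x * pd l (pd k v) x) := by
    unfold Ef
    rw [pd_sum_mul _ h1 h3]
  have e2 : ∀ k, pd l (gv A v k) x = ∑ j, pd l (fun y => A y k j) x * pd j v x
      + ∑ j, A x k j * pd l (pd j v) x := by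
    intro k
    unfold gv
    rw [pd_sum_mul _ (F := fun j y => A y k j) (h4 k) h3, ← Finset.sum_add_distrib]
  have e3 : ∑ k, (∑ j, A x k j * pd l (pd j v) x) * pd k v x = ∑ k, gv A v k x * pd l (pd k v) x := by
    simp only [gv, Finset.sum_mul]
    rw [Finset.sum_comm]
    refine Finset.sum_congr rfl fun i _ => Finset.sum_congr rfl fun j _ => ?_
    rw [← hs.apply i j]; ring
  rw [e1, Finset.sum_add_distrib]
  simp only [e2, add_mul, Finset.sum_add_distrib]
  rw [e3]
  have e4 : ∑ k, (∑ j, pd l (fun y => A y k j) x * pd j v x) * pd k v x =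
      ∑ i, ∑ j, pd l (fun y => A y i j) x * pd i v x * pd j v x := by
    refine Finset.sum_congr rfl fun i _ => ?_
    rw [Finset.sum_mul]
    exact Finset.sum_congr rfl fun j _ => by ring
  rw [e4]; ring

lemma div_Pf (hA : ∀ i j, ContDiffAt ℝ 1 (fun y => A y i j) x) (hv : ContDiffAt ℝ 2 v x)
    (hs : (A x).IsSymm) (hH : ContDiffAt ℝ 1 H x) (hβ : ContDiffAt ℝ 1 β x)
    (H₁ β₁ c : ℝ) (hH1 : ∀ i, pd i H x = H₁ * x i) (hβ1 : ∀ i, pd i β x = β₁ * x i) :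
    ∑ i, pd i (Pf A v H β c i) x =
      2 * H x * (Vf A v x + c * v x) * Lop A v x
      + (2 * H₁ * Vf A v x ^ 2 + 2 * H x * Tf A v x - (H₁ * mf A x + H x * Df A x) * Ef A v x
        - H x * Sf A v x)
      + (2 * c * H x * Ef A v x + 2 * c * H₁ * v x * Vf A v x)
      + ((β x ^ 2 * mf A x + 1) * (H₁ * mf A x + H x * Df A x) + 2 * H x * β x * β₁ * mf A x ^ 2
          + H x * β x ^ 2 * Mf A x) * v x ^ 2
      + 2 * H x * (β x ^ 2 * mf A x + 1) * v x * Vf A v x := by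
  have d1 := fun k => (cd_gv hA hv k).differentiableAt (by norm_num)
  have d2 := fun k => (cd_Nv hA k).differentiableAt (by norm_num)
  have d3 := (cd_Ef hA hv).differentiableAt (by norm_num)
  have d4 := (cd_Vf hA hv).differentiableAt (by norm_num)
  have d5 := (cd_mf hA).differentiableAt (by norm_num)
  have d6 : DifferentiableAt ℝ v x := hv.differentiableAt (by norm_num)
  have d7 := hH.differentiableAt (by norm_num)
  have d8 := hβ.differentiableAt (by norm_num)
  have hP : ∀ i, pd i (Pf A v H β c i) x =
      (2 * H₁ * Vf A v x + 2 * c * H₁ * v x) * (x i * gv A v i x)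
      + 2 * H x * (gv A v i x * pd i (Vf A v) x)
      + (2 * H x * (Vf A v x + c * v x)) * pd i (gv A v i) x
      - (H₁ * Ef A v x) * (Nv A i x * x i) - H x * (Nv A i x * pd i (Ef A v) x)
      - H x * Ef A v x * pd i (Nv A i) x
      + 2 * c * H x * (gv A v i x * pd i v x)
      + (H₁ * (β x ^ 2 * mf A x + 1) * v x ^ 2 + H x * (2 * β x * β₁ * mf A x) * v x ^ 2) * (Nv A i x * x i)
      + (H x * (β x ^ 2 * mf A x + 1) * v x ^ 2) * pd i (Nv A i) x
      + (H x * β x ^ 2 * v x ^ 2) * (Nv A i x * pd i (mf A) x)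
      + (2 * H x * (β x ^ 2 * mf A x + 1) * v x) * (Nv A i x * pd i v x) := by
    intro i
    have d1 := d1 i
    have d2 := d2 i
    have e0 : Pf A v H β c i = fun y => (((2 * ((H y * Vf A v y) * gv A v i y)) + (-1) * ((H y * Ef A v y) * Nv A i y))
      + (2 * c) * ((H y * v y) * gv A v i y))
      + (H y * Nv A i y) * (((β y * β y) * mf A y + 1) * (v y * v y)) := by
      ext y; unfold Pf; ring
    rw [e0]
    rw [pd_add (by fun_prop) (by fun_prop), pd_add (by fun_prop) (by fun_prop),
      pd_add (by fun_prop) (by fun_prop), pd_const_mul _ (by fun_prop), pd_const_mul _ (by fun_prop),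
      pd_const_mul _ (by fun_prop), pd_mul (by fun_prop) (by fun_prop), pd_mul (by fun_prop) (by fun_prop),
      pd_mul (by fun_prop) (by fun_prop), pd_mul (by fun_prop) (by fun_prop),
      pd_mul (by fun_prop) (by fun_prop), pd_mul (by fun_prop) (by fun_prop),
      pd_mul (by fun_prop) (by fun_prop), pd_mul (by fun_prop) (by fun_prop),
      pd_mul (by fun_prop) (by fun_prop), pd_add (by fun_prop) (by fun_prop), pd_const,
      pd_mul (by fun_prop) (by fun_prop), pd_mul (by fun_prop) (by fun_prop), pd_mul (by fun_prop) (by fun_prop), hH1, hβ1]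
    ring
  have s1 : ∑ i, gv A v i x * pd i (Vf A v) x
      = Tf A v x + ∑ i, ∑ k, gv A v i x * Nv A k x * pd i (pd k v) x := by
    simp only [pd_Vf hA hv, mul_add, Finset.mul_sum, Finset.sum_add_distrib, Tf, mul_assoc]
  have s2 : ∑ i, Nv A i x * pd i (Ef A v) x
      = Sf A v x + 2 * ∑ i, ∑ k, gv A v i x * Nv A k x * pd i (pd k v) x := by
    simp only [pd_Ef hA hv hs, mul_add, Finset.sum_add_distrib, Sf]
    congr 1
    rw [Finset.sum_comm, Finset.mul_sum]
    refine Finset.sum_congr rfl fun i _ => ?_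
    rw [Finset.mul_sum, Finset.mul_sum, Finset.mul_sum]
    refine Finset.sum_congr rfl fun k _ => ?_
    rw [pd_comm hv]; ring
  simp only [hP, Finset.sum_add_distrib, Finset.sum_sub_distrib, ← Finset.mul_sum]
  rw [sum_x_gv hs, s1, s2]
  simp only [Lop, Df, Ef, mf, Mf, Vf]
  ring

end identity

/-! ### Conjugation and the abstract Carleman inequality -/

section conj
variable {n : ℕ} {A : En n → Matrix (Fin n) (Fin n) ℝ} {z φ H β : En n → ℝ} {x : En n} {U : Set (En n)}

lemma pd_exp_mul (hφ : DifferentiableAt ℝ φ x) (hz : DifferentiableAt ℝ z x) (i : Fin n)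
    (h1 : pd i φ x = β x * x i) :
    pd i (fun y => Real.exp (φ y) * z y) x = Real.exp (φ x) * (pd i z x + β x * x i * z x) := by
  rw [pd_mul hφ.exp hz, pd_comp (Real.hasDerivAt_exp _) hφ, h1]; ring

lemma gv_exp_mul (hφ : DifferentiableAt ℝ φ x) (hz : DifferentiableAt ℝ z x)
    (h1 : ∀ i, pd i φ x = β x * x i) (i : Fin n) :
    gv A (fun y => Real.exp (φ y) * z y) i x
      = Real.exp (φ x) * (gv A z i x + β x * Nv A i x * z x) := by
  simp only [gv, Nv, pd_exp_mul hφ hz _ (h1 _), mul_add, Finset.sum_add_distrib, Finset.mul_sum,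
    Finset.sum_mul]
  congr 1 <;> refine Finset.sum_congr rfl fun j _ => by ring

lemma Vf_exp_mul (hφ : DifferentiableAt ℝ φ x) (hz : DifferentiableAt ℝ z x)
    (h1 : ∀ i, pd i φ x = β x * x i) :
    Vf A (fun y => Real.exp (φ y) * z y) x
      = Real.exp (φ x) * (Vf A z x + β x * mf A x * z x) := by
  simp only [Vf, mf, pd_exp_mul hφ hz _ (h1 _), mul_add, Finset.sum_add_distrib, Finset.mul_sum,
    Finset.sum_mul]
  congr 1 <;> refine Finset.sum_congr rfl fun j _ => by ring

lemma Lop_exp_mul (hU : IsOpen U) (hx : x ∈ U)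
    (hA : ∀ i j, ContDiffAt ℝ 1 (fun y => A y i j) x) (hs : (A x).IsSymm)
    (hφ : ∀ y ∈ U, ContDiffAt ℝ 2 φ y) (hz : ContDiff ℝ 2 z)
    (h1 : ∀ y ∈ U, ∀ i, pd i φ y = β y * y i) (hβ : ContDiffAt ℝ 1 β x)
    (β₁ : ℝ) (hβ1 : ∀ i, pd i β x = β₁ * x i) :
    Lop A (fun y => Real.exp (φ y) * z y) x = Real.exp (φ x) * (Lop A z x + 2 * β x * Vf A z x
      + (β x ^ 2 * mf A x + β₁ * mf A x + β x * Df A x) * z x) := by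
  have dz : ∀ y, DifferentiableAt ℝ z y := fun y => hz.differentiable (by norm_num) y
  have dφ : DifferentiableAt ℝ φ x := (hφ x hx).differentiableAt (by norm_num)
  have dβ := hβ.differentiableAt (by norm_num)
  have e : ∀ i, pd i (gv A (fun y => Real.exp (φ y) * z y) i) x =
      Real.exp (φ x) * (β x * (x i * gv A z i x) + (β x ^ 2 * z x + β₁ * z x) * (Nv A i x * x i)
        + pd i (gv A z i) x + β x * z x * pd i (Nv A i) x + β x * (Nv A i x * pd i z x)) := by
    intro i
    have dN := (cd_Nv hA i).differentiableAt (by norm_num)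
    have dg := (cd_gv hA hz.contDiffAt i).differentiableAt (by norm_num)
    have e1 : gv A (fun y => Real.exp (φ y) * z y) i =ᶠ[nhds x]
        fun y => Real.exp (φ y) * (gv A z i y + β y * Nv A i y * z y) := by
      filter_upwards [hU.mem_nhds hx] with y hy
      exact gv_exp_mul ((hφ y hy).differentiableAt (by norm_num)) (dz y) (h1 y hy) i
    have dz := dz x
    rw [pd_congr e1, pd_exp_mul (β := β) dφ (by fun_prop) i (h1 x hx i), pd_add (by fun_prop) (by fun_prop),
      pd_mul (by fun_prop) (by fun_prop), pd_mul (by fun_prop) (by fun_prop), hβ1]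
    ring
  rw [Lop]
  simp only [e, ← Finset.mul_sum, Finset.sum_add_distrib]
  rw [sum_x_gv hs]
  simp only [Lop, Df, mf, Vf]
  ring

lemma point_id (hU : IsOpen U) (hx : x ∈ U)
    (hA : ∀ i j, ContDiffAt ℝ 1 (fun y => A y i j) x) (hs : (A x).IsSymm)
    (hφ : ∀ y ∈ U, ContDiffAt ℝ 2 φ y) (hz : ContDiff ℝ 2 z)
    (h1 : ∀ y ∈ U, ∀ i, pd i φ y = β y * y i) (hβ : ContDiffAt ℝ 1 β x) (hH : ContDiffAt ℝ 1 H x)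
    (H₁ β₁ c : ℝ) (hH1 : ∀ i, pd i H x = H₁ * x i) (hβ1 : ∀ i, pd i β x = β₁ * x i)
    (v : En n → ℝ) (hv : v = fun y => Real.exp (φ y) * z y) (F V : ℝ) (hV : V = Vf A v x)
    (hF : F = Real.exp (φ x) * (Lop A z x + z x)) :
    ∑ i, pd i (Pf A v H β c i) x =
      2 * H x * (V + c * v x) * F + 2 * H₁ * V ^ 2 + 2 * H x * Tf A v x
      - (H₁ * mf A x + H x * (Df A x - 2 * c)) * Ef A v x - H x * Sf A v x
      + 2 * c * H₁ * v x * V + 4 * β x * H x * (V + c * v x) ^ 2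
      + 2 * H x * (β₁ * mf A x + β x * (Df A x - 2 * c)) * v x * (V + c * v x)
      + ((β x ^ 2 * mf A x + 1) * (H₁ * mf A x + H x * (Df A x - 2 * c))
        + 2 * H x * β x * β₁ * mf A x ^ 2 + H x * β x ^ 2 * Mf A x) * v x ^ 2 := by
  have hv2 : ContDiffAt ℝ 2 v x := by
    rw [hv]; exact (hφ x hx).exp.mul hz.contDiffAt
  have hL : Lop A v x = F + 2 * β x * V
      - (β x ^ 2 * mf A x - (β₁ * mf A x + β x * Df A x) + 1) * v x := by
    rw [hV, hv, Lop_exp_mul hU hx hA hs hφ hz h1 hβ β₁ hβ1,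
      Vf_exp_mul ((hφ x hx).differentiableAt (by norm_num)) (hz.differentiable (by norm_num) x) (h1 x hx), hF]
    ring
  rw [div_Pf hA hv2 hs hH hβ H₁ β₁ c hH1 hβ1, hL, ← hV]
  ring

lemma carleman_abs (hU : IsOpen U)
    (hA : ∀ x ∈ U, ∀ i j, ContDiffAt ℝ 1 (fun y => A y i j) x)
    (hφ : ∀ y ∈ U, ContDiffAt ℝ 2 φ y) (hz : ContDiff ℝ 2 z)
    (hzc : HasCompactSupport z) (hzU : tsupport z ⊆ U)
    (hβ : ∀ x ∈ U, ContDiffAt ℝ 1 β x) (hH : ∀ x ∈ U, ContDiffAt ℝ 1 H x) (c : ℝ)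
    (W1 W2 : En n → ℝ) (hW1 : ContinuousOn W1 U) (hW2 : ContinuousOn W2 U)
    (hpt : ∀ x ∈ tsupport z, W1 x * z x ^ 2 - W2 x * (Lop A z x + z x) ^ 2
      ≤ ∑ i, pd i (Pf A (fun y => Real.exp (φ y) * z y) H β c i) x) :
    ∫ x, W1 x * z x ^ 2 ≤ ∫ x, W2 x * (Lop A z x + z x) ^ 2 := by
  set v : En n → ℝ := fun y => Real.exp (φ y) * z y with hvdef
  have hvs : tsupport v ⊆ tsupport z := closure_mono fun y hy => by
    simp only [Function.mem_support, hvdef] at hy ⊢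
    exact fun h => hy (by rw [h, mul_zero])
  have hv : ∀ x ∈ U, ContDiffAt ℝ 2 v x := fun x hx => (hφ x hx).exp.mul hz.contDiffAt
  have hPs : ∀ i, tsupport (Pf A v H β c i) ⊆ tsupport z := by
    intro i
    refine closure_minimal (fun y hy => ?_) (isClosed_tsupport _)
    by_contra h
    have h0 : v y = 0 := image_eq_zero_of_notMem_tsupport fun h' => h (hvs h')
    have h1 : ∀ j, pd j v y = 0 := fun j => pd_zero_of_notMem fun h' => h (hvs h')
    apply hy
    simp [Pf, gv, Ef, h0, h1]
  have hPc : ∀ i, HasCompactSupport (Pf A v H β c i) := fun i =>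
    hzc.mono' ((subset_tsupport _).trans (hPs i))
  have hP1 : ∀ i, ContDiff ℝ 1 (Pf A v H β c i) := fun i => contDiff_of_supp fun x hx => by
    have hxU := hzU (hPs i hx)
    exact cd_Pf (hA x hxU) (hv x hxU) (hH x hxU) (hβ x hxU) c i
  have hinteg : ∀ i, Integrable (pd i (Pf A v H β c i)) := fun i =>
    (((hP1 i).pdk (k := 0)).continuous).integrable_of_hasCompactSupport
      ((hPc i).mono' ((subset_tsupport _).trans tsupport_pd))
  have hI : ∫ x, ∑ i, pd i (Pf A v H β c i) x = 0 := by
    rw [integral_finsetSum _ fun i _ => hinteg i]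
    exact Finset.sum_eq_zero fun i _ => integral_pd_zero (hP1 i) (hPc i)
  have hL0 : ∀ x, x ∉ tsupport z → Lop A z x = 0 := by
    intro x hx
    refine Finset.sum_eq_zero fun i _ => ?_
    have : gv A z i =ᶠ[nhds x] fun _ => 0 := by
      filter_upwards [(isClosed_tsupport z).isOpen_compl.mem_nhds hx] with y hy
      exact Finset.sum_eq_zero fun j _ => by rw [pd_zero_of_notMem hy, mul_zero]
    rw [pd_congr this, pd_const]
  have c1 : Continuous fun x => W1 x * z x ^ 2 := continuous_of_supp fun x hx => by
    have hx' : x ∈ tsupport z := by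
      refine closure_mono (fun y hy => ?_) hx
      exact fun h => hy (by simp [h])
    exact (hW1.continuousAt (hU.mem_nhds (hzU hx'))).mul (hz.continuous.continuousAt.pow 2)
  have s1 : HasCompactSupport fun x => W1 x * z x ^ 2 := hzc.mono fun y hy => by
    exact fun h => hy (by simp [h])
  have s2' : Function.support (fun x => W2 x * (Lop A z x + z x) ^ 2) ⊆ tsupport z := fun y hy => by
    by_contra h
    exact hy (by simp [hL0 y h, image_eq_zero_of_notMem_tsupport h])
  have c2 : Continuous fun x => W2 x * (Lop A z x + z x) ^ 2 := continuous_of_supp fun x hx => by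
    have hx' : x ∈ tsupport z := closure_minimal s2' (isClosed_tsupport _) hx
    have hL : ContinuousAt (Lop A z) x := by
      unfold Lop
      exact tendsto_finsetSum _ fun i _ => (cd_gv (hA x (hzU hx')) hz.contDiffAt i).pd0
    exact (hW2.continuousAt (hU.mem_nhds (hzU hx'))).mul
      ((hL.add hz.continuous.continuousAt).pow 2)
  have s2 : HasCompactSupport fun x => W2 x * (Lop A z x + z x) ^ 2 := hzc.mono' s2'
  have i1 := c1.integrable_of_hasCompactSupport s1 (μ := volume)
  have i2 := c2.integrable_of_hasCompactSupport s2 (μ := volume)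
  have := integral_mono (i1.sub i2) (integrable_finsetSum Finset.univ fun i _ => hinteg i) (fun x => by
    by_cases hx : x ∈ tsupport z
    · exact hpt x hx
    · have e0 : ∀ i, pd i (Pf A v H β c i) x = 0 := fun i =>
        pd_zero_of_notMem fun h => hx (hPs i h)
      simp [e0, hL0 x hx, image_eq_zero_of_notMem_tsupport hx])
  rw [hI] at this
  simp only [Pi.sub_apply] at this
  rw [integral_sub i1 i2] at this
  linarith

end conj

/-! ### Pointwise bounds -/

section bounds
variable {n : ℕ} {A : En n → Matrix (Fin n) (Fin n) ℝ} {v : En n → ℝ} {x : En n}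

lemma abs_sum_le_n {f : Fin n → ℝ} {B : ℝ} (h : ∀ i, |f i| ≤ B) : |∑ i, f i| ≤ n * B := by
  refine (Finset.abs_sum_le_sum_abs _ _).trans ?_
  refine (Finset.sum_le_sum fun i _ => h i).trans ?_
  simp

lemma abs_mul_le {a b A B : ℝ} (ha : |a| ≤ A) (hb : |b| ≤ B) : |a * b| ≤ A * B := by
  rw [abs_mul]
  exact mul_le_mul ha hb (abs_nonneg _) ((abs_nonneg _).trans ha)

lemma coord_le (x : En n) (i : Fin n) : |x i| ≤ ‖x‖ := by
  simpa using PiLp.norm_apply_le x i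

def gn (v : En n → ℝ) (x : En n) : ℝ := Real.sqrt (∑ i, pd i v x ^ 2)

lemma gn_nonneg : 0 ≤ gn v x := Real.sqrt_nonneg _

lemma gn_sq : gn v x ^ 2 = ∑ i, pd i v x ^ 2 := Real.sq_sqrt (Finset.sum_nonneg fun _ _ => sq_nonneg _)

lemma pd_le_gn (i : Fin n) : |pd i v x| ≤ gn v x := by
  apply abs_le_of_sq_le_sq _ gn_nonneg
  rw [gn_sq]
  exact Finset.single_le_sum (f := fun i => pd i v x ^ 2) (fun _ _ => sq_nonneg _) (Finset.mem_univ i)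

lemma pd_Nv (hA : ∀ i j, ContDiffAt ℝ 1 (fun y => A y i j) x) (i k : Fin n) :
    pd i (Nv A k) x = ∑ j, pd i (fun y => A y k j) x * x j + A x k i := by
  unfold Nv
  rw [pd_sum_mul _ (F := fun j y => A y k j) (G := fun j y => y j)
    (fun j => (hA k j).differentiableAt (by norm_num)) (fun j => diff_coord j x),
    Finset.sum_add_distrib]
  simp [pd_coord]

lemma pd_mf (hA : ∀ i j, ContDiffAt ℝ 1 (fun y => A y i j) x) (i : Fin n) :
    pd i (mf A) x = ∑ k, pd i (Nv A k) x * x k + Nv A i x := by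
  unfold mf
  rw [pd_sum_mul _ (F := fun j y => Nv A j y) (G := fun j y => y j)
    (fun j => (cd_Nv hA j).differentiableAt (by norm_num)) (fun j => diff_coord j x),
    Finset.sum_add_distrib]
  simp [pd_coord]

lemma near_bounds (hA : ∀ i j, ContDiffAt ℝ 1 (fun y => A y i j) x) {M R : ℝ} (hM : 0 ≤ M)
    (h1 : ∀ i j, |A x i j| ≤ M) (h2 : ∀ l i j, |pd l (fun y => A y i j) x| ≤ M) (hR : ‖x‖ ≤ R) :
    |Vf A v x| ≤ n * (n * (M * R)) * gn v x ∧
    |Tf A v x| ≤ n * (n * ((n * M) * (n * (M * R) + M))) * gn v x ^ 2 ∧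
    |Sf A v x| ≤ n * ((n * (M * R)) * (n * (n * M))) * gn v x ^ 2 ∧
    |Ef A v x| ≤ n * (n * M) * gn v x ^ 2 ∧
    |Df A x| ≤ n * (n * (M * R) + M) ∧
    |mf A x| ≤ n * ((n * (M * R)) * R) ∧
    |Mf A x| ≤ n * ((n * (M * R)) * (n * ((n * (M * R) + M) * R) + n * (M * R))) := by
  have hx : ∀ i, |x i| ≤ R := fun i => (coord_le x i).trans hR
  have hw : ∀ i, |pd i v x| ≤ gn v x := fun i => pd_le_gn i
  have hg : ∀ i, |gv A v i x| ≤ n * (M * gn v x) := fun i =>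
    abs_sum_le_n fun j => abs_mul_le (h1 i j) (hw j)
  have hN : ∀ i, |Nv A i x| ≤ n * (M * R) := fun i =>
    abs_sum_le_n fun j => abs_mul_le (h1 i j) (hx j)
  have hdN : ∀ i k, |pd i (Nv A k) x| ≤ n * (M * R) + M := fun i k => by
    rw [pd_Nv hA]
    exact (abs_add_le _ _).trans (add_le_add
      (abs_sum_le_n fun j => abs_mul_le (h2 i k j) (hx j)) (h1 k i))
  have hdm : ∀ i, |pd i (mf A) x| ≤ n * ((n * (M * R) + M) * R) + n * (M * R) := fun i => by
    rw [pd_mf hA]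
    exact (abs_add_le _ _).trans (add_le_add
      (abs_sum_le_n fun k => abs_mul_le (hdN i k) (hx k)) (hN i))
  refine ⟨?_, ?_, ?_, ?_, ?_, ?_, ?_⟩
  · refine (abs_sum_le_n fun i => abs_mul_le (hN i) (hw i)).trans (le_of_eq (by ring))
  · refine (abs_sum_le_n fun i => abs_sum_le_n fun k =>
      abs_mul_le (abs_mul_le (hg i) (hdN i k)) (hw k)).trans (le_of_eq (by ring))
  · refine (abs_sum_le_n fun l => abs_mul_le (hN l) (abs_sum_le_n fun i => abs_sum_le_n fun j =>
      abs_mul_le (abs_mul_le (h2 l i j) (hw i)) (hw j))).trans (le_of_eq (by ring))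
  · refine (abs_sum_le_n fun i => abs_mul_le (hg i) (hw i)).trans (le_of_eq (by ring))
  · exact abs_sum_le_n fun i => hdN i i
  · exact abs_sum_le_n fun i => abs_mul_le (hN i) (hx i)
  · exact abs_sum_le_n fun i => abs_mul_le (hN i) (hdm i)

lemma far_bounds (hA : ∀ i j, ContDiffAt ℝ 1 (fun y => A y i j) x) {η : ℝ} (hη : 0 ≤ η) (hη1 : η ≤ 1)
    (h1 : ∀ i j, |A x i j - if i = j then 1 else 0| ≤ η)
    (h2 : ∀ l i j, ‖x‖ * |pd l (fun y => A y i j) x| ≤ η) {κ : ℝ}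
    (hκ : κ = 10 * (n + 1) ^ 4 * η) :
    |Vf A v x| ≤ (1 + κ) * (‖x‖ * gn v x) ∧
    |Tf A v x - gn v x ^ 2| ≤ κ * gn v x ^ 2 ∧
    |Sf A v x| ≤ κ * gn v x ^ 2 ∧
    |Ef A v x - gn v x ^ 2| ≤ κ * gn v x ^ 2 ∧
    |Df A x - n| ≤ κ ∧
    |mf A x - ‖x‖ ^ 2| ≤ κ * ‖x‖ ^ 2 ∧
    |Mf A x - 2 * ‖x‖ ^ 2| ≤ κ * ‖x‖ ^ 2 := by
  set r := ‖x‖ with hr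
  set g := gn v x with hgdef
  have r0 : 0 ≤ r := norm_nonneg _
  have g0 : 0 ≤ g := gn_nonneg
  have hn0 : (0 : ℝ) ≤ n := Nat.cast_nonneg n
  have hx : ∀ i, |x i| ≤ r := fun i => coord_le x i
  have hw : ∀ i, |pd i v x| ≤ g := fun i => pd_le_gn i
  have hg : ∀ i, |gv A v i x - pd i v x| ≤ n * (η * g) := fun i => by
    have : gv A v i x - pd i v x = ∑ j, (A x i j - if i = j then 1 else 0) * pd j v x := by
      simp [gv, sub_mul, Finset.sum_sub_distrib]
    rw [this]
    exact abs_sum_le_n fun j => abs_mul_le (h1 i j) (hw j)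
  have hN : ∀ i, |Nv A i x - x i| ≤ n * (η * r) := fun i => by
    have : Nv A i x - x i = ∑ j, (A x i j - if i = j then 1 else 0) * x j := by
      simp [Nv, sub_mul, Finset.sum_sub_distrib]
    rw [this]
    exact abs_sum_le_n fun j => abs_mul_le (h1 i j) (hx j)
  have hdN : ∀ i k, |pd i (Nv A k) x - if k = i then 1 else 0| ≤ n * η + η := fun i k => by
    rw [pd_Nv hA, add_sub_assoc]
    refine (abs_add_le _ _).trans (add_le_add (abs_sum_le_n fun j => ?_) (h1 k i))
    rw [abs_mul, mul_comm]
    exact (mul_le_mul_of_nonneg_right (hx j) (abs_nonneg _)).trans (h2 i k j)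
  have hgb : ∀ i, |gv A v i x| ≤ (n + 1) * g := fun i => by
    have := abs_add_le (gv A v i x - pd i v x) (pd i v x)
    rw [sub_add_cancel] at this
    have h3 : n * (η * g) ≤ n * (1 * g) := by gcongr
    linarith [hg i, hw i]
  have hNb : ∀ i, |Nv A i x| ≤ (n + 1) * r := fun i => by
    have := abs_add_le (Nv A i x - x i) (x i)
    rw [sub_add_cancel] at this
    have h3 : n * (η * r) ≤ n * (1 * r) := by gcongr
    linarith [hN i, hx i]
  have kb : ∀ c : ℝ, c ≤ 10 * (n + 1) ^ 4 → c * η ≤ κ := fun c hc => by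
    rw [hκ]; gcongr
  have n2 : (n : ℝ) ^ 2 ≤ (n + 1) ^ 4 := by nlinarith [sq_nonneg ((n : ℝ) + 1), pow_nonneg hn0 3, pow_nonneg hn0 4]
  have n2' : (n : ℝ) ^ 2 ≤ 10 * ((n : ℝ) + 1) ^ 4 := by
    have : (0 : ℝ) ≤ ((n : ℝ) + 1) ^ 4 := by positivity
    linarith
  have hE0 : Ef A v x - g ^ 2 = ∑ i, (gv A v i x - pd i v x) * pd i v x := by
    rw [gn_sq, Ef, ← Finset.sum_sub_distrib]
    exact Finset.sum_congr rfl fun i _ => by ring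
  have hE : |Ef A v x - g ^ 2| ≤ (n ^ 2 * η) * g ^ 2 := by
    rw [hE0]
    exact (abs_sum_le_n fun i => abs_mul_le (hg i) (hw i)).trans (le_of_eq (by ring))
  have hm0 : mf A x - r ^ 2 = ∑ i, (Nv A i x - x i) * x i := by
    rw [hr, normsq_eq, mf, ← Finset.sum_sub_distrib]
    exact Finset.sum_congr rfl fun i _ => by ring
  have hm : |mf A x - r ^ 2| ≤ (n ^ 2 * η) * r ^ 2 := by
    rw [hm0]
    exact (abs_sum_le_n fun i => abs_mul_le (hN i) (hx i)).trans (le_of_eq (by ring))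
  have g20 := sq_nonneg g
  have r20 := sq_nonneg r
  refine ⟨?_, ?_, ?_, ?_, ?_, ?_, ?_⟩
  · have e : Vf A v x = ∑ i, x i * pd i v x + ∑ i, (Nv A i x - x i) * pd i v x := by
      rw [Vf, ← Finset.sum_add_distrib]
      exact Finset.sum_congr rfl fun i _ => by ring
    have c1 : |∑ i, x i * pd i v x| ≤ r * g := by
      apply abs_le_of_sq_le_sq _ (by positivity)
      rw [mul_pow, gn_sq, hr, normsq_eq]
      exact Finset.sum_mul_sq_le_sq_mul_sq _ _ _
    have c2 := abs_sum_le_n fun i => abs_mul_le (hN i) (hw i)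
    have c3 := mul_le_mul_of_nonneg_right (kb (n ^ 2) n2') (mul_nonneg r0 g0)
    rw [e]
    refine (abs_add_le _ _).trans ?_
    nlinarith
  · have e : Tf A v x - g ^ 2 = (Ef A v x - g ^ 2)
        + ∑ i, ∑ k, gv A v i x * (pd i (Nv A k) x - if k = i then 1 else 0) * pd k v x := by
      simp [Tf, Ef, mul_sub, sub_mul, Finset.sum_sub_distrib]
    have c2 := abs_sum_le_n fun i => abs_sum_le_n fun k => abs_mul_le (abs_mul_le (hgb i) (hdN i k)) (hw k)
    have c3 := mul_le_mul_of_nonneg_right (kb (n ^ 2 + n * (n * ((n + 1) * (n + 1)))) (by nlinarith)) g20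
    rw [e]
    refine (abs_add_le _ _).trans ?_
    nlinarith
  · have h2' : ∀ l, |Nv A l x * ∑ i, ∑ j, pd l (fun y => A y i j) x * pd i v x * pd j v x|
        ≤ (n + 1) * (n * (n * (η * g * g))) := fun l => by
      have c1 : |r * ∑ i, ∑ j, pd l (fun y => A y i j) x * pd i v x * pd j v x|
          ≤ n * (n * (η * g * g)) := by
        rw [Finset.mul_sum]
        refine abs_sum_le_n fun i => ?_
        rw [Finset.mul_sum]
        refine abs_sum_le_n fun j => ?_
        rw [← mul_assoc, ← mul_assoc]
        refine abs_mul_le (abs_mul_le ?_ (hw i)) (hw j)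
        rw [abs_mul, abs_of_nonneg r0]
        exact h2 l i j
      rw [abs_mul, abs_of_nonneg r0] at c1
      rw [abs_mul]
      calc _ ≤ ((n + 1) * r) * |∑ i, ∑ j, pd l (fun y => A y i j) x * pd i v x * pd j v x| := by
            gcongr; exact hNb l
        _ ≤ _ := by rw [mul_assoc]; gcongr
    have c3 := mul_le_mul_of_nonneg_right (kb (n * ((n + 1) * (n * n))) (by nlinarith [pow_nonneg hn0 3, pow_nonneg hn0 4])) g20
    refine (abs_sum_le_n h2').trans ?_
    nlinarith
  · exact hE.trans (mul_le_mul_of_nonneg_right (kb _ n2') g20)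
  · have e : Df A x - n = ∑ i : Fin n, (pd i (Nv A i) x - if i = i then 1 else 0) := by
      simp [Df]
    rw [e]
    refine (abs_sum_le_n fun i => hdN i i).trans ?_
    have := kb (n * (n + 1)) (by nlinarith)
    linarith
  · exact hm.trans (mul_le_mul_of_nonneg_right (kb _ n2') r20)
  · have e : Mf A x - 2 * r ^ 2 = 2 * (mf A x - r ^ 2) + ∑ i, Nv A i x * (Nv A i x - x i)
        + ∑ i, ∑ k, Nv A i x * (pd i (Nv A k) x - if k = i then 1 else 0) * x k := by
      simp only [Mf, pd_mf hA, mul_sub, sub_mul, Finset.sum_sub_distrib, mul_add, Finset.sum_add_distrib, Finset.mul_sum]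
      simp [mf, mul_assoc]
      ring
    have c2 := abs_sum_le_n fun i => abs_sum_le_n fun k => abs_mul_le (abs_mul_le (hNb i) (hdN i k)) (hx k)
    have c1 := abs_sum_le_n fun i => abs_mul_le (hNb i) (hN i)
    have c3 := mul_le_mul_of_nonneg_right (kb (2 * n ^ 2 + n * (n * ((n + 1) * (n + 1))) + n * (n * (n + 1))) (by nlinarith)) r20
    rw [e]
    refine (abs_add_le _ _).trans ?_
    have c4 := (abs_add_le (2 * (mf A x - r ^ 2)) (∑ i, Nv A i x * (Nv A i x - x i)))
    rw [abs_mul, abs_two] at c4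
    nlinarith

end bounds

/-! ### Pointwise positivity: arithmetic -/

lemma fa1 {κ g w : ℝ} (hκ0 : 0 ≤ κ) (hκ1 : κ ≤ 1 / 400)
    (hw : |w| ≤ (1 + κ) * g) : w ^ 2 ≤ (1 + 3 * κ) * g ^ 2 := by
  have h1 : w ^ 2 ≤ ((1 + κ) * g) ^ 2 := sq_le_sq' (abs_le.1 hw).1 (abs_le.1 hw).2
  have h2 : (1 + κ) ^ 2 ≤ 1 + 3 * κ := by nlinarith
  have h3 := mul_le_mul_of_nonneg_right h2 (sq_nonneg g)
  rw [mul_pow] at h1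
  linarith

lemma fa2 {a κ μ d : ℝ} (ha0 : 0 < a) (ha1 : a ≤ 1) (hμ : |μ| ≤ κ) (hd : |d| ≤ κ) :
    |(a - 1) * μ + d| ≤ 2 * κ := by
  have h1 : |a - 1| ≤ 1 := by rw [abs_le]; constructor <;> linarith
  have := abs_mul_le h1 hμ
  have := abs_add_le ((a - 1) * μ) d
  linarith

lemma fa3 {a κ g w T E S μ d : ℝ}
    (ha0 : 0 < a) (ha1 : a ≤ 1) (hκ0 : 0 ≤ κ) (hκ1 : κ ≤ 1 / 400)
    (hw2 : w ^ 2 ≤ (1 + 3 * κ) * g ^ 2) (hT : |T - g ^ 2| ≤ κ * g ^ 2) (hS : |S| ≤ κ * g ^ 2)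
    (hE : |E - g ^ 2| ≤ κ * g ^ 2) (hμ : |μ| ≤ κ) (hd : |d| ≤ κ) : (a - 14 * κ) * g ^ 2 ≤
      2 * (a - 1) * w ^ 2 + 2 * T - ((a - 1) * (1 + μ) + (1 + d)) * E - S := by
  have hT1 := (abs_le.1 hT).1
  have hS2 := (abs_le.1 hS).2
  obtain ⟨hE1, hE2⟩ := abs_le.1 hE
  have hf := (abs_le.1 (fa2 ha0 ha1 hμ hd)).2
  have g2 := sq_nonneg g
  clear hT hS hE hμ hd
  generalize g ^ 2 = G at *
  have e1 : (1 - a) * w ^ 2 ≤ (1 - a) * ((1 + 3 * κ) * G) :=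
    mul_le_mul_of_nonneg_left hw2 (by linarith)
  have e2 : (a - 1) * (1 + μ) + (1 + d) ≤ a + 2 * κ := by linarith
  have hκG : κ * G ≤ 1 / 400 * G := mul_le_mul_of_nonneg_right hκ1 g2
  have e0 : 0 ≤ E := by linarith
  have e3 : ((a - 1) * (1 + μ) + (1 + d)) * E ≤ (a + 2 * κ) * ((1 + κ) * G) := by
    apply (mul_le_mul_of_nonneg_right e2 e0).trans
    apply mul_le_mul_of_nonneg_left _ (by linarith)
    linarith
  have e4 : (a + 2 * κ) * (1 + κ) ≤ a + 4 * κ := by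
    nlinarith [mul_nonneg hκ0 (sub_nonneg.2 ha1), mul_nonneg hκ0 (sub_nonneg.2 hκ1)]
  have e5 : (1 - a) * (1 + 3 * κ) ≤ 1 - a + 3 * κ := by nlinarith [mul_nonneg hκ0 ha0.le]
  have e4' := mul_le_mul_of_nonneg_right e4 g2
  have e5' := mul_le_mul_of_nonneg_right e5 g2
  linarith

lemma fa4 {n a κ r g w v c : ℝ} (hn : 2 ≤ n) (hc : c = (n - 1) / 2)
    (ha0 : 0 < a) (ha1 : a ≤ 1) (hκ1 : κ ≤ 1 / 400) (hr0 : 0 < r) (hg : 0 ≤ g)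
    (hw : |w| ≤ (1 + κ) * g) :
    -(n / r) * (v ^ 2 + g ^ 2) ≤ 2 * c * (a - 1) * v * (w / r) := by
  have e1 : |v * w| ≤ v ^ 2 + g ^ 2 := by
    rw [abs_mul]
    have h1 : |w| ≤ 2 * g := hw.trans (by nlinarith)
    have h2 : |v| * |w| ≤ |v| * (2 * g) := mul_le_mul_of_nonneg_left h1 (abs_nonneg _)
    nlinarith [sq_nonneg (|v| - g), sq_abs v]
  have e2 : |2 * c * (a - 1)| ≤ n := by
    rw [abs_le, hc]; constructor <;> nlinarith
  have e3 : 2 * c * (a - 1) * v * (w / r) = (2 * c * (a - 1)) * (v * w) / r := by ring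
  have e4 := abs_mul_le e2 e1
  rw [e3, neg_mul, div_mul_eq_mul_div, ← neg_div]
  apply div_le_div_of_nonneg_right _ hr0.le
  linarith [(abs_le.1 e4).1]

lemma fa5 {a κ r μ d β ν v t p : ℝ}
    (hκ1 : κ ≤ 1 / 400) (hr0 : 0 < r) (hr1 : 25 / (2 * r) ≤ a / 50)
    (hμ : |μ| ≤ κ) (hd : |d| ≤ κ)
    (hβ : 0 ≤ β) (hν : |ν| ≤ 2) (hpdef : p = β ^ 2 * r ^ 2) :
    -(a / 50) * (1 + p) * v ^ 2 ≤
      4 * β * t ^ 2 + 2 * (β * ((ν - 2) * (1 + μ) + (1 + d))) * v * t := by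
  have p0 : 0 ≤ p := by rw [hpdef]; positivity
  have hβp : β ≤ (1 + p) / (2 * r) := by
    rw [le_div_iff₀ (by positivity), hpdef]
    nlinarith [sq_nonneg (β * r - 1)]
  have e0 : |(ν - 2) * (1 + μ) + (1 + d)| ≤ 10 := by
    have h1 : |ν - 2| ≤ 4 := by
      have := abs_le.1 hν
      rw [abs_le]; constructor <;> linarith
    have h2 : |1 + μ| ≤ 2 := by
      have := abs_le.1 hμ
      rw [abs_le]; constructor <;> linarith
    have h3 : |1 + d| ≤ 2 := by
      have := abs_le.1 hd
      rw [abs_le]; constructor <;> linarith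
    have h4 := abs_mul_le h1 h2
    have h5 := abs_add_le ((ν - 2) * (1 + μ)) (1 + d)
    linarith
  generalize (ν - 2) * (1 + μ) + (1 + d) = e at *
  have e3 : e ^ 2 ≤ 100 := by
    have := sq_le_sq' (abs_le.1 e0).1 (abs_le.1 e0).2
    linarith
  have e3' := mul_le_mul_of_nonneg_right e3 (sq_nonneg v)
  have e4 : -25 * v ^ 2 ≤ 4 * t ^ 2 + 2 * e * v * t := by
    have h := sq_nonneg (2 * t + e * v / 2)
    have h2 : (2 * t + e * v / 2) ^ 2 = 4 * t ^ 2 + 2 * e * v * t + e ^ 2 * v ^ 2 / 4 := by ring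
    linarith
  have e5 := mul_le_mul_of_nonneg_left e4 hβ
  have e6 : 25 * β ≤ a / 50 * (1 + p) := by
    have h1 : 25 * ((1 + p) / (2 * r)) = 25 / (2 * r) * (1 + p) := by ring
    have h2 := mul_le_mul_of_nonneg_right hr1 (by linarith : 0 ≤ 1 + p)
    linarith
  have e7 := mul_le_mul_of_nonneg_right e6 (sq_nonneg v)
  linarith

lemma fa6 {a κ μ d ω ν p : ℝ} (ha0 : 0 < a) (ha1 : a ≤ 1) (hκ0 : 0 ≤ κ) (hκ1 : κ ≤ 1 / 400)
    (hμ : |μ| ≤ κ) (hd : |d| ≤ κ) (hω : |ω| ≤ κ) (hν : |ν| ≤ 2) (p0 : 0 ≤ p)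
    (hp : 0 ≤ a / 2 + p * (a / 2 + 2 * ν - 2)) :
    (a / 2 - 32 * κ) * (1 + p) ≤ (p * (1 + μ) + 1) * ((a - 1) * (1 + μ) + (1 + d))
        + 2 * p * (ν - 2) * (1 + μ) ^ 2 + p * (2 + ω) := by
  have e1 : (p * (1 + μ) + 1) * ((a - 1) * (1 + μ) + (1 + d))
      + 2 * p * (ν - 2) * (1 + μ) ^ 2 + p * (2 + ω) = a / 2 * (1 + p) +
      (a / 2 + p * (a / 2 + 2 * ν - 2)) + (p * (μ * a) + (p * (1 + μ) + 1) * ((a - 1) * μ + d)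
      + p * (2 * (ν - 2) * (2 * μ + μ ^ 2)) + p * ω) := by ring
  have f1 : |μ * a| ≤ κ * 1 := abs_mul_le hμ (by rw [abs_of_pos ha0]; exact ha1)
  have f1' := mul_le_mul_of_nonneg_left (abs_le.1 f1).1 p0
  have hm := abs_le.1 hμ
  have hn' := abs_le.1 hν
  have f2 : |(p * (1 + μ) + 1) * ((a - 1) * μ + d)| ≤ (2 * (1 + p)) * (2 * κ) := by
    refine abs_mul_le ?_ (fa2 ha0 ha1 hμ hd)
    have h1 : 0 ≤ p * (1 + μ) := mul_nonneg p0 (by linarith)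
    have h2 : p * (1 + μ) ≤ p * 2 := mul_le_mul_of_nonneg_left (by linarith) p0
    rw [abs_le]; constructor <;> linarith
  have f2' := (abs_le.1 f2).1
  have f3 : |2 * (ν - 2) * (2 * μ + μ ^ 2)| ≤ 8 * (3 * κ) := by
    refine abs_mul_le ?_ ?_
    · rw [abs_le]; constructor <;> linarith
    · have : 2 * μ + μ ^ 2 = μ * (2 + μ) := by ring
      rw [this]
      have := abs_mul_le hμ (show |2 + μ| ≤ 3 by rw [abs_le]; constructor <;> linarith)
      linarith
  have f3' := mul_le_mul_of_nonneg_left (abs_le.1 f3).1 p0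
  have f4 := mul_le_mul_of_nonneg_left (abs_le.1 hω).1 p0
  rw [e1]
  have := mul_nonneg hκ0 p0
  linarith

lemma fa7 {n a κ r g w v F c δ t : ℝ} (hn : 2 ≤ n) (hc : c = (n - 1) / 2)
    (ha0 : 0 < a) (hκ1 : κ ≤ 1 / 400) (hr1 : 1 ≤ r) (hδ : δ = a / (64 * n ^ 2))
    (hw2 : w ^ 2 ≤ (1 + 3 * κ) * g ^ 2) (ht : t = r * w + c * v) :
    -(8 * δ) * g ^ 2 - 2 * n ^ 2 * δ * v ^ 2 - 64 * n ^ 2 / a * (r ^ 2 * F ^ 2) ≤ 2 * t * F := by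
  have hr0 : 0 < r := by linarith
  have hδ0 : 0 < δ := by rw [hδ]; positivity
  have hδi : 64 * n ^ 2 / a = 1 / δ := by rw [hδ]; field_simp
  rw [hδi]
  have e1 : (t / r) ^ 2 ≤ 8 * g ^ 2 + 2 * n ^ 2 * v ^ 2 := by
    have : t / r = w + c * v / r := by rw [ht]; field_simp
    rw [this]
    have h1 : (c * v / r) ^ 2 ≤ n ^ 2 * v ^ 2 := by
      have h0 : (c / r) ^ 2 ≤ n ^ 2 := by
        apply sq_le_sq'
        · have : 0 ≤ c / r := by rw [hc]; apply div_nonneg <;> linarith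
          linarith
        · rw [div_le_iff₀ hr0, hc]
          nlinarith
      calc (c * v / r) ^ 2 = (c / r) ^ 2 * v ^ 2 := by ring
        _ ≤ _ := by gcongr
    have h2 : (1 + 3 * κ) * g ^ 2 ≤ 2 * g ^ 2 := by gcongr; linarith
    have h3 := sq_nonneg g
    have h4 := sq_nonneg (w - c * v / r)
    have h5 : (w + c * v / r) ^ 2 + (w - c * v / r) ^ 2 = 2 * w ^ 2 + 2 * (c * v / r) ^ 2 := by ring
    linarith
  have e2 : 2 * t * F = 2 * (t / r) * (r * F) := by field_simp
  rw [e2]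
  have e3 : r ^ 2 * F ^ 2 = (r * F) ^ 2 := by ring
  rw [e3]
  generalize t / r = y at *
  generalize r * F = f at *
  have e4 : 0 ≤ δ * y ^ 2 + 2 * y * f + 1 / δ * f ^ 2 := by
    have : δ * y ^ 2 + 2 * y * f + 1 / δ * f ^ 2 = δ * (y + f / δ) ^ 2 := by field_simp; ring
    rw [this]; positivity
  have e5 := mul_le_mul_of_nonneg_left e1 hδ0.le
  linarith

lemma far_arith {n a κ r g w T E S μ d ω β ν v F c : ℝ} (hn : 2 ≤ n) (hc : c = (n - 1) / 2)
    (ha0 : 0 < a) (ha1 : a ≤ 1) (hκ0 : 0 ≤ κ) (hκ : κ ≤ a / 400)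
    (hr : (50 * n + 1000) / a ≤ r) (hg : 0 ≤ g)
    (hw : |w| ≤ (1 + κ) * g) (hT : |T - g ^ 2| ≤ κ * g ^ 2) (hS : |S| ≤ κ * g ^ 2)
    (hE : |E - g ^ 2| ≤ κ * g ^ 2) (hμ : |μ| ≤ κ) (hd : |d| ≤ κ) (hω : |ω| ≤ κ)
    (hβ : 0 ≤ β) (hν : |ν| ≤ 2)
    (hp : 0 ≤ a / 2 + (β ^ 2 * r ^ 2) * (a / 2 + 2 * ν - 2)) :
    a / 4 * v ^ 2 - 64 * n ^ 2 / a * (r ^ 2 * F ^ 2) ≤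
      2 * (r * w + c * v) * F + 2 * (a - 1) * w ^ 2 + 2 * T - ((a - 1) * (1 + μ) + (1 + d)) * E - S
      + 2 * c * (a - 1) * v * (w / r) + 4 * β * (r * w + c * v) ^ 2
      + 2 * (β * ((ν - 2) * (1 + μ) + (1 + d))) * v * (r * w + c * v)
      + ((β ^ 2 * r ^ 2 * (1 + μ) + 1) * ((a - 1) * (1 + μ) + (1 + d))
        + 2 * (β ^ 2 * r ^ 2) * (ν - 2) * (1 + μ) ^ 2 + β ^ 2 * r ^ 2 * (2 + ω)) * v ^ 2 := by
  have hr0 : 0 < r := lt_of_lt_of_le (by positivity) hr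
  have hra : 50 * n + 1000 ≤ a * r := by
    rw [div_le_iff₀ ha0] at hr; linarith
  have hr1 : 1 ≤ r := by
    by_contra h; push Not at h
    have : a * r ≤ 1 * 1 := mul_le_mul ha1 h.le hr0.le (by norm_num)
    linarith
  have hκ1 : κ ≤ 1 / 400 := by linarith
  have hw2 := fa1 hκ0 hκ1 hw
  have L1 := fa3 ha0 ha1 hκ0 hκ1 hw2 hT hS hE hμ hd
  have hnr : n / r ≤ a / 50 := by
    rw [div_le_iff₀ hr0]; linarith
  have hr2 : 25 / (2 * r) ≤ a / 50 := by
    rw [div_le_iff₀ (by positivity)]; linarith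
  have L2 := fa4 (v := v) hn hc ha0 ha1 hκ1 hr0 hg hw
  have L3 := fa5 (v := v) (t := r * w + c * v) hκ1 hr0 hr2 hμ hd hβ hν rfl
  have L4 := fa6 ha0 ha1 hκ0 hκ1 hμ hd hω hν (by positivity) hp
  have L5 := fa7 (F := F) (v := v) hn hc ha0 hκ1 hr1 rfl hw2 rfl
  have hδn : a / (64 * n ^ 2) * n ^ 2 = a / 64 := by field_simp
  have hδ0 : 0 < a / (64 * n ^ 2) := by positivity
  have p0 : 0 ≤ β ^ 2 * r ^ 2 := by positivity
  have g2 := sq_nonneg g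
  have v2 := sq_nonneg v
  generalize a / (64 * n ^ 2) = δ at *
  have hδ8 : 8 * δ ≤ a / 32 := by
    have h4 : (4 : ℝ) ≤ n ^ 2 := by nlinarith only [hn]
    have := mul_le_mul_of_nonneg_left h4 hδ0.le
    linarith only [this, hδn]
  have P1 : 0 ≤ (a - 14 * κ - n / r - 8 * δ) * g ^ 2 := by
    apply mul_nonneg _ g2; linarith
  have P2 : a / 4 * v ^ 2 ≤ ((a / 2 - 32 * κ) * (1 + β ^ 2 * r ^ 2) - a / 50 * (1 + β ^ 2 * r ^ 2) - n / r - 2 * n ^ 2 * δ) * v ^ 2 := by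
    apply mul_le_mul_of_nonneg_right _ v2
    have : 0 ≤ (a / 2 - 32 * κ - a / 50) * (β ^ 2 * r ^ 2) := by apply mul_nonneg _ p0; linarith
    linarith
  have L4' := mul_le_mul_of_nonneg_right L4 v2
  linarith

lemma na1 {l K0 K σ g T E S m D q : ℝ} (hl : 0 < l) (hK0 : 1 ≤ K0)
    (hK : K * l ^ 2 = 4 * K0 ^ 2 + 1) (hKp : 0 < K)
    (hT : |T| ≤ K0 * g ^ 2) (hS : |S| ≤ K0 * g ^ 2)
    (hE : |E| ≤ K0 * g ^ 2) (hEl : l * g ^ 2 ≤ E)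
    (hD : |D| ≤ K0) (hq : q = m / σ) (hq1 : l ≤ q) :
    g ^ 2 ≤ 2 * T - ((-K / σ) * m + D) * E - S := by
  have e : ((-K / σ) * m + D) * E = -(K * (q * E)) + D * E := by rw [hq]; ring
  have e1 : l ^ 2 * g ^ 2 ≤ q * E := by
    have : l * (l * g ^ 2) ≤ q * E := mul_le_mul hq1 hEl (by positivity) (hl.le.trans hq1)
    linarith
  have e2 : D * E ≤ K0 * (K0 * g ^ 2) := (le_abs_self _).trans (abs_mul_le hD hE)
  have e3 := mul_le_mul_of_nonneg_left e1 hKp.le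
  have e4 : K * (l ^ 2 * g ^ 2) = (4 * K0 ^ 2 + 1) * g ^ 2 := by rw [← hK]; ring
  rw [e]
  have h1 : K0 * g ^ 2 ≤ K0 ^ 2 * g ^ 2 := by
    apply mul_le_mul_of_nonneg_right _ (sq_nonneg g); nlinarith
  have := (abs_le.1 hT).1
  have := (abs_le.1 hS).2
  linarith

lemma na2 {K0 K σ V t v c : ℝ} (hKp : 0 < K) (si : 1 / σ ≤ 1)
    (hc : |c| ≤ K0) (ht : t = V + c * v) :
    -(4 * K) * t ^ 2 - 4 * K * K0 ^ 2 * v ^ 2 ≤ 2 * (-K / σ) * V ^ 2 := by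
  have e : 2 * (-K / σ) * V ^ 2 = -(2 * K * ((1 / σ) * V ^ 2)) := by ring
  have e1 : (1 / σ) * V ^ 2 ≤ 1 * V ^ 2 := mul_le_mul_of_nonneg_right si (sq_nonneg V)
  have e2 : V ^ 2 ≤ 2 * t ^ 2 + 2 * (c * v) ^ 2 := by
    have := sq_nonneg (V + 2 * (c * v))
    have h2 : V ^ 2 + (V + 2 * (c * v)) ^ 2 = 2 * (V + c * v) ^ 2 + 2 * (c * v) ^ 2 := by ring
    rw [ht]; linarith
  have e3 : c ^ 2 ≤ K0 ^ 2 := sq_le_sq' (abs_le.1 hc).1 (abs_le.1 hc).2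
  have e4 : (c * v) ^ 2 ≤ K0 ^ 2 * v ^ 2 := by rw [mul_pow]; gcongr
  have e5 : (1 / σ) * V ^ 2 ≤ 2 * t ^ 2 + 2 * (K0 ^ 2 * v ^ 2) := by linarith
  have e6 := mul_le_mul_of_nonneg_left e5 (by positivity : 0 ≤ 2 * K)
  rw [e]; linarith

lemma na3 {K0 K σ g V v c : ℝ} (hKp : 0 < K) (si : 1 / σ ≤ 1) (si0 : 0 < 1 / σ)
    (hV : |V| ≤ K0 * g) (hc : |c| ≤ K0) :
    -g ^ 2 - K0 ^ 4 * K ^ 2 * v ^ 2 ≤ 2 * c * (-K / σ) * v * V := by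
  have e : 2 * c * (-K / σ) * v * V = -(2 * K * ((1 / σ) * (c * (v * V)))) := by ring
  have e1 : |(1 / σ) * (c * (v * V))| ≤ 1 * (K0 * (|v| * (K0 * g))) := by
    refine abs_mul_le ?_ (abs_mul_le hc (abs_mul_le le_rfl hV))
    rw [abs_of_pos si0]; exact si
  have e2 := (abs_le.1 e1).2
  rw [e]
  have e3 := mul_le_mul_of_nonneg_left e2 (by positivity : 0 ≤ 2 * K)
  have e4 := sq_nonneg (g - K0 ^ 2 * K * |v|)
  have e5 : (g - K0 ^ 2 * K * |v|) ^ 2 = g ^ 2 - 2 * K * (1 * (K0 * (|v| * (K0 * g)))) + K0 ^ 4 * K ^ 2 * |v| ^ 2 := by ring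
  rw [sq_abs] at e5
  linarith

lemma na5 {K0 γ σ t m D β v q : ℝ} (hγ1 : 0 < γ - 1)
    (hD : |D| ≤ K0) (hβ1 : 1 ≤ β) (hβ3 : 9 * γ ^ 2 * K0 ^ 2 ≤ β)
    (hq : q = m / σ) (hq0 : 0 ≤ q) (hq2 : q ≤ K0) :
    -(β * t ^ 2) - β ^ 2 * v ^ 2 ≤ 2 * ((2 * (γ - 1) * β / σ) * m + β * D) * v * t := by
  have e : 2 * ((2 * (γ - 1) * β / σ) * m + β * D) * v * t
      = β * (2 * (2 * (γ - 1) * q + D) * v * t) := by rw [hq]; ring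
  have x1 : |2 * (γ - 1) * q + D| ≤ 3 * γ * K0 := by
    have h1 : |2 * (γ - 1) * q| ≤ (2 * (γ - 1)) * K0 := by
      refine abs_mul_le ?_ ?_
      · rw [abs_of_pos (by linarith)]
      · rw [abs_of_nonneg hq0]; exact hq2
    have h2 := abs_add_le (2 * (γ - 1) * q) D
    have h3 : 0 ≤ γ * K0 := mul_nonneg (by linarith) (hq0.trans hq2)
    linarith
  rw [e]
  generalize 2 * (γ - 1) * q + D = X at *
  have x2 : X ^ 2 ≤ 9 * γ ^ 2 * K0 ^ 2 := by
    have := sq_le_sq' (abs_le.1 x1).1 (abs_le.1 x1).2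
    have h : (3 * γ * K0) ^ 2 = 9 * γ ^ 2 * K0 ^ 2 := by ring
    linarith
  have x3 : -(t ^ 2) - X ^ 2 * v ^ 2 ≤ 2 * X * v * t := by
    have := sq_nonneg (t + X * v)
    have h : (t + X * v) ^ 2 = t ^ 2 + 2 * X * v * t + X ^ 2 * v ^ 2 := by ring
    linarith
  have x4 : X ^ 2 * v ^ 2 ≤ β * v ^ 2 := by gcongr; linarith
  have x5 : -(t ^ 2) - β * v ^ 2 ≤ 2 * X * v * t := by linarith
  have := mul_le_mul_of_nonneg_left x5 (by linarith : 0 ≤ β)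
  linarith

lemma na6 {l K0 K γ σ m D M β q : ℝ} (hl : 0 < l) (hK0 : 1 ≤ K0) (hKp : 0 < K) (hγ1 : 0 < γ - 1)
    (hγ : 4 * (γ - 1) * l ^ 2 = 2 * K0 ^ 2 * (K + 1) + K0 + 3)
    (hlm : l ≤ m) (hm : m ≤ K0)
    (hD : |D| ≤ K0) (hM : |M| ≤ K0) (hβ1 : 1 ≤ β)
    (hq : q = m / σ) (hq1 : l ≤ q) (hq2 : q ≤ K0) :
    3 * β ^ 2 ≤ (β ^ 2 * m + 1) * ((-K / σ) * m + D)
        + 2 * β * (2 * (γ - 1) * β / σ) * m ^ 2 + β ^ 2 * M := by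
  have e : (β ^ 2 * m + 1) * ((-K / σ) * m + D)
      + 2 * β * (2 * (γ - 1) * β / σ) * m ^ 2 + β ^ 2 * M
      = (β ^ 2 * m + 1) * (-(K * q) + D) + β ^ 2 * (4 * (γ - 1) * (q * m) + M) := by
    rw [hq]; ring
  have hD1 := (abs_le.1 hD).1
  have hM1 := (abs_le.1 hM).1
  have b2 : 1 ≤ β ^ 2 := by nlinarith
  have e1 : -(K0 * (K + 1)) ≤ -(K * q) + D := by
    have := mul_le_mul_of_nonneg_left hq2 hKp.le
    linarith
  have e2 : β ^ 2 * m + 1 ≤ 2 * K0 * β ^ 2 := by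
    have h1 : β ^ 2 * m ≤ β ^ 2 * K0 := by gcongr
    have h2 : 1 * 1 ≤ K0 * β ^ 2 := mul_le_mul hK0 b2 (by norm_num) (by linarith)
    linarith
  have hm0 : 0 ≤ m := hl.le.trans hlm
  have e3 : -(2 * K0 ^ 2 * (K + 1) * β ^ 2) ≤ (β ^ 2 * m + 1) * (-(K * q) + D) := by
    have h0 : 0 ≤ β ^ 2 * m + 1 := by positivity
    have h1 := mul_le_mul_of_nonneg_left e1 h0
    have h2 := mul_le_mul_of_nonneg_right e2 (by positivity : 0 ≤ K0 * (K + 1))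
    linarith
  have e4 : l ^ 2 ≤ q * m := by
    have : l * l ≤ q * m := mul_le_mul hq1 hlm hl.le (hl.le.trans hq1)
    linarith
  have e5 := mul_le_mul_of_nonneg_left e4 (by positivity : 0 ≤ 4 * (γ - 1))
  rw [e]
  have e6 : β ^ 2 * (2 * K0 ^ 2 * (K + 1) + 3) ≤ β ^ 2 * (4 * (γ - 1) * (q * m) + M) := by
    apply mul_le_mul_of_nonneg_left _ (by linarith)
    linarith
  linarith

lemma near_arith {l K0 K γ σ g V t T E S m D M β v F c : ℝ} (hl : 0 < l) (hK0 : 1 ≤ K0)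
    (hK : K * l ^ 2 = 4 * K0 ^ 2 + 1) (hγ : 4 * (γ - 1) * l ^ 2 = 2 * K0 ^ 2 * (K + 1) + K0 + 3)
    (hσ : 1 ≤ σ) (hV : |V| ≤ K0 * g) (hT : |T| ≤ K0 * g ^ 2) (hS : |S| ≤ K0 * g ^ 2)
    (hE : |E| ≤ K0 * g ^ 2) (hEl : l * g ^ 2 ≤ E) (hml : l * σ ≤ m) (hm : m ≤ K0)
    (hD : |D| ≤ K0) (hM : |M| ≤ K0) (hc : |c| ≤ K0) (ht : t = V + c * v)
    (hβ1 : 1 ≤ β) (hβ2 : 4 * K ≤ β) (hβ3 : 9 * γ ^ 2 * K0 ^ 2 ≤ β)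
    (hβ4 : 4 * K * K0 ^ 2 + K0 ^ 4 * K ^ 2 ≤ β) :
    v ^ 2 - F ^ 2 ≤ 2 * t * F + 2 * (-K / σ) * V ^ 2 + 2 * T - ((-K / σ) * m + D) * E - S
      + 2 * c * (-K / σ) * v * V + 4 * β * t ^ 2
      + 2 * ((2 * (γ - 1) * β / σ) * m + β * D) * v * t
      + ((β ^ 2 * m + 1) * ((-K / σ) * m + D)
        + 2 * β * (2 * (γ - 1) * β / σ) * m ^ 2 + β ^ 2 * M) * v ^ 2 := by
  have hσ0 : 0 < σ := by linarith
  have l2 : 0 < l ^ 2 := by positivity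
  have hKp : 0 < K := by
    by_contra h; push Not at h
    have h1 : K * l ^ 2 ≤ 0 := mul_nonpos_of_nonpos_of_nonneg h l2.le
    have := sq_nonneg K0
    linarith
  have hγ1 : 0 < γ - 1 := by
    by_contra h; push Not at h
    have h1 : (γ - 1) * l ^ 2 ≤ 0 := mul_nonpos_of_nonpos_of_nonneg h l2.le
    have : 0 ≤ 2 * K0 ^ 2 * (K + 1) := by positivity
    linarith
  have hq1 : l ≤ m / σ := by rw [le_div_iff₀ hσ0]; exact hml
  have hlm : l ≤ m := (le_mul_of_one_le_right hl.le hσ).trans hml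
  have hq2 : m / σ ≤ K0 := (div_le_self (hl.le.trans hlm) hσ).trans hm
  have si : 1 / σ ≤ 1 := by rw [div_le_one hσ0]; exact hσ
  have si0 : 0 < 1 / σ := by positivity
  have L1 := na1 (σ := σ) hl hK0 hK hKp hT hS hE hEl hD rfl hq1
  have L2 := na2 hKp si hc ht
  have L3 := na3 (v := v) hKp si si0 hV hc
  have L4 : -t ^ 2 - F ^ 2 ≤ 2 * t * F := by nlinarith only [sq_nonneg (t + F)]
  have L5 := na5 (t := t) (v := v) (σ := σ) hγ1 hD hβ1 hβ3 rfl (hl.le.trans hq1) hq2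
  have L6 := na6 hl hK0 hKp hγ1 hγ hlm hm hD hM hβ1 rfl hq1 hq2
  have v2 := sq_nonneg v
  have t2 := sq_nonneg t
  have L6' := mul_le_mul_of_nonneg_right L6 v2
  have b2 : β ≤ β ^ 2 := by nlinarith only [hβ1]
  have L7 : (4 * K * K0 ^ 2 + K0 ^ 4 * K ^ 2) * v ^ 2 ≤ β ^ 2 * v ^ 2 := by gcongr; linarith
  have L8 : 1 * v ^ 2 ≤ β ^ 2 * v ^ 2 := by gcongr; linarith
  have L9 : 4 * K * t ^ 2 ≤ β * t ^ 2 := by gcongr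
  have L10 : 1 * t ^ 2 ≤ β * t ^ 2 := by gcongr
  have b0 : 0 ≤ β * t ^ 2 := by positivity
  linarith

/-! ### Carleman estimates -/

section carl
variable {n : ℕ} {A : En n → Matrix (Fin n) (Fin n) ℝ} {lam α C : ℝ} {v : En n → ℝ} {x : En n}

lemma ED_cd (hA : EllipticDecay A lam α C) (hx : x ∈ OmegaExt n) (i j : Fin n) :
    ContDiffAt ℝ 1 (fun y => A y i j) x :=
  (hA.2.1 i j).contDiffAt ((isOpen_OmegaExt n).mem_nhds hx)

lemma ED_b1 (hA : EllipticDecay A lam α C) (hx : x ∈ OmegaExt n) (i j : Fin n) :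
    |A x i j - if i = j then 1 else 0| ≤ C * ‖x‖ ^ (-α) := by
  have h := hA.2.2.2 x hx i j
  have h2 : (A x - 1) i j = A x i j - if i = j then 1 else 0 := by
    rw [Matrix.sub_apply, Matrix.one_apply]
  rw [h2] at h
  have : 0 ≤ ‖x‖ * ‖gradient (fun y => (A y - 1) i j) x‖ := by positivity
  linarith

lemma ED_b2 (hA : EllipticDecay A lam α C) (hx : x ∈ OmegaExt n) (l i j : Fin n) :
    ‖x‖ * |pd l (fun y => A y i j) x| ≤ C * ‖x‖ ^ (-α) := by
  have h := hA.2.2.2 x hx i j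
  have h2 : pd l (fun y => A y i j) x = gradient (fun y => (A y - 1) i j) x l := by
    rw [gradient_coord]
    have : (fun y => (A y - 1) i j) = fun y => A y i j - (1 : Matrix (Fin n) (Fin n) ℝ) i j := by
      ext y; rw [Matrix.sub_apply]
    rw [this, pd_sub ((ED_cd hA hx i j).differentiableAt (by norm_num)) (differentiableAt_const _),
      pd_const, sub_zero]
  have h3 := coord_le (gradient (fun y => (A y - 1) i j) x) l
  rw [← h2] at h3
  have h4 := mul_le_mul_of_nonneg_left h3 (norm_nonneg x)
  have := abs_nonneg ((A x - 1) i j)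
  linarith

lemma quad_Ef : quadForm (A x) (WithLp.toLp 2 fun i => pd i v x) (WithLp.toLp 2 fun i => pd i v x)
    = Ef A v x := by
  simp [quadForm, Ef, gv, Matrix.mulVec, dotProduct]

lemma quad_mf : quadForm (A x) x x = mf A x := by
  simp [quadForm, mf, Nv, Matrix.mulVec, dotProduct]

lemma ED_Ef (hA : EllipticDecay A lam α C) (hx : x ∈ OmegaExt n) :
    lam * gn v x ^ 2 ≤ Ef A v x := by
  have h := (hA.2.2.1 x hx (WithLp.toLp 2 fun i => pd i v x)).1
  rw [quad_Ef, normsq_eq] at h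
  rw [gn_sq]
  exact h

lemma ED_mf (hA : EllipticDecay A lam α C) (hx : x ∈ OmegaExt n) :
    lam * ‖x‖ ^ 2 ≤ mf A x := by
  have h := (hA.2.2.1 x hx x).1
  rwa [quad_mf] at h

variable {φ β H z : En n → ℝ} {U : Set (En n)}

lemma far_point (hn : 2 ≤ n) (hA : EllipticDecay A lam α C) (hU : IsOpen U) (hx : x ∈ U)
    (hUO : U ⊆ OmegaExt n) {a η ν c : ℝ} (ha0 : 0 < a) (ha1 : a ≤ 1) (hη : C * ‖x‖ ^ (-α) ≤ η)
    (hη1 : 10 * ((n : ℝ) + 1) ^ 4 * η ≤ a / 400) (hr : (50 * (n : ℝ) + 1000) / a ≤ ‖x‖)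
    (hφ : ∀ y ∈ U, ContDiffAt ℝ 2 φ y) (hz : ContDiff ℝ 2 z)
    (h1 : ∀ y ∈ U, ∀ i, pd i φ y = β y * y i) (hβ : ContDiffAt ℝ 1 β x) (hH : ContDiffAt ℝ 1 H x)
    (hH1 : ∀ i, pd i H x = (a - 1) * H x / ‖x‖ ^ 2 * x i)
    (hβ1 : ∀ i, pd i β x = (ν - 2) * β x / ‖x‖ ^ 2 * x i)
    (hH0 : 0 ≤ H x) (hβ0 : 0 ≤ β x) (hν : |ν| ≤ 2)
    (hp : 0 ≤ a / 2 + (β x ^ 2 * ‖x‖ ^ 2) * (a / 2 + 2 * ν - 2)) (hc : c = ((n : ℝ) - 1) / 2) :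
    a / 4 * (H x * Real.exp (φ x) ^ 2) * z x ^ 2
      - 64 * (n : ℝ) ^ 2 / a * (H x * ‖x‖ ^ 2 * Real.exp (φ x) ^ 2) * (Lop A z x + z x) ^ 2
    ≤ ∑ i, pd i (Pf A (fun y => Real.exp (φ y) * z y) H β c i) x := by
  have hxO := hUO hx
  have hcdA := ED_cd hA hxO
  have hr0 : 0 < ‖x‖ := lt_trans one_pos hxO
  have hη0 : 0 ≤ η := by
    have i : Fin n := ⟨0, by omega⟩
    exact (abs_nonneg _).trans ((ED_b1 hA hxO i i).trans hη)
  have hn0 : (0 : ℝ) ≤ n := Nat.cast_nonneg n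
  have hηone : η ≤ 1 := by
    have h4 : 1 ≤ ((n : ℝ) + 1) ^ 4 := one_le_pow₀ (by linarith)
    have := mul_le_mul_of_nonneg_right h4 hη0
    linarith
  obtain ⟨b1, b2, b3, b4, b5, b6, b7⟩ := far_bounds (v := fun y => Real.exp (φ y) * z y) hcdA hη0 hηone
    (fun i j => (ED_b1 hA hxO i j).trans hη) (fun l i j => (ED_b2 hA hxO l i j).trans hη) rfl
  rw [point_id hU hx hcdA (hA.1 x hxO) hφ hz h1 hβ hH _ _ c hH1 hβ1 _ rfl _ _ rfl rfl]
  generalize 10 * ((n : ℝ) + 1) ^ 4 * η = κ at *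
  have hκ0 : 0 ≤ κ := (abs_nonneg _).trans b5
  set v := fun y => Real.exp (φ y) * z y with hv
  have hsq : 0 < ‖x‖ ^ 2 := by positivity
  have key := far_arith (n := n) (κ := κ) (r := ‖x‖) (g := gn v x) (w := Vf A v x / ‖x‖) (T := Tf A v x)
    (E := Ef A v x) (S := Sf A v x) (μ := mf A x / ‖x‖ ^ 2 - 1) (d := Df A x - n)
    (ω := Mf A x / ‖x‖ ^ 2 - 2) (β := β x) (ν := ν) (v := v x)
    (F := Real.exp (φ x) * (Lop A z x + z x)) (by exact_mod_cast hn) hc ha0 ha1 hκ0 hη1 hr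
    gn_nonneg ?_ b2 b3 b4 ?_ b5 ?_ hβ0 hν hp
  · have key2 := mul_le_mul_of_nonneg_left key hH0
    refine le_trans (le_of_eq ?_) (key2.trans (le_of_eq ?_))
    · rw [hv]; ring
    · have hne := hr0.ne'
      generalize Vf A v x = V
      generalize Tf A v x = T
      generalize Ef A v x = E
      generalize Sf A v x = S
      generalize mf A x = m
      generalize Mf A x = M
      generalize Df A x = D
      generalize Real.exp (φ x) * (Lop A z x + z x) = F
      have hvx : Real.exp (φ x) * z x = v x := rfl
      try rw [hvx]
      generalize v x = v0
      generalize ‖x‖ = r at *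
      generalize H x = h
      generalize β x = b
      rw [hc]
      field_simp
      ring
  · rw [abs_div, abs_of_pos hr0, div_le_iff₀ hr0]
    linarith
  · have : mf A x / ‖x‖ ^ 2 - 1 = (mf A x - ‖x‖ ^ 2) / ‖x‖ ^ 2 := by field_simp
    rw [this, abs_div, abs_of_pos hsq, div_le_iff₀ hsq]
    exact b6
  · have : Mf A x / ‖x‖ ^ 2 - 2 = (Mf A x - 2 * ‖x‖ ^ 2) / ‖x‖ ^ 2 := by field_simp
    rw [this, abs_div, abs_of_pos hsq, div_le_iff₀ hsq]
    exact b7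

lemma near_point (hA : EllipticDecay A lam α C) (hU : IsOpen U) (hx : x ∈ U)
    (hUO : U ⊆ OmegaExt n) (hlam : 0 < lam) {K0 K γ c : ℝ} (hK0 : 1 ≤ K0)
    (hK : K * lam ^ 2 = 4 * K0 ^ 2 + 1) (hγ : 4 * (γ - 1) * lam ^ 2 = 2 * K0 ^ 2 * (K + 1) + K0 + 3)
    (hφ : ∀ y ∈ U, ContDiffAt ℝ 2 φ y) (hz : ContDiff ℝ 2 z)
    (h1 : ∀ y ∈ U, ∀ i, pd i φ y = β y * y i) (hβ : ContDiffAt ℝ 1 β x) (hH : ContDiffAt ℝ 1 H x)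
    (hH1 : ∀ i, pd i H x = -K * H x / ‖x‖ ^ 2 * x i)
    (hβ1 : ∀ i, pd i β x = 2 * (γ - 1) * β x / ‖x‖ ^ 2 * x i)
    (hH0 : 0 ≤ H x) (hc : |c| ≤ K0)
    (bV : ∀ v : En n → ℝ, |Vf A v x| ≤ K0 * gn v x) (bT : ∀ v : En n → ℝ, |Tf A v x| ≤ K0 * gn v x ^ 2)
    (bS : ∀ v : En n → ℝ, |Sf A v x| ≤ K0 * gn v x ^ 2) (bE : ∀ v : En n → ℝ, |Ef A v x| ≤ K0 * gn v x ^ 2)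
    (bD : |Df A x - 2 * c| ≤ K0) (bM : |Mf A x| ≤ K0) (bm : mf A x ≤ K0)
    (hb1 : 1 ≤ β x) (hb2 : 4 * K ≤ β x) (hb3 : 9 * γ ^ 2 * K0 ^ 2 ≤ β x)
    (hb4 : 4 * K * K0 ^ 2 + K0 ^ 4 * K ^ 2 ≤ β x) :
    (H x * Real.exp (φ x) ^ 2) * z x ^ 2
      - (H x * Real.exp (φ x) ^ 2) * (Lop A z x + z x) ^ 2
    ≤ ∑ i, pd i (Pf A (fun y => Real.exp (φ y) * z y) H β c i) x := by
  have hxO := hUO hx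
  have hcdA := ED_cd hA hxO
  have hr0 : 1 < ‖x‖ := hxO
  rw [point_id hU hx hcdA (hA.1 x hxO) hφ hz h1 hβ hH _ _ c hH1 hβ1 _ rfl _ _ rfl rfl]
  set v := fun y => Real.exp (φ y) * z y with hv
  have key := near_arith (v := v x) (F := Real.exp (φ x) * (Lop A z x + z x)) hlam hK0 hK hγ
    (one_le_pow₀ (n := 2) hr0.le) (bV v) (bT v) (bS v) (bE v) (ED_Ef hA hxO) (ED_mf hA hxO) bm bD bM hc rfl
    hb1 hb2 hb3 hb4
  have key2 := mul_le_mul_of_nonneg_left key hH0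
  refine le_trans (le_of_eq ?_) (key2.trans (le_of_eq ?_))
  · rw [hv]; ring
  · ring

end carl

/-! ### Radial weights and the integrated Carleman estimates -/

section weights
variable {n : ℕ} {A : En n → Matrix (Fin n) (Fin n) ℝ} {lam α C : ℝ} {x : En n}

lemma pd_radial {f : ℝ → ℝ} {f' : ℝ} (hf : HasDerivAt f f' (‖x‖ ^ 2)) (i : Fin n) :
    pd i (fun y => f (‖y‖ ^ 2)) x = f' * (2 * x i) := by
  rw [pd_comp (f := fun y : En n => ‖y‖ ^ 2) hf
    ((contDiff_normsq (k := 1)).contDiffAt.differentiableAt (by norm_num)), pd_normsq]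

lemma cd_radial {k : WithTop ℕ∞} {f : ℝ → ℝ} (hf : ContDiffAt ℝ k f (‖x‖ ^ 2)) :
    ContDiffAt ℝ k (fun y : En n => f (‖y‖ ^ 2)) x :=
  ContDiffAt.comp (g := f) (f := fun y : En n => ‖y‖ ^ 2) x hf contDiff_normsq.contDiffAt

lemma cd_rpow {k : WithTop ℕ∞} {s l : ℝ} (hs : 0 < s) : ContDiffAt ℝ k (fun t : ℝ => t ^ l) s :=
  Real.contDiffAt_rpow_const_of_ne hs.ne'

lemma hd_rpow {s l : ℝ} (hs : 0 < s) : HasDerivAt (fun t : ℝ => t ^ l) (l * (s ^ l / s)) s := by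
  have := Real.hasDerivAt_rpow_const (p := l) (Or.inl hs.ne')
  rwa [Real.rpow_sub_one hs.ne'] at this

/-- The far Carleman phase, as a function of `σ = |x|²`. -/
def fphi (τ ε l s : ℝ) : ℝ := τ * s ^ l / (1 + ε * s ^ l)

def fbeta (τ ε l s : ℝ) : ℝ := 2 * (l * τ * (s ^ l / s) / (1 + ε * s ^ l) ^ 2)

variable {τ ε l s : ℝ}

lemma fden (hs : 0 < s) (hε : 0 ≤ ε) : 0 < 1 + ε * s ^ l := by
  have := Real.rpow_pos_of_pos hs l
  positivity

lemma hd_fphi (hs : 0 < s) (hε : 0 ≤ ε) : HasDerivAt (fphi τ ε l) (fbeta τ ε l s / 2) s := by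
  have h := fden (l := l) hs hε
  have h1 := ((hd_rpow (l := l) hs).const_mul τ).div (((hd_rpow (l := l) hs).const_mul ε).const_add 1) h.ne'
  refine h1.congr_deriv ?_
  unfold fbeta
  field_simp
  ring

lemma hd_fbeta (hs : 0 < s) (hε : 0 ≤ ε) : HasDerivAt (fbeta τ ε l)
    (((2 * l - 4 * l * (ε * s ^ l / (1 + ε * s ^ l))) - 2) * fbeta τ ε l s / s / 2) s := by
  have h := fden (l := l) hs hε
  have h2 := (hd_rpow (l := l) hs).div (hasDerivAt_id s) hs.ne'
  have h1 := ((h2.const_mul (l * τ)).div ((((hd_rpow (l := l) hs).const_mul ε).const_add 1).pow 2)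
    (pow_ne_zero 2 h.ne')).const_mul 2
  refine (h1.congr_deriv ?_)
  unfold fbeta
  simp only [id, Pi.div_apply, Nat.cast_ofNat, Nat.add_one_sub_one, pow_one, Pi.pow_apply]
  have := hs.ne'
  have := h.ne'
  field_simp
  ring

lemma cd_fphi {k : WithTop ℕ∞} (hs : 0 < s) (hε : 0 ≤ ε) : ContDiffAt ℝ k (fphi τ ε l) s :=
  (contDiffAt_const.mul (cd_rpow hs)).div (contDiffAt_const.add (contDiffAt_const.mul (cd_rpow hs)))
    (fden hs hε).ne'

lemma cd_fbeta {k : WithTop ℕ∞} (hs : 0 < s) (hε : 0 ≤ ε) : ContDiffAt ℝ k (fbeta τ ε l) s :=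
  contDiffAt_const.mul ((contDiffAt_const.mul ((cd_rpow hs).div contDiffAt_id hs.ne')).div
    ((contDiffAt_const.add (contDiffAt_const.mul (cd_rpow hs))).pow 2) (pow_ne_zero 2 (fden hs hε).ne'))

lemma fphi_le (hs : 0 < s) (hε : 0 < ε) (hτ : 0 ≤ τ) : fphi τ ε l s ≤ τ / ε := by
  unfold fphi
  rw [div_le_div_iff₀ (fden hs hε.le) hε]
  nlinarith

lemma fphi_mono {s1 s2 : ℝ} (hs : 0 < s1) (h : s1 ≤ s2) (hε : 0 ≤ ε) (hε1 : ε ≤ 1) (hτ : 0 ≤ τ) (hl : 0 ≤ l) :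
    τ * ((s2 ^ l - s1 ^ l) / (1 + s2 ^ l) ^ 2) ≤ fphi τ ε l s2 - fphi τ ε l s1 := by
  have h1 := Real.rpow_pos_of_pos hs l
  have h2 := Real.rpow_pos_of_pos (hs.trans_le h) l
  have h3 : s1 ^ l ≤ s2 ^ l := Real.rpow_le_rpow hs.le h hl
  unfold fphi
  generalize s1 ^ l = y1 at *
  generalize s2 ^ l = y2 at *
  have e : τ * y2 / (1 + ε * y2) - τ * y1 / (1 + ε * y1)
      = τ * ((y2 - y1) / ((1 + ε * y2) * (1 + ε * y1))) := by
    field_simp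
    ring
  rw [e]
  apply mul_le_mul_of_nonneg_left _ hτ
  apply div_le_div_of_nonneg_left (by linarith) (by positivity)
  rw [sq]
  have e1 : ε * y2 ≤ 1 * y2 := by gcongr
  have e2 : ε * y1 ≤ 1 * y2 := by gcongr
  gcongr <;> linarith

lemma far_hp {a : ℝ} (ha0 : 0 < a) (ha1 : a ≤ 1) (hl : 2 * l = 1 - a / 8) (hτ : 0 ≤ τ) :
    ∃ ε, 0 < ε ∧ ε ≤ 1 ∧ ∀ s : ℝ, 0 < s →
      0 ≤ a / 2 + (fbeta τ ε l s ^ 2 * s) *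
        (a / 2 + 2 * (2 * l - 4 * l * (ε * s ^ l / (1 + ε * s ^ l))) - 2) := by
  have hl0 : 0 < l := by linarith
  have ht : Tendsto (fun s : ℝ => τ ^ 2 * s ^ (-(a / 8))) atTop (nhds (τ ^ 2 * 0)) :=
    (tendsto_rpow_neg_atTop (by positivity)).const_mul _
  rw [mul_zero] at ht
  obtain ⟨S0, hS0⟩ := (ht.eventually (ge_mem_nhds (show (0 : ℝ) < a / 8 by positivity))).exists_forall_of_atTop
  set S1 := max S0 1 with hS1
  have hS1p : 0 < S1 := by positivity
  have hy := Real.rpow_pos_of_pos hS1p l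
  refine ⟨min 1 (a / 16 / S1 ^ l), by positivity, min_le_left _ _, fun s hs => ?_⟩
  set ε := min 1 (a / 16 / S1 ^ l)
  have hε0 : 0 < ε := by positivity
  have hεS : ε * S1 ^ l ≤ a / 16 := by
    rw [← le_div_iff₀ hy]; exact min_le_right _ _
  have hd := fden (l := l) hs hε0.le
  have hsl := Real.rpow_pos_of_pos hs l
  set q := ε * s ^ l / (1 + ε * s ^ l) with hq
  have hq0 : 0 ≤ q := by positivity
  have hq1 : q ≤ 1 := by rw [hq, div_le_one hd]; linarith
  have hp0 : 0 ≤ fbeta τ ε l s ^ 2 * s := by positivity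
  rcases le_total s S1 with h | h
  · have : ε * s ^ l ≤ ε * S1 ^ l := by
      gcongr
    have hq2 : q ≤ a / 16 := by
      refine le_trans (div_le_self (by positivity) ?_) (this.trans hεS)
      have : 0 < ε * s ^ l := by positivity
      linarith
    have h3 : 4 * l * q ≤ a / 8 := by
      have : 4 * l * q ≤ 2 * (a / 16) := mul_le_mul (by linarith) hq2 hq0 (by norm_num)
      linarith
    have : 0 ≤ a / 2 + 2 * (2 * l - 4 * l * q) - 2 := by linarith
    positivity
  · have hp1 : fbeta τ ε l s ^ 2 * s ≤ a / 8 := by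
      refine le_trans ?_ (hS0 s ((le_max_left _ _).trans h))
      have e1 : s ^ (-(a / 8)) = (s ^ l / s) ^ 2 * s := by
        have : -(a / 8) = l + l - 1 := by linarith
        rw [this, Real.rpow_sub_one hs.ne', Real.rpow_add hs]
        field_simp
      rw [e1, ← mul_assoc, ← mul_pow]
      apply mul_le_mul_of_nonneg_right _ hs.le
      have h0 : 0 ≤ fbeta τ ε l s := by unfold fbeta; positivity
      have : fbeta τ ε l s ≤ τ * (s ^ l / s) := by
        unfold fbeta
        have h1 : l * τ * (s ^ l / s) / (1 + ε * s ^ l) ^ 2 ≤ l * τ * (s ^ l / s) := by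
          apply div_le_self (by positivity)
          apply one_le_pow₀
          have : 0 < ε * s ^ l := by positivity
          linarith
        have h2 : 2 * l * (τ * (s ^ l / s)) ≤ 1 * (τ * (s ^ l / s)) := by
          gcongr; linarith
        linarith
      gcongr
    have h3 : -4 ≤ a / 2 + 2 * (2 * l - 4 * l * q) - 2 := by
      have : l * q ≤ l * 1 := by gcongr
      linarith
    have := mul_le_mul_of_nonneg_left h3 hp0
    linarith

theorem carleman_far (hn : 2 ≤ n) (hA : EllipticDecay A lam α C) (hα : 0 < α) {a : ℝ}
    (ha0 : 0 < a) (ha1 : a ≤ 1) (hl : 2 * l = 1 - a / 8) :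
    ∃ R0 : ℝ, 1 ≤ R0 ∧ ∀ τ : ℝ, 0 ≤ τ → ∃ ε : ℝ, 0 < ε ∧ ε ≤ 1 ∧ ∀ z : En n → ℝ, ContDiff ℝ 2 z →
      HasCompactSupport z → tsupport z ⊆ {x | R0 < ‖x‖} →
      ∫ x, a / 4 * ((‖x‖ ^ 2) ^ ((a - 1) / 2) * Real.exp (fphi τ ε l (‖x‖ ^ 2)) ^ 2) * z x ^ 2 ≤
      ∫ x, 64 * (n : ℝ) ^ 2 / a * ((‖x‖ ^ 2) ^ ((a - 1) / 2) * ‖x‖ ^ 2 *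
        Real.exp (fphi τ ε l (‖x‖ ^ 2)) ^ 2) * (Lop A z x + z x) ^ 2 := by
  have hl0 : 0 < l := by linarith
  have ht : Tendsto (fun s : ℝ => C * s ^ (-α)) atTop (nhds (C * 0)) :=
    (tendsto_rpow_neg_atTop hα).const_mul _
  rw [mul_zero] at ht
  have hη0 : 0 < a / 400 / (10 * ((n : ℝ) + 1) ^ 4) := by positivity
  obtain ⟨S0, hS0⟩ := (ht.eventually (ge_mem_nhds hη0)).exists_forall_of_atTop
  refine ⟨max (max S0 ((50 * (n : ℝ) + 1000) / a)) 1, le_max_right _ _, fun τ hτ => ?_⟩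
  set R0 := max (max S0 ((50 * (n : ℝ) + 1000) / a)) 1 with hR0
  obtain ⟨ε, hε0, hε1, hp⟩ := far_hp ha0 ha1 hl hτ
  refine ⟨ε, hε0, hε1, fun z hz hzc hzU => ?_⟩
  have hUO : {x : En n | R0 < ‖x‖} ⊆ OmegaExt n := fun x (hx : R0 < ‖x‖) =>
    (lt_of_le_of_lt (le_max_right _ _) hx : 1 < ‖x‖)
  have hU : IsOpen {x : En n | R0 < ‖x‖} := isOpen_lt continuous_const continuous_norm
  have hpos : ∀ x ∈ {x : En n | R0 < ‖x‖}, 0 < ‖x‖ ^ 2 := fun x hx => by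
    have : 1 < ‖x‖ := hUO hx
    positivity
  have c1 : ∀ x ∈ {x : En n | R0 < ‖x‖}, ContDiffAt ℝ 2 (fun y : En n => fphi τ ε l (‖y‖ ^ 2)) x :=
    fun x hx => cd_radial (cd_fphi (hpos x hx) hε0.le)
  have c2 : ∀ x ∈ {x : En n | R0 < ‖x‖}, ContDiffAt ℝ 1 (fun y : En n => fbeta τ ε l (‖y‖ ^ 2)) x :=
    fun x hx => cd_radial (cd_fbeta (hpos x hx) hε0.le)
  have c3 : ∀ x ∈ {x : En n | R0 < ‖x‖}, ContDiffAt ℝ 1 (fun y : En n => (‖y‖ ^ 2) ^ ((a - 1) / 2)) x :=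
    fun x hx => cd_radial (f := fun t => t ^ ((a - 1) / 2)) (cd_rpow (hpos x hx))
  have d1 : ContinuousOn (fun y : En n => fphi τ ε l (‖y‖ ^ 2)) {x : En n | R0 < ‖x‖} :=
    fun x hx => (c1 x hx).continuousAt.continuousWithinAt
  have d3 : ContinuousOn (fun y : En n => (‖y‖ ^ 2) ^ ((a - 1) / 2)) {x : En n | R0 < ‖x‖} :=
    fun x hx => (c3 x hx).continuousAt.continuousWithinAt
  have d4 : ContinuousOn (fun y : En n => ‖y‖ ^ 2) {x : En n | R0 < ‖x‖} :=
    contDiff_normsq (k := 0) |>.continuous.continuousOn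
  refine carleman_abs (β := fun y : En n => fbeta τ ε l (‖y‖ ^ 2))
    (φ := fun y : En n => fphi τ ε l (‖y‖ ^ 2)) (H := fun y : En n => (‖y‖ ^ 2) ^ ((a - 1) / 2)) hU
    (fun x hx => ED_cd hA (hUO hx)) c1 hz hzc hzU c2 c3 (((n : ℝ) - 1) / 2) _ _ ?_ ?_ ?_
  · exact continuousOn_const.mul (d3.mul (d1.rexp.pow 2))
  · exact continuousOn_const.mul ((d3.mul d4).mul (d1.rexp.pow 2))
  · intro x hx
    have hxU := hzU hx
    have hs := hpos x hxU
    have hxR : R0 < ‖x‖ := hxU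
    have hb0 : 0 ≤ fbeta τ ε l (‖x‖ ^ 2) := by
      have := Real.rpow_pos_of_pos hs l
      unfold fbeta
      positivity
    refine far_point (ν := 2 * l - 4 * l * (ε * (‖x‖ ^ 2) ^ l / (1 + ε * (‖x‖ ^ 2) ^ l))) hn hA hU hxU hUO
      ha0 ha1 (hS0 _ ?_) (le_of_eq ?_) ?_ c1 hz ?_ (c2 x hxU) (c3 x hxU) ?_ ?_ ?_ hb0 ?_ (hp _ hs) rfl
    · exact ((le_max_left _ _).trans (le_max_left _ _)).trans hxR.le
    · field_simp
    · exact ((le_max_right _ _).trans (le_max_left _ _)).trans hxR.le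
    · intro y hy i
      rw [pd_radial (hd_fphi (hpos y hy) hε0.le)]
      ring
    · intro i
      rw [pd_radial (f := fun t => t ^ ((a - 1) / 2)) (hd_rpow hs)]
      ring
    · intro i
      rw [pd_radial (hd_fbeta hs hε0.le)]
      ring
    · have := Real.rpow_pos_of_pos hs ((a - 1) / 2)
      positivity
    · have h1 := Real.rpow_pos_of_pos hs l
      have hd := fden (l := l) hs hε0.le
      have hq0 : 0 ≤ ε * (‖x‖ ^ 2) ^ l / (1 + ε * (‖x‖ ^ 2) ^ l) := by positivity
      have hq1 : ε * (‖x‖ ^ 2) ^ l / (1 + ε * (‖x‖ ^ 2) ^ l) ≤ 1 := by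
        rw [div_le_one hd]; linarith
      have e1 := mul_le_mul_of_nonneg_left hq1 hl0.le
      have e2 := mul_nonneg hl0.le hq0
      rw [abs_le]; constructor <;> linarith

end weights

section nearw
variable {n : ℕ} {A : En n → Matrix (Fin n) (Fin n) ℝ} {lam α C : ℝ} {x : En n}

lemma hd_nbeta {s γ τ : ℝ} (hs : 0 < s) : HasDerivAt (fun t : ℝ => 2 * γ * τ * (t ^ γ / t))
    (2 * (γ - 1) * (2 * γ * τ * (s ^ γ / s)) / s / 2) s := by
  have h2 := ((hd_rpow (l := γ) hs).div (hasDerivAt_id s) hs.ne').const_mul (2 * γ * τ)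
  refine h2.congr_deriv ?_
  simp only [id]
  field_simp

lemma near_K0 (hA : EllipticDecay A lam α C) (hα : 0 < α) (hC : 0 < C) {R1 : ℝ} (hR1 : 1 < R1) (c : ℝ) :
    ∃ K0 : ℝ, 1 ≤ K0 ∧ |c| ≤ K0 ∧ ∀ x : En n, x ∈ OmegaExt n → ‖x‖ ≤ R1 →
    (∀ v : En n → ℝ, |Vf A v x| ≤ K0 * gn v x) ∧ (∀ v : En n → ℝ, |Tf A v x| ≤ K0 * gn v x ^ 2) ∧
    (∀ v : En n → ℝ, |Sf A v x| ≤ K0 * gn v x ^ 2) ∧ (∀ v : En n → ℝ, |Ef A v x| ≤ K0 * gn v x ^ 2) ∧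
    |Df A x - 2 * c| ≤ K0 ∧ |Mf A x| ≤ K0 ∧ mf A x ≤ K0 := by
  set M := 1 + C with hM
  have hM0 : 0 < M := by linarith
  have hR0 : 0 < R1 := by linarith
  set k1 := n * (n * (M * R1)) with hk1
  set k2 := n * (n * ((n * M) * (n * (M * R1) + M))) with hk2
  set k3 := n * ((n * (M * R1)) * (n * (n * M))) with hk3
  set k4 := n * (n * M) with hk4
  set k5 := n * (n * (M * R1) + M) with hk5
  set k6 := n * ((n * (M * R1)) * R1) with hk6
  set k7 := n * ((n * (M * R1)) * (n * ((n * (M * R1) + M) * R1) + n * (M * R1))) with hk7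
  have p1 : 0 ≤ k1 := by positivity
  have p2 : 0 ≤ k2 := by positivity
  have p3 : 0 ≤ k3 := by positivity
  have p4 : 0 ≤ k4 := by positivity
  have p5 : 0 ≤ k5 := by positivity
  have p6 : 0 ≤ k6 := by positivity
  have p7 : 0 ≤ k7 := by positivity
  have pc := abs_nonneg c
  refine ⟨1 + 2 * |c| + k1 + k2 + k3 + k4 + k5 + k6 + k7, by linarith, by linarith, fun x hx hxR => ?_⟩
  have hx1 : 1 < ‖x‖ := hx
  have hdec : C * ‖x‖ ^ (-α) ≤ C := by
    have : ‖x‖ ^ (-α) ≤ 1 := Real.rpow_le_one_of_one_le_of_nonpos hx1.le (by linarith)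
    nlinarith
  have b1 : ∀ i j, |A x i j| ≤ M := fun i j => by
    have h1 := ED_b1 hA hx i j
    have h2 := abs_add_le (A x i j - if i = j then 1 else 0) (if i = j then 1 else 0)
    rw [sub_add_cancel] at h2
    have h3 : |(if i = j then 1 else 0 : ℝ)| ≤ 1 := by split_ifs <;> simp
    linarith
  have b2 : ∀ l i j, |pd l (fun y => A y i j) x| ≤ M := fun l i j => by
    have h1 := ED_b2 hA hx l i j
    have h2 := le_mul_of_one_le_left (abs_nonneg (pd l (fun y => A y i j) x)) hx1.le
    linarith
  have B := fun v : En n → ℝ => near_bounds (v := v) (ED_cd hA hx) hM0.le b1 b2 hxR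
  refine ⟨fun v => (B v).1.trans ?_, fun v => (B v).2.1.trans ?_, fun v => (B v).2.2.1.trans ?_,
    fun v => (B v).2.2.2.1.trans ?_, ?_, (B 0).2.2.2.2.2.2.trans ?_,
    ((le_abs_self _).trans (B 0).2.2.2.2.2.1).trans ?_⟩
  · exact mul_le_mul_of_nonneg_right (by linarith) gn_nonneg
  · exact mul_le_mul_of_nonneg_right (by linarith) (sq_nonneg _)
  · exact mul_le_mul_of_nonneg_right (by linarith) (sq_nonneg _)
  · exact mul_le_mul_of_nonneg_right (by linarith) (sq_nonneg _)
  · have h1 := (B 0).2.2.2.2.1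
    have h2 := abs_sub (Df A x) (2 * c)
    rw [abs_mul, abs_two] at h2
    linarith
  · linarith
  · linarith

theorem carleman_near (hlam : 0 < lam) (hA : EllipticDecay A lam α C) (hα : 0 < α) (hC : 0 < C)
    {R1 : ℝ} (hR1 : 1 < R1) :
    ∃ K γ τ0 : ℝ, 1 ≤ γ ∧ 0 < τ0 ∧ ∀ τ : ℝ, τ0 ≤ τ → ∀ z : En n → ℝ, ContDiff ℝ 2 z →
      HasCompactSupport z → tsupport z ⊆ {x | 1 < ‖x‖ ∧ ‖x‖ < R1} →
      ∫ x, ((‖x‖ ^ 2) ^ (-K / 2) * Real.exp (τ * (‖x‖ ^ 2) ^ γ) ^ 2) * z x ^ 2 ≤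
      ∫ x, ((‖x‖ ^ 2) ^ (-K / 2) * Real.exp (τ * (‖x‖ ^ 2) ^ γ) ^ 2) * (Lop A z x + z x) ^ 2 := by
  obtain ⟨K0, hK0, hcK, hb⟩ := near_K0 hA hα hC hR1 0
  have hl2 : 0 < lam ^ 2 := by positivity
  obtain ⟨K, hK⟩ : ∃ K : ℝ, K * lam ^ 2 = 4 * K0 ^ 2 + 1 :=
    ⟨(4 * K0 ^ 2 + 1) / lam ^ 2, by field_simp⟩
  have hKp : 0 < K := by
    by_contra h; push Not at h
    have h1 : K * lam ^ 2 ≤ 0 := mul_nonpos_of_nonpos_of_nonneg h hl2.le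
    have := sq_nonneg K0
    linarith
  obtain ⟨γ, hγ⟩ : ∃ γ : ℝ, 4 * (γ - 1) * lam ^ 2 = 2 * K0 ^ 2 * (K + 1) + K0 + 3 :=
    ⟨(2 * K0 ^ 2 * (K + 1) + K0 + 3) / (4 * lam ^ 2) + 1, by field_simp; ring⟩
  have hγ1 : 1 ≤ γ := by
    by_contra h; push Not at h
    have h1 : (γ - 1) * lam ^ 2 ≤ 0 := mul_nonpos_of_nonpos_of_nonneg (by linarith) hl2.le
    have : 0 ≤ 2 * K0 ^ 2 * (K + 1) := by positivity
    linarith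
  refine ⟨K, γ, 1 + 4 * K + 9 * γ ^ 2 * K0 ^ 2 + (4 * K * K0 ^ 2 + K0 ^ 4 * K ^ 2), hγ1, by positivity,
    fun τ hτ z hz hzc hzU => ?_⟩
  have q1 : 0 ≤ 9 * γ ^ 2 * K0 ^ 2 := by positivity
  have q2 : 0 ≤ 4 * K * K0 ^ 2 + K0 ^ 4 * K ^ 2 := by positivity
  have hτ0 : 0 < τ := by linarith
  set U := {x : En n | 1 < ‖x‖ ∧ ‖x‖ < R1} with hUdef
  have hUO : U ⊆ OmegaExt n := fun x hx => hx.1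
  have hU : IsOpen U := (isOpen_lt continuous_const continuous_norm).inter
    (isOpen_lt continuous_norm continuous_const)
  have hpos : ∀ x ∈ U, 0 < ‖x‖ ^ 2 := fun x hx => by
    have : 1 < ‖x‖ := hx.1
    positivity
  have c1 : ∀ x ∈ U, ContDiffAt ℝ 2 (fun y : En n => τ * (‖y‖ ^ 2) ^ γ) x :=
    fun x hx => cd_radial (f := fun t => τ * t ^ γ) (contDiffAt_const.mul (cd_rpow (hpos x hx)))
  have c2 : ∀ x ∈ U, ContDiffAt ℝ 1 (fun y : En n => 2 * γ * τ * ((‖y‖ ^ 2) ^ γ / ‖y‖ ^ 2)) x :=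
    fun x hx => cd_radial (f := fun t => 2 * γ * τ * (t ^ γ / t))
      (contDiffAt_const.mul ((cd_rpow (hpos x hx)).div contDiffAt_id (hpos x hx).ne'))
  have c3 : ∀ x ∈ U, ContDiffAt ℝ 1 (fun y : En n => (‖y‖ ^ 2) ^ (-K / 2)) x :=
    fun x hx => cd_radial (f := fun t => t ^ (-K / 2)) (cd_rpow (hpos x hx))
  have d1 : ContinuousOn (fun y : En n => τ * (‖y‖ ^ 2) ^ γ) U :=
    fun x hx => (c1 x hx).continuousAt.continuousWithinAt
  have d3 : ContinuousOn (fun y : En n => (‖y‖ ^ 2) ^ (-K / 2)) U :=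
    fun x hx => (c3 x hx).continuousAt.continuousWithinAt
  refine carleman_abs (β := fun y : En n => 2 * γ * τ * ((‖y‖ ^ 2) ^ γ / ‖y‖ ^ 2))
    (φ := fun y : En n => τ * (‖y‖ ^ 2) ^ γ) (H := fun y : En n => (‖y‖ ^ 2) ^ (-K / 2)) hU
    (fun x hx => ED_cd hA (hUO hx)) c1 hz hzc hzU c2 c3 0 _ _ (d3.mul (d1.rexp.pow 2))
    (d3.mul (d1.rexp.pow 2)) ?_
  intro x hx
  have hxU := hzU hx
  have hs := hpos x hxU
  have hxR : ‖x‖ < R1 := hxU.2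
  have hbig : τ ≤ 2 * γ * τ * ((‖x‖ ^ 2) ^ γ / ‖x‖ ^ 2) := by
    have h1 : 1 ≤ ‖x‖ ^ 2 := one_le_pow₀ hxU.1.le
    have h2 : ‖x‖ ^ 2 ≤ (‖x‖ ^ 2) ^ γ := Real.self_le_rpow_of_one_le h1 hγ1
    have h3 : 1 ≤ (‖x‖ ^ 2) ^ γ / ‖x‖ ^ 2 := by rwa [le_div_iff₀ hs, one_mul]
    have h4 : 1 * τ * 1 ≤ 2 * γ * τ * ((‖x‖ ^ 2) ^ γ / ‖x‖ ^ 2) := by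
      gcongr; linarith
    linarith
  obtain ⟨f1, f2, f3, f4, f5, f6, f7⟩ := hb x (hUO hxU) hxR.le
  refine near_point (γ := γ) (K := K) hA hU hxU hUO hlam hK0 hK hγ c1 hz ?_ (c2 x hxU) (c3 x hxU) ?_ ?_ ?_ hcK
    f1 f2 f3 f4 f5 f6 f7 ?_ ?_ ?_ ?_
  · intro y hy i
    rw [pd_radial (f := fun t => τ * t ^ γ) ((hd_rpow (hpos y hy)).const_mul τ)]
    ring
  · intro i
    rw [pd_radial (f := fun t => t ^ (-K / 2)) (hd_rpow hs)]
    ring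
  · intro i
    rw [pd_radial (f := fun t => 2 * γ * τ * (t ^ γ / t)) (hd_nbeta hs)]
    ring
  · have := Real.rpow_pos_of_pos hs (-K / 2)
    positivity
  all_goals linarith

end nearw

section P8
variable {n : ℕ} {f g : En n → ℝ} {i : Fin n} {x : En n}

/-- Convolution. -/
def Mol (f g : En n → ℝ) (x : En n) : ℝ := ∫ t, f t * g (x - t)

lemma Mol_eq (f g : En n → ℝ) :
    Mol f g = convolution f g (ContinuousLinearMap.lsmul ℝ ℝ) volume := by
  ext x
  simp [Mol, convolution]

lemma Mol_comm (f g : En n → ℝ) (x : En n) : Mol f g x = Mol g f x := by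
  unfold Mol
  rw [← integral_sub_left_eq_self (fun t => f t * g (x - t)) volume x]
  congr 1; ext t; simp [mul_comm]

lemma Mol_smooth (hf : Continuous f) (hg : ContDiff ℝ (⊤ : ℕ∞) g) (hc : HasCompactSupport g) :
    ContDiff ℝ (⊤ : ℕ∞) (Mol f g) := by
  rw [Mol_eq]
  exact hc.contDiff_convolution_right _ hf.locallyIntegrable hg

lemma pd_Mol (hf : Continuous f) (hg : ContDiff ℝ 1 g) (hc : HasCompactSupport g) (i : Fin n) (x : En n) :
    pd i (Mol f g) x = Mol f (pd i g) x := by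
  rw [Mol_eq, Mol_eq, pd, (hc.hasFDerivAt_convolution_right (ContinuousLinearMap.lsmul ℝ ℝ)
    hf.locallyIntegrable hg x).fderiv, convolution_precompR_apply _ hf.locallyIntegrable
    (hc.fderiv ℝ) (hg.continuous_fderiv (by norm_num))]
  rfl

lemma cs_pd (hc : HasCompactSupport g) : HasCompactSupport (pd i g) :=
  IsCompact.of_isClosed_subset hc (isClosed_tsupport _) tsupport_pd

lemma cont_pd (hg : ContDiff ℝ 1 g) : Continuous (pd i g) :=
  continuous_iff_continuousAt.2 fun x => hg.contDiffAt.pd0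

lemma pd_Mol_left (hf : ContDiff ℝ 1 f) (hcf : HasCompactSupport f) (hg : Continuous g)
    (i : Fin n) (x : En n) :
    pd i (Mol f g) x = Mol (pd i f) g x := by
  rw [show Mol f g = Mol g f from funext fun y => Mol_comm f g y, pd_Mol hg hf hcf, Mol_comm]

/-- Mollifier predicate. -/
structure IsMol (B δ : ℝ) (ρ : En n → ℝ) : Prop where
  sm : ContDiff ℝ (⊤ : ℕ∞) ρ
  cs : HasCompactSupport ρ
  nn : ∀ x, 0 ≤ ρ x
  supp : Function.support ρ ⊆ ball 0 δ
  one : ∫ x, ρ x = 1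
  bd : ∀ i, ∫ x, |pd i ρ x| ≤ B / δ

lemma IsMol.close {B δ ε c : ℝ} {ρ : En n → ℝ} (h : IsMol B δ ρ) (hε : 0 ≤ ε) (hf : Continuous f)
    (hc : ∀ t ∈ ball x δ, |f t - c| ≤ ε) : |Mol f ρ x - c| ≤ ε := by
  rw [Mol_comm, Mol_eq]
  exact dist_convolution_le hε h.supp h.nn h.one hf.aestronglyMeasurable hc

lemma exists_mol (n : ℕ) : ∃ B : ℝ, 0 ≤ B ∧ ∀ δ > 0, ∃ ρ : En n → ℝ, IsMol B δ ρ := by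
  let b : ContDiffBump (0 : En n) := ⟨1/2, 1, by norm_num, by norm_num⟩
  set r : En n → ℝ := b.normed volume with hr
  have hrs : ContDiff ℝ (⊤ : ℕ∞) r := b.contDiff_normed
  have hrc : HasCompactSupport r := b.hasCompactSupport_normed
  have hr1 : ∫ x, r x = 1 := b.integral_normed
  have hrn : ∀ x, 0 ≤ r x := fun x => b.nonneg_normed x
  have hrp : Function.support r = ball 0 1 := b.support_normed_eq
  refine ⟨∑ i, ∫ x, |pd i r x|, Finset.sum_nonneg fun i _ => integral_nonneg fun x => abs_nonneg _, ?_⟩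
  intro δ hδ
  have hd : Module.finrank ℝ (En n) = n := by simp
  have hpd : ∀ i x, pd i (fun y => (δ ^ n)⁻¹ * r (δ⁻¹ • y)) x = (δ ^ n)⁻¹ * (δ⁻¹ * pd i r (δ⁻¹ • x)) := by
    intro i x
    have h1 : HasFDerivAt r (fderiv ℝ r (δ⁻¹ • x)) (δ⁻¹ • x) :=
      ((hrs.differentiable (by simp)) _).hasFDerivAt
    have h2 : HasFDerivAt (fun y : En n => δ⁻¹ • y) (δ⁻¹ • ContinuousLinearMap.id ℝ (En n)) x :=
      (hasFDerivAt_id x).const_smul δ⁻¹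
    have h3 := (h1.comp x h2).const_mul ((δ ^ n)⁻¹)
    unfold pd
    have h4 := h3.fderiv
    simp only [Function.comp_def] at h4
    rw [h4]
    simp
  refine ⟨fun y => (δ ^ n)⁻¹ * r (δ⁻¹ • y), ?_, ?_, ?_, ?_, ?_, ?_⟩
  · exact contDiff_const.mul (hrs.comp (contDiff_const_smul _))
  · have := hrc.comp_smul (inv_ne_zero hδ.ne')
    exact this.mul_left
  · intro x; have := hrn (δ⁻¹ • x); positivity
  · intro x hx
    have : δ⁻¹ • x ∈ Function.support r := by
      intro h0; apply hx; simp [h0]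
    rw [hrp, mem_ball_zero_iff, norm_smul, norm_inv, Real.norm_of_nonneg hδ.le, inv_mul_lt_iff₀ hδ] at this
    simpa using this
  · rw [integral_const_mul, Measure.integral_comp_inv_smul, hr1, hd, abs_of_pos (by positivity)]
    have : δ ^ n ≠ 0 := by positivity
    simp [this]
  · intro i
    simp_rw [hpd, abs_mul]
    rw [integral_const_mul, integral_const_mul, Measure.integral_comp_inv_smul volume (fun x => |pd i r x|), hd]
    have h0 : δ ^ n ≠ 0 := by positivity
    rw [abs_of_pos (by positivity : 0 < δ ^ n), abs_of_pos (by positivity : 0 < (δ ^ n)⁻¹),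
      abs_of_pos (by positivity : 0 < δ⁻¹), smul_eq_mul]
    have : ∫ x, |pd i r x| ≤ ∑ i, ∫ x, |pd i r x| :=
      Finset.single_le_sum (f := fun i => ∫ x, |pd i r x|)
        (fun i _ => integral_nonneg fun x => abs_nonneg _) (Finset.mem_univ i)
    calc _ = (∫ x, |pd i r x|) / δ := by field_simp
      _ ≤ _ := by gcongr

lemma cs_sub (hc : HasCompactSupport g) (x : En n) : HasCompactSupport (fun t => g (x - t)) :=
  hc.comp_homeomorph (Homeomorph.subLeft x)

/-- Friedrichs commutator estimate. -/
lemma fried_comm {B δ ε₁ ε₂ L : ℝ} {ρ a G : En n → ℝ} (h : IsMol B δ ρ) (hδ : 0 < δ) (hε₁ : 0 ≤ ε₁)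
    (hε₂ : 0 ≤ ε₂) (hL : 0 ≤ L)
    (ha : ContDiff ℝ 1 a) (hac : HasCompactSupport a) (hG : Continuous G)
    (hLip : ∀ t, |a x - a t| ≤ L * ‖x - t‖)
    (h1 : ∀ t ∈ ball x δ, |pd i a t - pd i a x| ≤ ε₁) (h2 : ∀ t ∈ ball x δ, |G t - G x| ≤ ε₂) :
    |(∫ t, (a x - a t) * G t * pd i ρ (x - t)) + pd i a x * G x| ≤ |G x| * ε₁ + L * B * ε₂ := by
  have hρ1 : ContDiff ℝ 1 ρ := h.sm.of_le (by exact_mod_cast le_top)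
  have hpc : Continuous (fun t => pd i ρ (x - t)) := (cont_pd hρ1).comp (by fun_prop)
  have hps : HasCompactSupport (fun t => pd i ρ (x - t)) := cs_sub (cs_pd h.cs) x
  have hinteg : ∀ F : En n → ℝ, Continuous F → Integrable (fun t => F t * pd i ρ (x - t)) := fun F hF =>
    (hF.mul hpc).integrable_of_hasCompactSupport hps.mul_left
  have hac' := ha.continuous
  have e0 : ∫ t, pd i ρ (x - t) = 0 := by
    rw [integral_sub_left_eq_self (fun t => pd i ρ t)]
    exact integral_pd_zero hρ1 h.cs
  have e1 : ∫ t, a t * pd i ρ (x - t) = Mol (pd i a) ρ x := by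
    rw [← pd_Mol_left ha hac hρ1.continuous, pd_Mol hac' hρ1 h.cs]; rfl
  have e2 : ∫ t, (a x - a t) * G t * pd i ρ (x - t) = - (G x * Mol (pd i a) ρ x) +
      ∫ t, (a x - a t) * (G t - G x) * pd i ρ (x - t) := by
    have : ∀ t, (a x - a t) * G t * pd i ρ (x - t) = (G x * a x * pd i ρ (x - t) - G x * (a t * pd i ρ (x - t)))
        + (a x - a t) * (G t - G x) * pd i ρ (x - t) := fun t => by ring
    simp_rw [this]
    rw [integral_add, integral_sub, integral_const_mul, integral_const_mul, e0, e1]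
    · ring
    · exact hinteg (fun _ => G x * a x) continuous_const
    · exact (hinteg a hac').const_mul _
    · exact (hinteg (fun _ => G x * a x) continuous_const).sub ((hinteg a hac').const_mul _)
    · exact hinteg (fun t => (a x - a t) * (G t - G x)) (by fun_prop)
  have b1 : |Mol (pd i a) ρ x - pd i a x| ≤ ε₁ := h.close hε₁ (cont_pd ha) h1
  have b2 : |∫ t, (a x - a t) * (G t - G x) * pd i ρ (x - t)| ≤ L * B * ε₂ := by
    have hi : Integrable (fun t => L * δ * ε₂ * |pd i ρ (x - t)|) :=
      (((hinteg (fun _ => 1) continuous_const).norm).const_mul (L * δ * ε₂)).congr (by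
        filter_upwards with t; simp)
    refine (abs_integral_le_integral_abs).trans ((integral_mono (hinteg (fun t => (a x - a t) * (G t - G x)) (by fun_prop)).norm hi ?_).trans ?_)
    · intro t
      by_cases ht : t ∈ ball x δ
      · simp only [Real.norm_eq_abs, abs_mul]
        have h3 : |a x - a t| ≤ L * δ := (hLip t).trans (by
          have : ‖x - t‖ ≤ δ := by
            rw [mem_ball, dist_comm, dist_eq_norm] at ht; exact ht.le
          gcongr)
        have := h2 t ht
        gcongr
      · have : pd i ρ (x - t) = 0 := by
          by_contra hne
          have hm : (x - t) ∈ tsupport ρ := by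
            by_contra hh; exact hne (pd_zero_of_notMem hh)
          have hne2 : pd i ρ (x - t) ∈ ({0}ᶜ : Set ℝ) := hne
          -- neighbourhood argument
          have hop : IsOpen {y | pd i ρ y ≠ 0} := isOpen_ne_fun (cont_pd hρ1) continuous_const
          have hts : {y | pd i ρ y ≠ 0} ⊆ closedBall 0 δ := by
            intro y hy
            have hyt : y ∈ tsupport ρ := by
              by_contra hh; exact hy (pd_zero_of_notMem hh)
            exact closure_minimal (h.supp.trans ball_subset_closedBall) isClosed_closedBall hyt
          have hin : (x - t) ∈ interior (closedBall (0 : En n) δ) := interior_maximal hts hop hne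
          rw [interior_closedBall _ hδ.ne'] at hin
          apply ht
          rw [mem_ball_zero_iff] at hin
          rw [mem_ball, dist_comm, dist_eq_norm]; exact hin
        simp [this]
    · rw [integral_const_mul, integral_sub_left_eq_self (fun t => |pd i ρ t|)]
      calc L * δ * ε₂ * ∫ t, |pd i ρ t| ≤ L * δ * ε₂ * (B / δ) := by gcongr; exact h.bd i
        _ = _ := by field_simp
  rw [e2]
  have : -(G x * Mol (pd i a) ρ x) + (∫ t, (a x - a t) * (G t - G x) * pd i ρ (x - t)) + pd i a x * G x
    = - (G x * (Mol (pd i a) ρ x - pd i a x)) + ∫ t, (a x - a t) * (G t - G x) * pd i ρ (x - t) := by ring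
  rw [this]
  refine (abs_add_le _ _).trans (add_le_add ?_ b2)
  rw [abs_neg, abs_mul]
  gcongr
end P8

section P9
variable {n : ℕ} {f g u : En n → ℝ} {i : Fin n} {x : En n}
variable {A : En n → Matrix (Fin n) (Fin n) ℝ} {lam α C : ℝ}

lemma unif_small (hf : Continuous f) (hc : HasCompactSupport f) {η : ℝ} (hη : 0 < η) :
    ∀ᶠ δ in nhdsWithin (0:ℝ) (Set.Ioi 0), ∀ x, ∀ t ∈ ball x δ, |f t - f x| ≤ η := by
  have h := Metric.uniformContinuous_iff.1 (hc.uniformContinuous_of_continuous hf) η hη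
  obtain ⟨d, hd, h⟩ := h
  filter_upwards [Ioo_mem_nhdsGT hd] with δ hδ x t ht
  have := h (a := t) (b := x) (lt_trans ht hδ.2)
  exact this.le

lemma term_small {a G : En n → ℝ} {B : ℝ} (hB : 0 ≤ B) (ha : ContDiff ℝ 1 a) (hac : HasCompactSupport a)
    (hG : Continuous G) (hGc : HasCompactSupport G) (i : Fin n) {η : ℝ} (hη : 0 < η) :
    ∀ᶠ δ in nhdsWithin (0:ℝ) (Set.Ioi 0), ∀ ρ, IsMol B δ ρ → ∀ x,
      |pd i a x * Mol G ρ x + ∫ t, (a x - a t) * G t * pd i ρ (x - t)| ≤ η := by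
  obtain ⟨M1, hM1⟩ := (cs_pd (i := i) hac).exists_bound_of_continuous (cont_pd ha)
  obtain ⟨M2, hM2⟩ := hGc.exists_bound_of_continuous hG
  obtain ⟨L, hL⟩ := ha.lipschitzWith_of_hasCompactSupport hac one_ne_zero
  have hM1' : 0 ≤ M1 := (norm_nonneg _).trans (hM1 0)
  have hM2' : 0 ≤ M2 := (norm_nonneg _).trans (hM2 0)
  have hL0 : (0:ℝ) ≤ L := L.2
  set θ : ℝ := η / (1 + M1 + M2 + L * B) with hθ
  have hden : 0 < 1 + M1 + M2 + L * B := by positivity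
  have hθ0 : 0 < θ := by positivity
  filter_upwards [unif_small (cont_pd (i := i) ha) (cs_pd hac) hθ0, unif_small hG hGc hθ0,
    self_mem_nhdsWithin] with δ h1 h2 hδ ρ hρ x
  have e1 := fried_comm (i := i) (x := x) hρ hδ hθ0.le hθ0.le hL0 ha hac hG (fun t => by
    have := hL.dist_le_mul x t; rwa [Real.dist_eq, dist_eq_norm] at this) (h1 x) (h2 x)
  have e2 := hρ.close hθ0.le hG (h2 x)
  have : pd i a x * Mol G ρ x + ∫ t, (a x - a t) * G t * pd i ρ (x - t)
    = pd i a x * (Mol G ρ x - G x) + ((∫ t, (a x - a t) * G t * pd i ρ (x - t)) + pd i a x * G x) := by ring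
  rw [this]
  have b1 : |pd i a x| ≤ M1 := hM1 x
  have b2 : |G x| ≤ M2 := hM2 x
  calc _ ≤ |pd i a x| * |Mol G ρ x - G x| + |(∫ t, (a x - a t) * G t * pd i ρ (x - t)) + pd i a x * G x| := by
        rw [← abs_mul]; exact abs_add_le _ _
    _ ≤ M1 * θ + (M2 * θ + L * B * θ) := by
        refine add_le_add (by gcongr) (e1.trans (by gcongr))
    _ ≤ (1 + M1 + M2 + L * B) * θ := by nlinarith only [hθ0]
    _ = η := by rw [hθ]; field_simp

/-- Smooth cutoff. -/
lemma exists_cutoff {K U : Set (En n)} (hK : IsCompact K) (hU : IsOpen U) (hKU : K ⊆ U) :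
    ∃ ζ : En n → ℝ, ∃ d > 0, ContDiff ℝ (⊤ : ℕ∞) ζ ∧ HasCompactSupport ζ ∧ tsupport ζ ⊆ U ∧
      (∀ x ∈ thickening d K, ζ x = 1) ∧ (∀ x, 0 ≤ ζ x) ∧ ∀ x, ζ x ≤ 1 := by
  obtain ⟨d, hd, hdU⟩ := hK.exists_cthickening_subset_open hU hKU
  have hdis : Disjoint (thickening d K)ᶜ (cthickening (d/2) K) := by
    rw [Set.disjoint_compl_left_iff_subset]
    exact cthickening_subset_thickening' hd (by linarith) K
  obtain ⟨f, f0, f1, f2⟩ := exists_contMDiffMap_zero_one_of_isClosed (n := (⊤ : ℕ∞))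
    (modelWithCornersSelf ℝ (En n)) isOpen_thickening.isClosed_compl isClosed_cthickening hdis
  have hts : tsupport f ⊆ cthickening d K := by
    refine closure_minimal (fun x hx => ?_) isClosed_cthickening
    by_contra h
    exact hx (f0 (fun hh => h (thickening_subset_cthickening _ _ hh)))
  refine ⟨f, d/2, by linarith, f.contMDiff.contDiff, ?_, hts.trans hdU, ?_, fun x => (f2 x).1, fun x => (f2 x).2⟩
  · exact hK.cthickening.of_isClosed_subset (isClosed_tsupport _) hts
  · exact fun x hx => f1 (thickening_subset_cthickening _ _ hx)

lemma cd_cut {k : WithTop ℕ∞} {ζ : En n → ℝ} {U : Set (En n)} (hζ : ContDiff ℝ k ζ) (ht : tsupport ζ ⊆ U)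
    (hf : ∀ x ∈ U, ContDiffAt ℝ k f x) : ContDiff ℝ k (fun x => ζ x * f x) := by
  refine contDiff_of_supp fun x hx => ?_
  exact hζ.contDiffAt.mul (hf x (ht (closure_mono (Function.support_mul_subset_left _ _) hx)))

lemma WS_cd (hu : WeakSol A u) (hx : x ∈ OmegaExt n) : ContDiffAt ℝ 1 u x :=
  hu.1.contDiffAt ((isOpen_OmegaExt n).mem_nhds hx)

lemma weak_full (hu : WeakSol A u) {φ : En n → ℝ} (h1 : ContDiff ℝ (⊤ : ℕ∞) φ) (h2 : HasCompactSupport φ)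
    (h3 : tsupport φ ⊆ OmegaExt n) :
    ∫ x, ∑ i, ∑ j, A x i j * pd j u x * pd i φ x = ∫ x, u x * φ x := by
  have h := hu.2 φ h1 h2 h3
  rw [setIntegral_eq_integral_of_forall_compl_eq_zero, setIntegral_eq_integral_of_forall_compl_eq_zero] at h
  · rw [← h]
    refine integral_congr_ae (Eventually.of_forall fun x => ?_)
    simp only [Matrix.mulVec, dotProduct, gradient_coord, Finset.sum_mul]
  · intro x hx
    have : φ x = 0 := image_eq_zero_of_notMem_tsupport fun hh => hx (h3 hh)
    simp [this]
  · intro x hx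
    have : ∀ i, pd i φ x = 0 := fun i => pd_zero_of_notMem fun hh => hx (h3 hh)
    simp [gradient_coord, this]

lemma pd_sub_left (hg : ContDiff ℝ 1 g) (i : Fin n) (x t : En n) :
    pd i (fun s => g (x - s)) t = - pd i g (x - t) := by
  have h1 : HasFDerivAt g (fderiv ℝ g (x - t)) (x - t) := ((hg.differentiable one_ne_zero) _).hasFDerivAt
  have h2 : HasFDerivAt (fun s : En n => x - s) (- ContinuousLinearMap.id ℝ (En n)) t :=
    (hasFDerivAt_id t).const_sub x
  have h4 := (h1.comp t h2).fderiv
  simp only [Function.comp_def] at h4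
  unfold pd
  rw [h4]; simp

lemma approx (hA : EllipticDecay A lam α C) (hu : WeakSol A u) {K : Set (En n)} (hK : IsCompact K)
    (hKU : K ⊆ OmegaExt n) {ε : ℝ} (hε : 0 < ε) :
    ∃ w : En n → ℝ, ContDiff ℝ (⊤ : ℕ∞) w ∧ ∀ x ∈ K, |w x - u x| ≤ ε ∧
      (∀ i, |pd i w x - pd i u x| ≤ ε) ∧ |Lop A w x + w x| ≤ ε := by
  obtain ⟨ζ, d, hd, hζs, hζc, hζt, hζ1, -, -⟩ := exists_cutoff hK (isOpen_OmegaExt n) hKU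
  have hζ1' : ContDiff ℝ 1 ζ := hζs.of_le (by exact_mod_cast le_top)
  obtain ⟨B, hB, hmol⟩ := exists_mol n
  set U : En n → ℝ := fun x => ζ x * u x with hU
  set a : Fin n → Fin n → En n → ℝ := fun i j x => ζ x * A x i j with ha
  have hUs : ContDiff ℝ 1 U := cd_cut hζ1' hζt fun x hx => WS_cd hu hx
  have hUc : HasCompactSupport U := hζc.mul_right
  have has : ∀ i j, ContDiff ℝ 1 (a i j) := fun i j => cd_cut hζ1' hζt fun x hx => ED_cd hA hx i j
  have hac : ∀ i j, HasCompactSupport (a i j) := fun i j => hζc.mul_right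
  have hGs : ∀ j, Continuous (pd j U) := fun j => cont_pd hUs
  have hGc : ∀ j, HasCompactSupport (pd j U) := fun j => cs_pd hUc
  have hnh : ∀ x ∈ thickening d K, ζ =ᶠ[nhds x] fun _ => 1 := fun x hx => by
    filter_upwards [isOpen_thickening.mem_nhds hx] with y hy using hζ1 y hy
  have hUe : ∀ x ∈ thickening d K, U =ᶠ[nhds x] u := fun x hx => by
    filter_upwards [hnh x hx] with y hy; simp [hU, hy]
  have hae : ∀ i j, ∀ x ∈ thickening d K, a i j =ᶠ[nhds x] fun y => A y i j := fun i j x hx => by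
    filter_upwards [hnh x hx] with y hy; simp [ha, hy]
  set η : ℝ := ε / (1 + (n:ℝ)^2) with hη
  have hη0 : 0 < η := by positivity
  have hηε : (n:ℝ)^2 * η ≤ ε := by
    rw [hη, mul_div_assoc', div_le_iff₀ (by positivity)]; nlinarith
  have hev : ∀ᶠ δ in nhdsWithin (0:ℝ) (Set.Ioi 0), (∀ x, ∀ t ∈ ball x δ, |U t - U x| ≤ ε) ∧
      (∀ j, ∀ x, ∀ t ∈ ball x δ, |pd j U t - pd j U x| ≤ ε) ∧
      (∀ i j, ∀ ρ, IsMol B δ ρ → ∀ x,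
      |pd i (a i j) x * Mol (pd j U) ρ x + ∫ t, (a i j x - a i j t) * pd j U t * pd i ρ (x - t)| ≤ η) ∧
      0 < δ ∧ δ < d := by
    refine (unif_small hUs.continuous hUc hε).and (((eventually_all.2 fun j => unif_small (hGs j) (hGc j) hε)).and
      ((eventually_all.2 fun i => eventually_all.2 fun j => term_small hB (has i j) (hac i j) (hGs j) (hGc j) i hη0).and ?_))
    filter_upwards [Ioo_mem_nhdsGT hd] with δ h using h
  obtain ⟨δ, hδ1, hδ2, hδ3, hδ0, hδd⟩ := hev.exists
  obtain ⟨ρ, hρ⟩ := hmol δ hδ0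
  have hρ1 : ContDiff ℝ 1 ρ := hρ.sm.of_le (by exact_mod_cast le_top)
  have hpw : ∀ j, pd j (Mol U ρ) = Mol (pd j U) ρ := fun j =>
    funext fun x => pd_Mol_left hUs hUc hρ1.continuous j x
  have hws : ContDiff ℝ (⊤ : ℕ∞) (Mol U ρ) := Mol_smooth hUs.continuous hρ.sm hρ.cs
  refine ⟨Mol U ρ, hws, fun x hx => ?_⟩
  have hxt : x ∈ thickening d K := self_subset_thickening hd K hx
  refine ⟨?_, fun i => ?_, ?_⟩
  · have := hρ.close hε.le hUs.continuous (hδ1 x)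
    rwa [(hUe x hxt).eq_of_nhds] at this
  · rw [hpw, ← pd_congr (hUe x hxt)]
    exact hρ.close hε.le (hGs i) (hδ2 i x)
  · -- the equation
    have hball : closedBall x δ ⊆ thickening d K := fun t ht =>
      mem_thickening_iff.2 ⟨x, hx, lt_of_le_of_lt ht hδd⟩
    have hthO : thickening d K ⊆ OmegaExt n := fun t ht => by
      refine hζt (subset_tsupport _ ?_); simp [hζ1 t ht]
    set φ : En n → ℝ := fun t => ρ (x - t) with hφ
    have hφt : tsupport φ ⊆ closedBall x δ := by
      refine closure_minimal (fun t ht => ?_) isClosed_closedBall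
      have : x - t ∈ ball (0 : En n) δ := hρ.supp ht
      rw [mem_ball_zero_iff] at this
      rw [mem_closedBall, dist_comm, dist_eq_norm]; exact this.le
    have hw := weak_full hu (φ := φ) (hρ.sm.comp (contDiff_const.sub contDiff_id)) (cs_sub hρ.cs x)
      (hφt.trans (hball.trans hthO))
    have hpφ : ∀ i t, pd i φ t = - pd i ρ (x - t) := fun i t => pd_sub_left hρ1 i x t
    have hpρ0 : ∀ i t, t ∉ thickening d K → pd i ρ (x - t) = 0 := fun i t ht => by
      have := pd_zero_of_notMem (i := i) (f := φ) (x := t) (fun hh => ht (hball (hφt hh)))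
      rw [hpφ] at this; linarith
    have hφ0 : ∀ t, t ∉ thickening d K → φ t = 0 := fun t ht =>
      image_eq_zero_of_notMem_tsupport (fun hh => ht (hball (hφt hh)))
    have hpc : ∀ i, Continuous (fun t => pd i ρ (x - t)) := fun i => (cont_pd hρ1).comp (by fun_prop)
    have hps : ∀ i, HasCompactSupport (fun t => pd i ρ (x - t)) := fun i => cs_sub (cs_pd hρ.cs) x
    have hinteg : ∀ i, ∀ F : En n → ℝ, Continuous F → Integrable (fun t => F t * pd i ρ (x - t)) := fun i F hF =>
      (hF.mul (hpc i)).integrable_of_hasCompactSupport (hps i).mul_left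
    have hwx : Mol U ρ x = - ∑ i, ∑ j, ∫ t, a i j t * pd j U t * pd i ρ (x - t) := by
      have e1 : Mol U ρ x = ∫ t, u t * φ t := by
        refine integral_congr_ae (Eventually.of_forall fun t => ?_)
        by_cases ht : t ∈ thickening d K
        · simp only [(hUe t ht).eq_of_nhds]; rfl
        · have := hφ0 t ht
          simp only [hφ] at this ⊢
          simp [this]
      rw [e1, ← hw]
      have e2 : ∀ t, ∑ i, ∑ j, A t i j * pd j u t * pd i φ t = - ∑ i, ∑ j, a i j t * pd j U t * pd i ρ (x - t) := by
        intro t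
        simp_rw [← Finset.sum_neg_distrib]
        refine Finset.sum_congr rfl fun i _ => Finset.sum_congr rfl fun j _ => ?_
        rw [hpφ]
        by_cases ht : t ∈ thickening d K
        · rw [(hae i j t ht).eq_of_nhds, pd_congr (hUe t ht)]; ring
        · rw [hpρ0 i t ht]; ring
      simp_rw [e2]
      rw [integral_neg, integral_finsetSum]
      · congr 1
        refine Finset.sum_congr rfl fun i _ => ?_
        rw [integral_finsetSum]
        exact fun j _ => hinteg i (fun t => a i j t * pd j U t) ((has i j).continuous.mul (hGs j))
      · exact fun i _ => integrable_finsetSum _ fun j _ =>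
          hinteg i (fun t => a i j t * pd j U t) ((has i j).continuous.mul (hGs j))
    have hL : Lop A (Mol U ρ) x = ∑ i, ∑ j, (pd i (a i j) x * Mol (pd j U) ρ x + a i j x * Mol (pd j U) (pd i ρ) x) := by
      unfold Lop
      refine Finset.sum_congr rfl fun i _ => ?_
      have e3 : gv A (Mol U ρ) i = fun y => ∑ j, A y i j * Mol (pd j U) ρ y := by
        ext y; simp only [gv, hpw]
      have hxO := hthO hxt
      have hMs : ∀ j, ContDiff ℝ (⊤ : ℕ∞) (Mol (pd j U) ρ) := fun j => Mol_smooth (hGs j) hρ.sm hρ.cs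
      rw [e3, pd_sum_mul]
      · refine Finset.sum_congr rfl fun j _ => ?_
        rw [pd_Mol (hGs j) hρ1 hρ.cs, (hae i j x hxt).eq_of_nhds, pd_congr (hae i j x hxt)]
      · exact fun j => (ED_cd hA hxO i j).differentiableAt one_ne_zero
      · exact fun j => (hMs j).differentiable (by simp) x
    have hfin : Lop A (Mol U ρ) x + Mol U ρ x = ∑ i, ∑ j, (pd i (a i j) x * Mol (pd j U) ρ x +
        ∫ t, (a i j x - a i j t) * pd j U t * pd i ρ (x - t)) := by
      rw [hL, hwx, ← sub_eq_add_neg, ← Finset.sum_sub_distrib]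
      refine Finset.sum_congr rfl fun i _ => ?_
      rw [← Finset.sum_sub_distrib]
      refine Finset.sum_congr rfl fun j _ => ?_
      have : ∀ t, (a i j x - a i j t) * pd j U t * pd i ρ (x - t) =
        a i j x * (pd j U t * pd i ρ (x - t)) - a i j t * pd j U t * pd i ρ (x - t) := fun t => by ring
      simp_rw [this]
      rw [integral_sub ((hinteg i _ (hGs j)).const_mul _)
        (hinteg i (fun t => a i j t * pd j U t) ((has i j).continuous.mul (hGs j))), integral_const_mul]
      unfold Mol
      ring
    rw [hfin]
    calc _ ≤ ∑ i : Fin n, ∑ j : Fin n, η := (Finset.abs_sum_le_sum_abs _ _).trans (Finset.sum_le_sum fun i _ =>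
          (Finset.abs_sum_le_sum_abs _ _).trans (Finset.sum_le_sum fun j _ => hδ3 i j ρ hρ x))
      _ = (n:ℝ)^2 * η := by simp; ring
      _ ≤ ε := hηε
end P9

section P10
variable {n : ℕ} {f g u : En n → ℝ} {i : Fin n} {x : En n}
variable {A : En n → Matrix (Fin n) (Fin n) ℝ} {lam α C : ℝ}

lemma tsupp_K {F : En n → ℝ} {K : Set (En n)} (hK : IsCompact K) (h0 : ∀ x, x ∉ K → F x = 0) :
    tsupport F ⊆ K :=
  closure_minimal (fun x hx => by by_contra h; exact hx (h0 x h)) hK.isClosed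

lemma cont_K {F : En n → ℝ} {K V : Set (En n)} (hK : IsCompact K) (hKV : K ⊆ V)
    (hF : ∀ x ∈ V, ContinuousAt F x) (h0 : ∀ x, x ∉ K → F x = 0) : Continuous F :=
  continuous_of_supp fun x hx => hF x (hKV (tsupp_K hK h0 hx))

lemma int_K {F : En n → ℝ} {K V : Set (En n)} (hK : IsCompact K) (hKV : K ⊆ V)
    (hF : ∀ x ∈ V, ContinuousAt F x) (h0 : ∀ x, x ∉ K → F x = 0) : Integrable F :=
  (cont_K hK hKV hF h0).integrable_of_hasCompactSupport
    (hK.of_isClosed_subset (isClosed_tsupport _) (tsupp_K hK h0))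

lemma two_le_top : (2 : WithTop ℕ∞) ≤ ((⊤ : ℕ∞) : WithTop ℕ∞) :=
  WithTop.coe_le_coe.2 (le_top (a := (2 : ℕ∞)))

/-- Passing to the limit, all integrands supported in a compact set. -/
lemma lim_K {F : ℕ → En n → ℝ} {f b : En n → ℝ} {K V : Set (En n)} (hK : IsCompact K) (hKV : K ⊆ V)
    (hF : ∀ k, ∀ x ∈ V, ContinuousAt (F k) x) (h0 : ∀ k x, x ∉ K → F k x = 0)
    (hb : ∀ x ∈ V, ContinuousAt b x) (hb0 : ∀ x, x ∉ K → b x = 0)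
    (hle : ∀ k, ∀ x ∈ K, |F k x| ≤ b x) (hf0 : ∀ x, x ∉ K → f x = 0)
    (hlim : ∀ x ∈ K, Tendsto (fun k => F k x) atTop (nhds (f x))) :
    Tendsto (fun k => ∫ x, F k x) atTop (nhds (∫ x, f x)) := by
  refine tendsto_integral_of_dominated_convergence b (fun k => (cont_K hK hKV (hF k) (h0 k)).aestronglyMeasurable)
    (int_K hK hKV hb hb0) (fun k => Eventually.of_forall fun x => ?_) (Eventually.of_forall fun x => ?_)
  · by_cases hx : x ∈ K
    · exact hle k x hx
    · simp [h0 k x hx, hb0 x hx]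
  · by_cases hx : x ∈ K
    · exact hlim x hx
    · simp [h0 _ x hx, hf0 x hx]

lemma cont_Lop (hA : ∀ i j, ContDiffAt ℝ 1 (fun y => A y i j) x) (hf : ContDiffAt ℝ 2 f x) :
    ContinuousAt (Lop A f) x :=
  tendsto_finsetSum _ fun i _ => (cd_gv hA hf i).pd0

lemma Lop_zero (hx : x ∉ tsupport f) : Lop A f x = 0 := by
  unfold Lop
  refine Finset.sum_eq_zero fun i _ => pd_zero_of_notMem fun h => hx ?_
  refine closure_minimal (fun y hy => ?_) (isClosed_tsupport f) h
  by_contra hh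
  apply hy
  simp only [gv]
  exact Finset.sum_eq_zero fun j _ => by rw [pd_zero_of_notMem hh]; ring

lemma gv_zero (hx : x ∉ tsupport f) : gv A f i x = 0 :=
  Finset.sum_eq_zero fun j _ => by rw [pd_zero_of_notMem hx]; ring

lemma gv_mul (hf : Differentiable ℝ f) (hg : Differentiable ℝ g) :
    gv A (fun y => f y * g y) i x = f x * gv A g i x + g x * gv A f i x := by
  simp only [gv, Finset.mul_sum, ← Finset.sum_add_distrib]
  refine Finset.sum_congr rfl fun j _ => ?_
  rw [pd_mul (hf x) (hg x)]; ring

lemma gv_symm (hs : (A x).IsSymm) : ∑ i, gv A f i x * pd i g x = ∑ i, gv A g i x * pd i f x := by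
  simp only [gv, Finset.sum_mul]
  rw [Finset.sum_comm]
  refine Finset.sum_congr rfl fun i _ => Finset.sum_congr rfl fun j _ => ?_
  rw [hs.apply i j]; ring

lemma Lop_mul (hA : ∀ i j, ContDiffAt ℝ 1 (fun y => A y i j) x) (hs : (A x).IsSymm)
    (hf : ContDiff ℝ 2 f) (hg : ContDiff ℝ 2 g) :
    Lop A (fun y => f y * g y) x = f x * Lop A g x + 2 * (∑ i, gv A f i x * pd i g x) + g x * Lop A f x := by
  have hf1 : Differentiable ℝ f := hf.differentiable (by norm_num)
  have hg1 : Differentiable ℝ g := hg.differentiable (by norm_num)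
  have h1 : ∀ i, pd i (gv A (fun y => f y * g y) i) x =
      (pd i f x * gv A g i x + f x * pd i (gv A g i) x) + (pd i g x * gv A f i x + g x * pd i (gv A f i) x) := by
    intro i
    have d1 := (cd_gv hA hg.contDiffAt i).differentiableAt one_ne_zero
    have d2 := (cd_gv hA hf.contDiffAt i).differentiableAt one_ne_zero
    rw [show gv A (fun y => f y * g y) i = fun y => f y * gv A g i y + g y * gv A f i y from
      funext fun y => gv_mul hf1 hg1]
    rw [pd_add (f := fun y => f y * gv A g i y) (g := fun y => g y * gv A f i y) ((hf1 x).mul d1) ((hg1 x).mul d2), pd_mul (hf1 x) d1, pd_mul (hg1 x) d2]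
  have h2 := gv_symm (f := g) (g := f) hs
  unfold Lop
  simp_rw [h1, Finset.sum_add_distrib, ← Finset.mul_sum]
  simp_rw [mul_comm (pd _ _ _)]
  rw [h2]; ring

/-- Approximating sequence. -/
lemma approx_seq (hA : EllipticDecay A lam α C) (hu : WeakSol A u) {K : Set (En n)} (hK : IsCompact K)
    (hKU : K ⊆ OmegaExt n) :
    ∃ w : ℕ → En n → ℝ, (∀ k, ContDiff ℝ (⊤ : ℕ∞) (w k)) ∧ ∀ x ∈ K,
      (∀ k, |w k x| ≤ |u x| + 1) ∧ (∀ k i, |pd i (w k) x| ≤ |pd i u x| + 1) ∧ (∀ k, |Lop A (w k) x + w k x| ≤ 1) ∧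
      Tendsto (fun k => w k x) atTop (nhds (u x)) ∧ (∀ i, Tendsto (fun k => pd i (w k) x) atTop (nhds (pd i u x)))
      ∧ Tendsto (fun k => Lop A (w k) x + w k x) atTop (nhds 0) := by
  have h := fun k : ℕ => approx hA hu hK hKU (ε := 1 / ((k:ℝ) + 1)) (by positivity)
  choose w hw1 hw2 using h
  have hle : ∀ k : ℕ, 1 / ((k:ℝ) + 1) ≤ 1 := fun k => by
    rw [div_le_one (by positivity)]; linarith [k.cast_nonneg (α := ℝ)]
  have hbd : ∀ {a b c : ℝ}, |a - b| ≤ c → c ≤ 1 → |a| ≤ |b| + 1 := fun {a b c} h1 h2 => by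
    have := abs_sub_abs_le_abs_sub a b; linarith
  have hl : ∀ {a : ℕ → ℝ} {b : ℝ}, (∀ k : ℕ, |a k - b| ≤ 1 / ((k:ℝ) + 1)) → Tendsto a atTop (nhds b) := by
    intro a b h
    rw [tendsto_iff_dist_tendsto_zero]
    exact squeeze_zero (fun _ => dist_nonneg) h tendsto_one_div_add_atTop_nhds_zero_nat
  refine ⟨w, hw1, fun x hx => ⟨fun k => hbd (hw2 k x hx).1 (hle k), fun k i => hbd ((hw2 k x hx).2.1 i) (hle k),
    fun k => (hw2 k x hx).2.2.trans (hle k), hl fun k => (hw2 k x hx).1, fun i => hl fun k => (hw2 k x hx).2.1 i,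
    hl fun k => by simpa using (hw2 k x hx).2.2⟩⟩

lemma carl_limit (hA : EllipticDecay A lam α C) (hu : WeakSol A u) {V : Set (En n)} (hV : V ⊆ OmegaExt n)
    {W1 W2 : En n → ℝ} (hW1 : ∀ x ∈ V, ContinuousAt W1 x) (hW2 : ∀ x ∈ V, ContinuousAt W2 x)
    (hC : ∀ z : En n → ℝ, ContDiff ℝ 2 z → HasCompactSupport z → tsupport z ⊆ V →
      ∫ x, W1 x * z x ^ 2 ≤ ∫ x, W2 x * (Lop A z x + z x) ^ 2)
    {χ : En n → ℝ} (hχ : ContDiff ℝ (⊤ : ℕ∞) χ) (hc : HasCompactSupport χ) (ht : tsupport χ ⊆ V) :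
    ∫ x, W1 x * (χ x * u x) ^ 2 ≤ ∫ x, W2 x * (2 * (∑ i, gv A χ i x * pd i u x) + u x * Lop A χ x) ^ 2 := by
  have hK : IsCompact (tsupport χ) := hc
  obtain ⟨w, hws, hw⟩ := approx_seq hA hu hK (ht.trans hV)
  have hw2 : ∀ k, ContDiff ℝ 2 (w k) := fun k => (hws k).of_le two_le_top
  have hχ2 : ContDiff ℝ 2 χ := hχ.of_le two_le_top
  have hz2 : ∀ k, ContDiff ℝ 2 (fun y => χ y * w k y) := fun k => hχ2.mul (hw2 k)
  have hzt : ∀ k, tsupport (fun y => χ y * w k y) ⊆ tsupport χ := fun k =>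
    closure_mono (Function.support_mul_subset_left _ _)
  have huc : ∀ x ∈ V, ContinuousAt u x := fun x hx => (WS_cd hu (hV hx)).continuousAt
  have hpuc : ∀ x ∈ V, ∀ i, ContinuousAt (pd i u) x := fun x hx i => (WS_cd hu (hV hx)).pd0
  have hAc : ∀ x ∈ V, ∀ i j, ContDiffAt ℝ 1 (fun y => A y i j) x := fun x hx i j => ED_cd hA (hV hx) i j
  have hgc : ∀ x ∈ V, ∀ i, ContinuousAt (gv A χ i) x := fun x hx i =>
    (cd_gv (hAc x hx) hχ2.contDiffAt i).continuousAt
  have hLc : ∀ x ∈ V, ContinuousAt (Lop A χ) x := fun x hx => cont_Lop (hAc x hx) hχ2.contDiffAt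
  have hχ0 : ∀ x, x ∉ tsupport χ → χ x = 0 := fun x hx => image_eq_zero_of_notMem_tsupport hx
  have hineq := fun k => hC _ (hz2 k) (hc.mul_right) ((hzt k).trans ht)
  have hLm : ∀ k, ∀ x ∈ tsupport χ, Lop A (fun y => χ y * w k y) x + χ x * w k x =
      χ x * (Lop A (w k) x + w k x) + 2 * (∑ i, gv A χ i x * pd i (w k) x) + w k x * Lop A χ x := by
    intro k x hx
    rw [Lop_mul (hAc x (ht hx)) (hA.1 x (hV (ht hx))) hχ2 (hw2 k)]; ring
  refine le_of_tendsto_of_tendsto' (lim_K (F := fun k x => W1 x * (χ x * w k x) ^ 2)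
      (b := fun x => |W1 x| * (|χ x| * (|u x| + 1)) ^ 2) hK ht ?_ ?_ ?_ ?_ ?_ ?_ ?_)
    (lim_K (F := fun k x => W2 x * (Lop A (fun y => χ y * w k y) x + χ x * w k x) ^ 2)
      (b := fun x => |W2 x| * (|χ x| + 2 * (∑ i, |gv A χ i x| * (|pd i u x| + 1)) + (|u x| + 1) * |Lop A χ x|) ^ 2)
      hK ht ?_ ?_ ?_ ?_ ?_ ?_ ?_) hineq
  · exact fun k x hx => (hW1 x hx).mul ((hz2 k).continuous.continuousAt.pow 2)
  · intro k x hx; simp [hχ0 x hx]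
  · exact fun x hx => (hW1 x hx).abs.mul ((hχ.continuous.continuousAt.abs.mul ((huc x hx).abs.add continuousAt_const)).pow 2)
  · intro x hx; simp [hχ0 x hx]
  · intro k x hx
    rw [abs_mul, abs_pow, abs_mul]
    have := (hw x hx).1 k
    gcongr
  · intro x hx; simp [hχ0 x hx]
  · intro x hx
    exact ((((hw x hx).2.2.2.1).const_mul _).pow 2).const_mul _
  · exact fun k x hx => (hW2 x hx).mul (((cont_Lop (hAc x hx) (hz2 k).contDiffAt).add
      (hz2 k).continuous.continuousAt).pow 2)
  · intro k x hx
    rw [Lop_zero (fun h => hx (hzt k h)), hχ0 x hx]; simp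
  · intro x hx
    refine (hW2 x hx).abs.mul (((hχ.continuous.continuousAt.abs.add (continuousAt_const.mul ?_)).add
      (((huc x hx).abs.add continuousAt_const).mul (hLc x hx).abs)).pow 2)
    exact tendsto_finsetSum _ fun i _ => (hgc x hx i).abs.mul ((hpuc x hx i).abs.add continuousAt_const)
  · intro x hx
    simp [hχ0 x hx, Lop_zero hx, gv_zero hx]
  · intro k x hx
    rw [hLm k x hx, abs_mul, abs_pow]
    obtain ⟨h1, h2, h3, -⟩ := hw x hx
    gcongr
    refine (abs_add_le _ _).trans (add_le_add ((abs_add_le _ _).trans (add_le_add ?_ ?_)) ?_)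
    · rw [abs_mul]; exact mul_le_of_le_one_right (abs_nonneg _) (h3 k)
    · rw [abs_mul, abs_of_pos (by norm_num : (0:ℝ) < 2)]
      gcongr
      refine (Finset.abs_sum_le_sum_abs _ _).trans (Finset.sum_le_sum fun i _ => ?_)
      rw [abs_mul]
      have := h2 k i
      gcongr
    · rw [abs_mul]
      have := h1 k
      gcongr
  · intro x hx
    simp [hχ0 x hx, Lop_zero hx, gv_zero hx]
  · intro x hx
    obtain ⟨-, -, -, h4, h5, h6⟩ := hw x hx
    simp_rw [hLm _ x hx]
    have e : 2 * (∑ i, gv A χ i x * pd i u x) + u x * Lop A χ x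
      = χ x * 0 + 2 * (∑ i, gv A χ i x * pd i u x) + u x * Lop A χ x := by ring
    rw [e]
    refine Tendsto.const_mul _ (Tendsto.pow (((h6.const_mul _).add (Tendsto.const_mul _ ?_)).add (h4.mul_const _)) 2)
    exact tendsto_finsetSum _ fun i _ => (h5 i).const_mul _

/-- Weak formulation with `C¹` test functions. -/
lemma weak_C1 (hA : EllipticDecay A lam α C) (hu : WeakSol A u) {φ : En n → ℝ} (h1 : ContDiff ℝ 1 φ)
    (h2 : HasCompactSupport φ) (h3 : tsupport φ ⊆ OmegaExt n) :
    ∫ x, ∑ i, gv A u i x * pd i φ x = ∫ x, u x * φ x := by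
  have hK : IsCompact (tsupport φ) := h2
  obtain ⟨w, hws, hw⟩ := approx_seq hA hu hK h3
  have hw2 : ∀ k, ContDiff ℝ 2 (w k) := fun k => (hws k).of_le two_le_top
  have hAc : ∀ x ∈ OmegaExt n, ∀ i j, ContDiffAt ℝ 1 (fun y => A y i j) x := fun x hx i j => ED_cd hA hx i j
  have hgc : ∀ k, ∀ x ∈ OmegaExt n, ∀ i, ContDiffAt ℝ 1 (gv A (w k) i) x := fun k x hx i =>
    cd_gv (hAc x hx) (hw2 k).contDiffAt i
  have hφ0 : ∀ x, x ∉ tsupport φ → φ x = 0 := fun x hx => image_eq_zero_of_notMem_tsupport hx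
  have hpφ0 : ∀ x, x ∉ tsupport φ → ∀ i, pd i φ x = 0 := fun x hx i => pd_zero_of_notMem hx
  have huc : ∀ x ∈ OmegaExt n, ContinuousAt u x := fun x hx => (WS_cd hu hx).continuousAt
  have hpuc : ∀ x ∈ OmegaExt n, ∀ i, ContinuousAt (pd i u) x := fun x hx i => (WS_cd hu hx).pd0
  have hpφ : ∀ i, Continuous (pd i φ) := fun i => cont_pd h1
  have key : ∀ k, ∫ x, ((∑ i, gv A (w k) i x * pd i φ x) + Lop A (w k) x * φ x) = 0 := by
    intro k
    have hF : ∀ i, ContDiff ℝ 1 (fun x => φ x * gv A (w k) i x) := fun i =>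
      cd_cut h1 h3 fun x hx => hgc k x hx i
    have hFc : ∀ i, HasCompactSupport (fun x => φ x * gv A (w k) i x) := fun i => h2.mul_right
    have e : ∀ x, (∑ i, gv A (w k) i x * pd i φ x) + Lop A (w k) x * φ x
        = ∑ i, pd i (fun x => φ x * gv A (w k) i x) x := by
      intro x
      by_cases hx : x ∈ tsupport φ
      · rw [Lop, Finset.sum_mul, ← Finset.sum_add_distrib]
        refine Finset.sum_congr rfl fun i _ => ?_
        rw [pd_mul (h1.differentiable one_ne_zero x) ((hgc k x (h3 hx) i).differentiableAt one_ne_zero)]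
        ring
      · simp only [hpφ0 x hx, hφ0 x hx, mul_zero, Finset.sum_const_zero, add_zero]
        symm
        refine Finset.sum_eq_zero fun i _ => pd_zero_of_notMem fun h => hx ?_
        exact closure_mono (Function.support_mul_subset_left _ _) h
    simp_rw [e]
    rw [integral_finsetSum]
    · exact Finset.sum_eq_zero fun i _ => integral_pd_zero (hF i) (hFc i)
    · exact fun i _ => (cont_pd (hF i)).integrable_of_hasCompactSupport (cs_pd (hFc i))
  have lim := lim_K (F := fun k x => (∑ i, gv A (w k) i x * pd i φ x) + Lop A (w k) x * φ x)
    (f := fun x => (∑ i, gv A u i x * pd i φ x) - u x * φ x)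
    (b := fun x => (∑ i, (∑ j, |A x i j| * (|pd j u x| + 1)) * |pd i φ x|) + (1 + (|u x| + 1)) * |φ x|) hK h3
    ?_ ?_ ?_ ?_ ?_ ?_ ?_
  · simp_rw [key] at lim
    have := tendsto_nhds_unique lim tendsto_const_nhds
    rw [integral_sub] at this
    · linarith
    · refine int_K hK h3 (fun x hx => ?_) (fun x hx => by simp [hpφ0 x hx])
      refine tendsto_finsetSum _ fun i _ => ContinuousAt.mul ?_ (hpφ i).continuousAt
      exact tendsto_finsetSum _ fun j _ => (hAc x hx i j).continuousAt.mul (hpuc x hx j)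
    · exact int_K hK h3 (fun x hx => (huc x hx).mul h1.continuous.continuousAt) (fun x hx => by simp [hφ0 x hx])
  · intro k x hx
    refine ContinuousAt.add ?_ ((cont_Lop (hAc x hx) (hw2 k).contDiffAt).mul h1.continuous.continuousAt)
    exact tendsto_finsetSum _ fun i _ => (hgc k x hx i).continuousAt.mul (hpφ i).continuousAt
  · intro k x hx; simp [hpφ0 x hx, hφ0 x hx]
  · intro x hx
    refine ContinuousAt.add ?_ ((continuousAt_const.add ((huc x hx).abs.add continuousAt_const)).mul
      h1.continuous.continuousAt.abs)
    refine tendsto_finsetSum _ fun i _ => ContinuousAt.mul ?_ (hpφ i).continuousAt.abs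
    exact tendsto_finsetSum _ fun j _ => (hAc x hx i j).continuousAt.abs.mul ((hpuc x hx j).abs.add continuousAt_const)
  · intro x hx; simp [hpφ0 x hx, hφ0 x hx]
  · intro k x hx
    obtain ⟨b1, b2, b3, -⟩ := hw x hx
    refine (abs_add_le _ _).trans (add_le_add ?_ ?_)
    · refine (Finset.abs_sum_le_sum_abs _ _).trans (Finset.sum_le_sum fun i _ => ?_)
      rw [abs_mul]
      refine mul_le_mul_of_nonneg_right ?_ (abs_nonneg _)
      refine (Finset.abs_sum_le_sum_abs _ _).trans (Finset.sum_le_sum fun j _ => ?_)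
      rw [abs_mul]
      exact mul_le_mul_of_nonneg_left (b2 k j) (abs_nonneg _)
    · rw [abs_mul]
      refine mul_le_mul_of_nonneg_right ?_ (abs_nonneg _)
      have e : Lop A (w k) x = (Lop A (w k) x + w k x) - w k x := by ring
      rw [e]
      exact (abs_sub _ _).trans (add_le_add (b3 k) (b1 k))
  · intro x hx; simp [hpφ0 x hx, hφ0 x hx]
  · intro x hx
    obtain ⟨-, -, -, h4, h5, h6⟩ := hw x hx
    have e : ∀ k, Lop A (w k) x = (Lop A (w k) x + w k x) - w k x := fun k => by ring
    have h7 : Tendsto (fun k => Lop A (w k) x) atTop (nhds (0 - u x)) := by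
      exact (h6.sub h4).congr fun k => (e k).symm
    have e2 : (∑ i, gv A u i x * pd i φ x) - u x * φ x = (∑ i, gv A u i x * pd i φ x) + (0 - u x) * φ x := by ring
    rw [e2]
    refine Tendsto.add (tendsto_finsetSum _ fun i _ => Tendsto.mul_const _ ?_) (h7.mul_const _)
    exact tendsto_finsetSum _ fun j _ => (h5 j).const_mul _
end P10

section P11
variable {n : ℕ} {f g u : En n → ℝ} {i : Fin n} {x : En n}
variable {A : En n → Matrix (Fin n) (Fin n) ℝ} {lam α C : ℝ}

lemma ED_pow_le (hx : x ∈ OmegaExt n) (hα : 0 < α) : ‖x‖ ^ (-α) ≤ 1 :=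
  Real.rpow_le_one_of_one_le_of_nonpos (le_of_lt hx) (by linarith)

lemma ED_abs (hA : EllipticDecay A lam α C) (hα : 0 < α) (hC : 0 < C) (hx : x ∈ OmegaExt n) (i j : Fin n) :
    |A x i j| ≤ 1 + C := by
  have h := ED_b1 hA hx i j
  have h2 := mul_le_of_le_one_right hC.le (ED_pow_le hx hα)
  have h3 : |(if i = j then 1 else 0 : ℝ)| ≤ 1 := by split_ifs <;> simp
  have h4 := abs_sub_abs_le_abs_sub (A x i j) (if i = j then 1 else 0)
  linarith

lemma gv_abs (hA : EllipticDecay A lam α C) (hα : 0 < α) (hC : 0 < C) (hx : x ∈ OmegaExt n) (i : Fin n) :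
    |gv A f i x| ≤ n * ((1 + C) * gn f x) :=
  abs_sum_le_n fun j => abs_mul_le (ED_abs hA hα hC hx i j) (pd_le_gn j)

lemma gvs_abs (hA : EllipticDecay A lam α C) (hα : 0 < α) (hC : 0 < C) (hx : x ∈ OmegaExt n) :
    |∑ i, gv A f i x * pd i g x| ≤ n * (n * ((1 + C) * gn f x) * gn g x) :=
  abs_sum_le_n fun i => abs_mul_le (gv_abs hA hα hC hx i) (pd_le_gn i)

lemma cont_gn (h : ∀ i, ContinuousAt (pd i f) x) : ContinuousAt (gn f) x := by
  unfold gn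
  exact Real.continuous_sqrt.continuousAt.comp (tendsto_finsetSum _ fun i _ => (h i).pow 2)

lemma gn_zero (h : x ∉ tsupport f) : gn f x = 0 := by
  simp [gn, pd_zero_of_notMem h]

lemma cacc_arith {lam z u p q t D : ℝ} (hlam : 0 < lam) (ht : |t| ≤ D * p * q) :
    -(lam / 2 * (z ^ 2 * p ^ 2)) - 2 * D ^ 2 / lam * (q ^ 2 * u ^ 2) ≤ 2 * z * u * t := by
  have h1 : -(2 * |z| * |u| * (D * p * q)) ≤ 2 * z * u * t := by
    have : |2 * z * u * t| ≤ 2 * |z| * |u| * (D * p * q) := by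
      rw [abs_mul, abs_mul, abs_mul, abs_of_pos (by norm_num : (0:ℝ) < 2)]
      gcongr
    exact (neg_le_neg this).trans (neg_abs_le _)
  refine le_trans ?_ h1
  rw [← sq_abs z, ← sq_abs u]
  generalize |z| = a
  generalize |u| = b
  have e : (lam / 2 * (a ^ 2 * p ^ 2)) + 2 * D ^ 2 / lam * (q ^ 2 * b ^ 2) - 2 * a * b * (D * p * q)
    = (lam * a * p - 2 * D * q * b) ^ 2 / (2 * lam) := by field_simp; ring
  have : 0 ≤ (lam * a * p - 2 * D * q * b) ^ 2 / (2 * lam) := by positivity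
  linarith

lemma caccio (hlam : 0 < lam) (hA : EllipticDecay A lam α C) (hα : 0 < α) (hC : 0 < C) (hu : WeakSol A u) :
    ∃ Kc, 0 ≤ Kc ∧ ∀ ζ : En n → ℝ, ContDiff ℝ 1 ζ → HasCompactSupport ζ → tsupport ζ ⊆ OmegaExt n →
      ∫ x, ζ x ^ 2 * gn u x ^ 2 ≤ Kc * ∫ x, (ζ x ^ 2 + gn ζ x ^ 2) * u x ^ 2 := by
  set D : ℝ := n * (n * (1 + C)) with hD
  refine ⟨2 / lam * (1 + 2 * D ^ 2 / lam), by positivity, fun ζ hζ hζc hζt => ?_⟩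
  have hK : IsCompact (tsupport ζ) := hζc
  have huc : ∀ x ∈ OmegaExt n, ContinuousAt u x := fun x hx => (WS_cd hu hx).continuousAt
  have hpuc : ∀ x ∈ OmegaExt n, ∀ i, ContinuousAt (pd i u) x := fun x hx i => (WS_cd hu hx).pd0
  have hζ0 : ∀ x, x ∉ tsupport ζ → ζ x = 0 := fun x hx => image_eq_zero_of_notMem_tsupport hx
  have hcz : ∀ x, ContinuousAt ζ x := fun x => hζ.continuous.continuousAt
  have hcg : ∀ x, ContinuousAt (gn ζ) x := fun x => cont_gn fun i => (cont_pd hζ).continuousAt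
  have i1 : Integrable (fun x => ζ x ^ 2 * gn u x ^ 2) :=
    int_K hK hζt (fun x hx => ((hcz x).pow 2).mul ((cont_gn (hpuc x hx)).pow 2)) (fun x hx => by simp [hζ0 x hx])
  have i2 : Integrable (fun x => ζ x ^ 2 * u x ^ 2) :=
    int_K hK hζt (fun x hx => ((hcz x).pow 2).mul ((huc x hx).pow 2)) (fun x hx => by simp [hζ0 x hx])
  have i3 : Integrable (fun x => gn ζ x ^ 2 * u x ^ 2) :=
    int_K hK hζt (fun x hx => ((hcg x).pow 2).mul ((huc x hx).pow 2)) (fun x hx => by simp [gn_zero hx])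
  set φ : En n → ℝ := fun x => ζ x * (ζ x * u x) with hφ
  have hφ1 : ContDiff ℝ 1 φ := cd_cut hζ hζt fun x hx => hζ.contDiffAt.mul (WS_cd hu hx)
  have hφt : tsupport φ ⊆ tsupport ζ := closure_mono (Function.support_mul_subset_left _ _)
  have hw := weak_C1 hA hu hφ1 hζc.mul_right (hφt.trans hζt)
  have hpt : ∀ x, lam / 2 * (ζ x ^ 2 * gn u x ^ 2) - 2 * D ^ 2 / lam * (gn ζ x ^ 2 * u x ^ 2)
      ≤ ∑ i, gv A u i x * pd i φ x := by
    intro x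
    by_cases hx : x ∈ tsupport ζ
    · have hxO := hζt hx
      have hdz := hζ.differentiable one_ne_zero x
      have hdu := (WS_cd hu hxO).differentiableAt one_ne_zero
      have e : ∑ i, gv A u i x * pd i φ x = ζ x ^ 2 * Ef A u x + 2 * ζ x * u x * ∑ i, gv A u i x * pd i ζ x := by
        rw [Ef, Finset.mul_sum, Finset.mul_sum, ← Finset.sum_add_distrib]
        refine Finset.sum_congr rfl fun i _ => ?_
        rw [hφ, pd_mul (g := fun x => ζ x * u x) hdz (hdz.mul hdu), pd_mul hdz hdu]; ring
      rw [e]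
      have h1 := ED_Ef (v := u) hA hxO
      have h2 := gvs_abs (f := u) (g := ζ) hA hα hC hxO
      have h3 := cacc_arith (z := ζ x) (u := u x) (p := gn u x) (q := gn ζ x) (D := D) hlam
        (h2.trans (le_of_eq (by rw [hD]; ring)))
      have h4 := mul_le_mul_of_nonneg_left h1 (sq_nonneg (ζ x))
      linarith
    · rw [hζ0 x hx, gn_zero hx]
      have : ∀ i, pd i φ x = 0 := fun i => pd_zero_of_notMem fun h => hx (hφt h)
      simp [this]
  have hi : Integrable (fun x => ∑ i, gv A u i x * pd i φ x) := by
    refine int_K hK hζt (fun x hx => ?_) (fun x hx => ?_)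
    · refine tendsto_finsetSum _ fun i _ => ContinuousAt.mul ?_ (cont_pd hφ1).continuousAt
      exact tendsto_finsetSum _ fun j _ => (ED_cd hA hx i j).continuousAt.mul (hpuc x hx j)
    · exact Finset.sum_eq_zero fun i _ => by rw [pd_zero_of_notMem (f := φ) fun h => hx (hφt h)]; ring
  have hm := integral_mono ((i1.const_mul (lam/2)).sub (i3.const_mul (2 * D ^ 2 / lam))) hi hpt
  simp only [Pi.sub_apply] at hm
  rw [integral_sub (i1.const_mul _) (i3.const_mul _), integral_const_mul, integral_const_mul, hw] at hm
  have e2 : ∫ x, u x * φ x = ∫ x, ζ x ^ 2 * u x ^ 2 := by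
    refine integral_congr_ae (Eventually.of_forall fun x => ?_)
    simp only [hφ]; ring
  have e3 : ∫ x, (ζ x ^ 2 + gn ζ x ^ 2) * u x ^ 2 = (∫ x, ζ x ^ 2 * u x ^ 2) + ∫ x, gn ζ x ^ 2 * u x ^ 2 := by
    rw [← integral_add i2 i3]; congr 1; ext x; ring
  rw [e2] at hm
  rw [e3]
  have n2 : 0 ≤ ∫ x, ζ x ^ 2 * u x ^ 2 := integral_nonneg fun x => by positivity
  have n3 : 0 ≤ ∫ x, gn ζ x ^ 2 * u x ^ 2 := integral_nonneg fun x => by positivity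
  have hk : 0 ≤ 2 * D ^ 2 / lam := by positivity
  generalize (∫ x, ζ x ^ 2 * u x ^ 2) = a at *
  generalize (∫ x, gn ζ x ^ 2 * u x ^ 2) = b at *
  generalize (∫ x, ζ x ^ 2 * gn u x ^ 2) = c at *
  generalize 2 * D ^ 2 / lam = k at *
  have : c = 2 / lam * (lam / 2 * c) := by field_simp
  rw [this, mul_assoc]
  refine mul_le_mul_of_nonneg_left ?_ (by positivity)
  nlinarith [mul_nonneg hk n2]

/-- Radial cutoff: `0` for `|x|² ≤ s1`, `1` for `|x|² ≥ s2`. -/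
def cin (s1 s2 : ℝ) (σ : ℝ) : ℝ := Real.smoothTransition ((σ - s1) / (s2 - s1))

lemma cin_smooth (s1 s2 : ℝ) {k : ℕ∞} : ContDiff ℝ k (cin s1 s2) :=
  Real.smoothTransition.contDiff.comp ((contDiff_id.sub contDiff_const).div_const _)

lemma cin_zero {s1 s2 σ : ℝ} (h : s1 < s2) (hσ : σ ≤ s1) : cin s1 s2 σ = 0 :=
  Real.smoothTransition.zero_of_nonpos (div_nonpos_of_nonpos_of_nonneg (by linarith) (by linarith))

lemma cin_one {s1 s2 σ : ℝ} (h : s1 < s2) (hσ : s2 ≤ σ) : cin s1 s2 σ = 1 :=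
  Real.smoothTransition.one_of_one_le (by rw [le_div_iff₀ (by linarith)]; linarith)

lemma cin_nonneg (s1 s2 σ : ℝ) : 0 ≤ cin s1 s2 σ := Real.smoothTransition.nonneg _
lemma cin_le_one (s1 s2 σ : ℝ) : cin s1 s2 σ ≤ 1 := Real.smoothTransition.le_one _

lemma st_bound : ∃ S : ℝ, 0 ≤ S ∧ (∀ t, |deriv Real.smoothTransition t| ≤ S) ∧
    ∀ t, |deriv (deriv Real.smoothTransition) t| ≤ S := by
  have h2 : ContDiff ℝ 2 Real.smoothTransition := Real.smoothTransition.contDiff (n := 2)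
  have h1 : ContDiff ℝ 1 (deriv Real.smoothTransition) := ContDiff.deriv' h2
  have h0 : Continuous (deriv (deriv Real.smoothTransition)) := h1.continuous_deriv (by norm_num)
  have hz : ∀ t, t ∉ Set.Icc (0:ℝ) 1 → deriv Real.smoothTransition t = 0 := by
    intro t ht
    rw [Set.mem_Icc, not_and_or, not_le, not_le] at ht
    rcases ht with ht | ht
    · have : Real.smoothTransition =ᶠ[nhds t] fun _ => 0 := by
        filter_upwards [Iio_mem_nhds ht] with s hs using Real.smoothTransition.zero_of_nonpos (le_of_lt hs)
      rw [this.deriv_eq]; simp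
    · have : Real.smoothTransition =ᶠ[nhds t] fun _ => 1 := by
        filter_upwards [Ioi_mem_nhds ht] with s hs using Real.smoothTransition.one_of_one_le (le_of_lt hs)
      rw [this.deriv_eq]; simp
  have hc : HasCompactSupport (deriv Real.smoothTransition) :=
    HasCompactSupport.intro isCompact_Icc hz
  obtain ⟨S1, hS1⟩ := hc.exists_bound_of_continuous h1.continuous
  obtain ⟨S2, hS2⟩ := hc.deriv.exists_bound_of_continuous h0
  refine ⟨max S1 S2, ((norm_nonneg _).trans (hS1 0)).trans (le_max_left _ _), fun t => (hS1 t).trans (le_max_left _ _),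
    fun t => (hS2 t).trans (le_max_right _ _)⟩

lemma cin_deriv (s1 s2 σ : ℝ) : HasDerivAt (cin s1 s2)
    (deriv Real.smoothTransition ((σ - s1) / (s2 - s1)) / (s2 - s1)) σ := by
  have h1 : HasDerivAt Real.smoothTransition (deriv Real.smoothTransition ((σ - s1) / (s2 - s1)))
      ((σ - s1) / (s2 - s1)) :=
    ((Real.smoothTransition.contDiff (n := 1)).differentiable (by norm_num) _).hasDerivAt
  have h2 : HasDerivAt (fun σ => (σ - s1) / (s2 - s1)) (1 / (s2 - s1)) σ :=
    ((hasDerivAt_id σ).sub_const s1).div_const _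
  have := h1.comp σ h2
  rw [mul_one_div] at this
  exact this

lemma cin_deriv2 (s1 s2 σ : ℝ) : HasDerivAt
    (fun σ => deriv Real.smoothTransition ((σ - s1) / (s2 - s1)) / (s2 - s1))
    (deriv (deriv Real.smoothTransition) ((σ - s1) / (s2 - s1)) / (s2 - s1) ^ 2) σ := by
  have hd : ContDiff ℝ 1 (deriv Real.smoothTransition) := ContDiff.deriv' (Real.smoothTransition.contDiff (n := 2))
  have h1 := (hd.differentiable (by norm_num) ((σ - s1) / (s2 - s1))).hasDerivAt
  have h2 : HasDerivAt (fun σ => (σ - s1) / (s2 - s1)) (1 / (s2 - s1)) σ :=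
    ((hasDerivAt_id σ).sub_const s1).div_const _
  have := (h1.comp σ h2).div_const (s2 - s1)
  rw [mul_one_div, div_div, ← sq] at this
  exact this
end P11

section P12
variable {n : ℕ} {f g u : En n → ℝ} {i : Fin n} {x : En n}
variable {A : En n → Matrix (Fin n) (Fin n) ℝ} {lam α C : ℝ}

def Qf (A : En n → Matrix (Fin n) (Fin n) ℝ) (χ u : En n → ℝ) (x : En n) : ℝ :=
  2 * (∑ i, gv A χ i x * pd i u x) + u x * Lop A χ x

lemma Qf_congr (h : f =ᶠ[nhds x] g) : Qf A f u x = Qf A g u x := by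
  have h1 : ∀ i, gv A f i =ᶠ[nhds x] gv A g i := fun i => by
    filter_upwards [eventually_eventually_nhds.2 h] with y hy
    exact Finset.sum_congr rfl fun j _ => by rw [pd_congr hy]
  unfold Qf Lop
  congr 2
  · exact Finset.sum_congr rfl fun i _ => by rw [(h1 i).eq_of_nhds]
  · exact Finset.sum_congr rfl fun i _ => pd_congr (h1 i)

lemma Qf_const (c : ℝ) : Qf A (fun _ => c) u x = 0 := by
  have h : ∀ i, gv A (fun _ => c) i = fun _ => 0 := fun i => by
    ext y; simp [gv, pd_const]
  simp [Qf, Lop, h, pd_const]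

lemma Qf_u_zero (h : u =ᶠ[nhds x] fun _ => 0) : Qf A f u x = 0 := by
  have : ∀ i, pd i u x = 0 := fun i => by rw [pd_congr h, pd_const]
  simp [Qf, this, h.eq_of_nhds]

lemma cont_Qf (hA : EllipticDecay A lam α C) (hu : WeakSol A u) (hf : ContDiff ℝ 2 f) (hx : x ∈ OmegaExt n) :
    ContinuousAt (Qf A f u) x := by
  have hAc : ∀ i j, ContDiffAt ℝ 1 (fun y => A y i j) x := fun i j => ED_cd hA hx i j
  refine (continuousAt_const.mul ?_).add ((WS_cd hu hx).continuousAt.mul (cont_Lop hAc hf.contDiffAt))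
  exact tendsto_finsetSum _ fun i _ => (cd_gv hAc hf.contDiffAt i).continuousAt.mul (WS_cd hu hx).pd0

/-- inner cutoff -/
def chin (n : ℕ) (s1 s2 : ℝ) (x : En n) : ℝ := cin s1 s2 (‖x‖ ^ 2)
/-- outer cutoff -/
def psiR (n : ℕ) (R : ℝ) (x : En n) : ℝ := 1 - cin (R ^ 2) (2 * R ^ 2) (‖x‖ ^ 2)

lemma chin_smooth (s1 s2 : ℝ) {k : ℕ∞} : ContDiff ℝ k (chin n s1 s2) := (cin_smooth s1 s2).comp contDiff_normsq
lemma psiR_smooth (R : ℝ) {k : ℕ∞} : ContDiff ℝ k (psiR n R) := contDiff_const.sub (chin_smooth _ _)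

lemma nsq_cont : Continuous (fun x : En n => ‖x‖ ^ 2) := by fun_prop

lemma Qf_chin_zero {s1 s2 : ℝ} (h : s1 < s2) (hx : ‖x‖ ^ 2 < s1 ∨ s2 < ‖x‖ ^ 2) : Qf A (chin n s1 s2) u x = 0 := by
  rcases hx with hx | hx
  · rw [Qf_congr (g := fun _ => 0), Qf_const]
    filter_upwards [nsq_cont.continuousAt.eventually (Iio_mem_nhds hx)] with y hy using cin_zero h (le_of_lt hy)
  · rw [Qf_congr (g := fun _ => 1), Qf_const]
    filter_upwards [nsq_cont.continuousAt.eventually (Ioi_mem_nhds hx)] with y hy using cin_one h (le_of_lt hy)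

lemma Qf_psi_zero {R : ℝ} (hR : 0 < R) (hx : ‖x‖ ^ 2 < R ^ 2 ∨ 2 * R ^ 2 < ‖x‖ ^ 2) : Qf A (psiR n R) u x = 0 := by
  have h : R ^ 2 < 2 * R ^ 2 := by nlinarith
  rcases hx with hx | hx
  · rw [Qf_congr (g := fun _ => 1), Qf_const]
    filter_upwards [nsq_cont.continuousAt.eventually (Iio_mem_nhds hx)] with y hy
    simp [psiR, cin_zero h (le_of_lt hy)]
  · rw [Qf_congr (g := fun _ => 0), Qf_const]
    filter_upwards [nsq_cont.continuousAt.eventually (Ioi_mem_nhds hx)] with y hy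
    simp [psiR, cin_one h (le_of_lt hy)]

lemma annulus_compact (a b : ℝ) : IsCompact {x : En n | a ≤ ‖x‖ ^ 2 ∧ ‖x‖ ^ 2 ≤ b} := by
  refine (isCompact_closedBall (0 : En n) (Real.sqrt b)).of_isClosed_subset ?_ ?_
  · exact (isClosed_le continuous_const nsq_cont).inter (isClosed_le nsq_cont continuous_const)
  · intro x hx
    rw [mem_closedBall_zero_iff]
    exact Real.le_sqrt_of_sq_le hx.2

lemma push (hA : EllipticDecay A lam α C) (hu : WeakSol A u) {V : Set (En n)} (hV : V ⊆ OmegaExt n)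
    {w1 w2 : En n → ℝ} {φ : ℝ → ℝ} (hw1 : ∀ x ∈ V, ContinuousAt w1 x) (hw2 : ∀ x ∈ V, ContinuousAt w2 x)
    (hn1 : ∀ x, 0 ≤ w1 x) (hn2 : ∀ x, 0 ≤ w2 x)
    (hφ : ∀ x ∈ V, ContinuousAt (fun x : En n => φ (‖x‖ ^ 2)) x) (hmono : MonotoneOn φ (Set.Ioi 0))
    (hC : ∀ z : En n → ℝ, ContDiff ℝ 2 z → HasCompactSupport z → tsupport z ⊆ V →
      ∫ x, w1 x * Real.exp (φ (‖x‖ ^ 2)) ^ 2 * z x ^ 2 ≤ ∫ x, w2 x * Real.exp (φ (‖x‖ ^ 2)) ^ 2 * (Lop A z x + z x) ^ 2)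
    {s1 s2 s3 s4 R : ℝ} (h0 : 0 < s1) (h12 : s1 < s2) (h23 : s2 < s3) (h34 : s3 ≤ s4) (hR : 0 < R) (h4R : s4 ≤ R ^ 2)
    (hKV : {x : En n | s1 ≤ ‖x‖ ^ 2 ∧ ‖x‖ ^ 2 ≤ 2 * R ^ 2} ⊆ V) :
    Real.exp (φ s3) ^ 2 * ∫ x in {x : En n | s3 ≤ ‖x‖ ^ 2 ∧ ‖x‖ ^ 2 ≤ s4}, w1 x * u x ^ 2 ≤
      Real.exp (φ s2) ^ 2 * (∫ x, w2 x * Qf A (chin n s1 s2) u x ^ 2) +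
        ∫ x, w2 x * Real.exp (φ (‖x‖ ^ 2)) ^ 2 * Qf A (psiR n R) u x ^ 2 := by
  have hRR : R ^ 2 < 2 * R ^ 2 := by nlinarith
  set K : Set (En n) := {x : En n | s1 ≤ ‖x‖ ^ 2 ∧ ‖x‖ ^ 2 ≤ 2 * R ^ 2} with hKdef
  have hK : IsCompact K := annulus_compact _ _
  set χ : En n → ℝ := fun x => chin n s1 s2 x * psiR n R x with hχ
  have hχs : ContDiff ℝ (⊤ : ℕ∞) χ := (chin_smooth s1 s2).mul (psiR_smooth R)
  have hχ0 : ∀ x, x ∉ K → χ x = 0 := by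
    intro x hx
    by_cases h : s1 ≤ ‖x‖ ^ 2
    · have : 2 * R ^ 2 ≤ ‖x‖ ^ 2 := by
        by_contra hh; exact hx ⟨h, by linarith⟩
      simp [hχ, psiR, cin_one hRR this]
    · simp [hχ, chin, cin_zero h12 (le_of_not_ge h)]
  have hχt : tsupport χ ⊆ K := tsupp_K hK hχ0
  have hχc : HasCompactSupport χ := hK.of_isClosed_subset (isClosed_tsupport _) hχt
  have hec : ∀ x ∈ V, ContinuousAt (fun x : En n => Real.exp (φ (‖x‖ ^ 2)) ^ 2) x := fun x hx =>
    (Real.continuous_exp.continuousAt.comp (hφ x hx)).pow 2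
  have huc : ∀ x ∈ V, ContinuousAt u x := fun x hx => (WS_cd hu (hV hx)).continuousAt
  have main := carl_limit hA hu hV (W1 := fun x => w1 x * Real.exp (φ (‖x‖ ^ 2)) ^ 2)
    (W2 := fun x => w2 x * Real.exp (φ (‖x‖ ^ 2)) ^ 2) (fun x hx => (hw1 x hx).mul (hec x hx))
    (fun x hx => (hw2 x hx).mul (hec x hx)) hC hχs hχc (hχt.trans hKV)
  set S : Set (En n) := {x : En n | s3 ≤ ‖x‖ ^ 2 ∧ ‖x‖ ^ 2 ≤ s4} with hS
  have hSc : IsCompact S := annulus_compact _ _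
  have hSK : S ⊆ K := fun x hx => ⟨by have := hx.1; linarith, by have := hx.2; linarith⟩
  have iL : Integrable (fun x => w1 x * Real.exp (φ (‖x‖ ^ 2)) ^ 2 * (χ x * u x) ^ 2) :=
    int_K hK hKV (fun x hx => ((hw1 x hx).mul (hec x hx)).mul ((hχs.continuous.continuousAt.mul (huc x hx)).pow 2))
      (fun x hx => by simp [hχ0 x hx])
  have left : Real.exp (φ s3) ^ 2 * ∫ x in S, w1 x * u x ^ 2 ≤
      ∫ x, w1 x * Real.exp (φ (‖x‖ ^ 2)) ^ 2 * (χ x * u x) ^ 2 := by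
    rw [← integral_const_mul]
    refine le_trans (setIntegral_mono_on ?_ iL.integrableOn hSc.measurableSet ?_)
      (setIntegral_le_integral iL (Eventually.of_forall fun x => ?_))
    · refine ContinuousOn.integrableOn_compact hSc fun x hx => ContinuousAt.continuousWithinAt ?_
      exact continuousAt_const.mul ((hw1 x (hKV (hSK hx))).mul ((huc x (hKV (hSK hx))).pow 2))
    · intro x hx
      have e1 : χ x = 1 := by
        have a1 := hx.1
        have a2 := hx.2
        simp [hχ, chin, psiR, cin_one h12 (show s2 ≤ ‖x‖ ^ 2 by linarith), cin_zero hRR (show ‖x‖ ^ 2 ≤ R ^ 2 by linarith)]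
      rw [e1, one_mul]
      have e2 : Real.exp (φ s3) ≤ Real.exp (φ (‖x‖ ^ 2)) :=
        Real.exp_le_exp.2 (hmono (by simp; linarith) (by simp only [Set.mem_Ioi]; linarith [hx.1]) hx.1)
      have e3 : Real.exp (φ s3) ^ 2 ≤ Real.exp (φ (‖x‖ ^ 2)) ^ 2 := by gcongr
      have := mul_le_mul_of_nonneg_right e3 (mul_nonneg (hn1 x) (sq_nonneg (u x)))
      linarith
    · have := hn1 x
      simp only [Pi.zero_apply]
      positivity
  have cQ1 : ∀ x ∈ V, ContinuousAt (Qf A (chin n s1 s2) u) x := fun x hx => cont_Qf hA hu (chin_smooth (k := 2) _ _) (hV hx)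
  have cQ2 : ∀ x ∈ V, ContinuousAt (Qf A (psiR n R) u) x := fun x hx => cont_Qf hA hu (psiR_smooth (k := 2) _) (hV hx)
  have cQ3 : ∀ x ∈ V, ContinuousAt (Qf A χ u) x := fun x hx => cont_Qf hA hu (hχs.of_le two_le_top) (hV hx)
  have i1 : Integrable (fun x => w2 x * Qf A (chin n s1 s2) u x ^ 2) := by
    refine int_K hK hKV (fun x hx => (hw2 x hx).mul ((cQ1 x hx).pow 2)) fun x hx => ?_
    have : ‖x‖ ^ 2 < s1 ∨ s2 < ‖x‖ ^ 2 := by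
      by_contra hh; push Not at hh; exact hx ⟨hh.1, by linarith [hh.2]⟩
    simp [Qf_chin_zero h12 this]
  have i2 : Integrable (fun x => w2 x * Real.exp (φ (‖x‖ ^ 2)) ^ 2 * Qf A (psiR n R) u x ^ 2) := by
    refine int_K hK hKV (fun x hx => ((hw2 x hx).mul (hec x hx)).mul ((cQ2 x hx).pow 2)) fun x hx => ?_
    have : ‖x‖ ^ 2 < R ^ 2 ∨ 2 * R ^ 2 < ‖x‖ ^ 2 := by
      by_contra hh; push Not at hh; exact hx ⟨by linarith [hh.1], by linarith [hh.2]⟩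
    simp [Qf_psi_zero hR this]
  have hcase1 : ∀ x : En n, ‖x‖ ^ 2 < R ^ 2 → Qf A χ u x = Qf A (chin n s1 s2) u x := fun x hx => by
    refine Qf_congr ?_
    filter_upwards [nsq_cont.continuousAt.eventually (Iio_mem_nhds hx)] with y hy
    simp [hχ, psiR, cin_zero hRR (le_of_lt hy)]
  have hcase2 : ∀ x : En n, s2 < ‖x‖ ^ 2 → Qf A χ u x = Qf A (psiR n R) u x := fun x hx => by
    refine Qf_congr ?_
    filter_upwards [nsq_cont.continuousAt.eventually (Ioi_mem_nhds hx)] with y hy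
    simp [hχ, chin, cin_one h12 (le_of_lt hy)]
  have hQ0 : ∀ x, x ∉ K → Qf A χ u x = 0 := fun x hx => by
    by_cases h : s2 < ‖x‖ ^ 2
    · rw [hcase2 x h, Qf_psi_zero hR]
      right; by_contra hh; push Not at hh; exact hx ⟨by linarith, hh⟩
    · rw [hcase1 x (by linarith), Qf_chin_zero h12]
      left; by_contra hh; push Not at hh; exact hx ⟨hh, by linarith⟩
  have i3 : Integrable (fun x => w2 x * Real.exp (φ (‖x‖ ^ 2)) ^ 2 * Qf A χ u x ^ 2) :=
    int_K hK hKV (fun x hx => ((hw2 x hx).mul (hec x hx)).mul ((cQ3 x hx).pow 2)) fun x hx => by simp [hQ0 x hx]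
  refine left.trans (main.trans ?_)
  rw [← integral_const_mul, ← integral_add (i1.const_mul _) i2]
  refine integral_mono i3 ((i1.const_mul _).add i2) fun x => ?_
  have p2 := hn2 x
  by_cases h : s2 < ‖x‖ ^ 2
  · have e : Qf A χ u x = Qf A (psiR n R) u x := hcase2 x h
    change w2 x * Real.exp (φ (‖x‖ ^ 2)) ^ 2 * Qf A χ u x ^ 2 ≤ Real.exp (φ s2) ^ 2 * (w2 x * Qf A (chin n s1 s2) u x ^ 2) + w2 x * Real.exp (φ (‖x‖ ^ 2)) ^ 2 * Qf A (psiR n R) u x ^ 2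
    rw [e]
    have : 0 ≤ Real.exp (φ s2) ^ 2 * (w2 x * Qf A (chin n s1 s2) u x ^ 2) := by positivity
    linarith
  · have e : Qf A χ u x = Qf A (chin n s1 s2) u x := hcase1 x (by linarith)
    change w2 x * Real.exp (φ (‖x‖ ^ 2)) ^ 2 * Qf A χ u x ^ 2 ≤ Real.exp (φ s2) ^ 2 * (w2 x * Qf A (chin n s1 s2) u x ^ 2) + w2 x * Real.exp (φ (‖x‖ ^ 2)) ^ 2 * Qf A (psiR n R) u x ^ 2
    rw [e]
    have p3 : 0 ≤ w2 x * Real.exp (φ (‖x‖ ^ 2)) ^ 2 * Qf A (psiR n R) u x ^ 2 := by positivity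
    by_cases hx1 : ‖x‖ ^ 2 < s1
    · rw [Qf_chin_zero h12 (Or.inl hx1)]; simpa using p3
    · push Not at h hx1
      have e2 : Real.exp (φ (‖x‖ ^ 2)) ≤ Real.exp (φ s2) :=
        Real.exp_le_exp.2 (hmono (by simp only [Set.mem_Ioi]; linarith) (by simp only [Set.mem_Ioi]; linarith) h)
      have e3 : Real.exp (φ (‖x‖ ^ 2)) ^ 2 ≤ Real.exp (φ s2) ^ 2 := by gcongr
      have := mul_le_mul_of_nonneg_right e3 (mul_nonneg p2 (sq_nonneg (Qf A (chin n s1 s2) u x)))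
      linarith
end P12

section P13
variable {n : ℕ} {f g u : En n → ℝ} {i : Fin n} {x : En n}
variable {A : En n → Matrix (Fin n) (Fin n) ℝ} {lam α C : ℝ}

lemma radial_gn {F : ℝ → ℝ} {F1 : ℝ} (h : HasDerivAt F F1 (‖x‖ ^ 2)) :
    gn (fun y : En n => F (‖y‖ ^ 2)) x = 2 * |F1| * ‖x‖ := by
  have e : ∑ i, (pd i (fun y : En n => F (‖y‖ ^ 2)) x) ^ 2 = (2 * |F1| * ‖x‖) ^ 2 := by
    have : (2 * |F1| * ‖x‖) ^ 2 = ∑ i, 4 * F1 ^ 2 * x i ^ 2 := by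
      rw [← Finset.mul_sum, ← normsq_eq, mul_pow, mul_pow, sq_abs]; ring
    rw [this]
    exact Finset.sum_congr rfl fun i _ => by rw [pd_radial h]; ring
  rw [gn, e, Real.sqrt_sq (by positivity)]

lemma radial_arith {p a C X f1 f2 xi xj d : ℝ} (h1 : X * |p| ≤ C) (h2 : |a| ≤ 1 + C) (hd : |d| ≤ 1)
    (hi : |xi| ≤ X) (hj : |xj| ≤ X) (hC : 0 ≤ C) :
    |p * (f1 * (2 * xj)) + a * (f2 * (2 * xi) * (2 * xj) + f1 * (2 * d))| ≤
      C * (2 * |f1|) + (1 + C) * (4 * |f2| * X ^ 2 + 2 * |f1|) := by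
  have hX : 0 ≤ X := (abs_nonneg _).trans hi
  have t1 : |p * (f1 * (2 * xj))| ≤ C * (2 * |f1|) := by
    have : |p * (f1 * (2 * xj))| = (|xj| * |p|) * (2 * |f1|) := by
      rw [abs_mul, abs_mul, abs_mul, abs_of_pos (by norm_num : (0:ℝ) < 2)]; ring
    rw [this]
    have : |xj| * |p| ≤ X * |p| := by gcongr
    gcongr
    linarith
  have t2 : |f2 * (2 * xi) * (2 * xj) + f1 * (2 * d)| ≤ 4 * |f2| * X ^ 2 + 2 * |f1| := by
    refine (abs_add_le _ _).trans ?_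
    have e1 : |f2 * (2 * xi) * (2 * xj)| = 4 * |f2| * (|xi| * |xj|) := by
      simp only [abs_mul, abs_of_pos (by norm_num : (0:ℝ) < 2)]; ring
    have e2 : |f1 * (2 * d)| = 2 * |f1| * |d| := by
      simp only [abs_mul, abs_of_pos (by norm_num : (0:ℝ) < 2)]; ring
    rw [e1, e2]
    have : |xi| * |xj| ≤ X * X := by gcongr
    have e3 : 4 * |f2| * (|xi| * |xj|) ≤ 4 * |f2| * X ^ 2 := by rw [sq]; gcongr
    have e4 : 2 * |f1| * |d| ≤ 2 * |f1| * 1 := by gcongr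
    linarith
  refine (abs_add_le _ _).trans (add_le_add t1 (abs_mul_le h2 t2))

lemma radial_L (hA : EllipticDecay A lam α C) (hα : 0 < α) (hC : 0 < C) (hx : x ∈ OmegaExt n)
    {F F1 F2 : ℝ → ℝ} (h1 : ∀ σ, HasDerivAt F (F1 σ) σ) (h2 : ∀ σ, HasDerivAt F1 (F2 σ) σ) :
    |Lop A (fun y : En n => F (‖y‖ ^ 2)) x| ≤
      n * (n * (C * (2 * |F1 (‖x‖ ^ 2)|) + (1 + C) * (4 * |F2 (‖x‖ ^ 2)| * ‖x‖ ^ 2 + 2 * |F1 (‖x‖ ^ 2)|))) := by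
  have hd1 : DifferentiableAt ℝ (fun y : En n => F1 (‖y‖ ^ 2)) x :=
    (h2 (‖x‖ ^ 2)).differentiableAt.comp x ((contDiff_normsq (k := 1)).differentiable one_ne_zero x)
  have hp : ∀ j, pd j (fun y : En n => F (‖y‖ ^ 2)) = fun y => F1 (‖y‖ ^ 2) * (2 * y j) := fun j => by
    ext y; exact pd_radial (h1 _) j
  have hg : ∀ i, gv A (fun y : En n => F (‖y‖ ^ 2)) i = fun y => ∑ j, A y i j * (F1 (‖y‖ ^ 2) * (2 * y j)) := fun i => by
    ext y; simp only [gv, hp]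
  have hdx : ∀ j, DifferentiableAt ℝ (fun y : En n => 2 * y j) x := fun j => (diff_coord j x).const_mul 2
  unfold Lop
  refine abs_sum_le_n fun i => ?_
  rw [hg, pd_sum_mul (F := fun j y => A y i j) (G := fun j y => F1 (‖y‖ ^ 2) * (2 * y j)) _
    (fun j => (ED_cd hA hx i j).differentiableAt one_ne_zero) (fun j => hd1.mul (hdx j))]
  refine abs_sum_le_n fun j => ?_
  rw [pd_mul (f := fun y : En n => F1 (‖y‖ ^ 2)) (g := fun y : En n => 2 * y j) hd1 (hdx j), pd_radial (h2 _), pd_const_mul 2 (diff_coord j x), pd_coord]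
  refine radial_arith ?_ (ED_abs hA hα hC hx i j) ?_ (coord_le x i) (coord_le x j) hC.le
  · exact (ED_b2 hA hx _ _ _).trans (mul_le_of_le_one_right hC.le (ED_pow_le hx hα))
  · split_ifs <;> simp

lemma Q_arith {N C S R f1 f2 X q t u g L : ℝ} (hC : 0 < C) (hS : 0 ≤ S) (hR : 1 ≤ R) (hN : 0 ≤ N)
    (hX0 : 0 ≤ X) (hX : X ^ 2 ≤ 2 * R ^ 2) (hf1 : |f1| ≤ S / R ^ 2) (hf2 : |f2| ≤ S / R ^ 4) (hg : 0 ≤ g)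
    (hq : q = 2 * |f1| * X)
    (ht : |t| ≤ N * (N * ((1 + C) * q) * g))
    (hL : |L| ≤ N * (N * (C * (2 * |f1|) + (1 + C) * (4 * |f2| * X ^ 2 + 2 * |f1|)))) :
    (2 * t + u * L) ^ 2 ≤ 2 * (12 * N ^ 2 * (1 + C) * S) ^ 2 / R ^ 2 * (g ^ 2 + u ^ 2) := by
  have hR0 : 0 < R := by linarith
  have hXR : X ≤ 2 * R := by
    refine abs_le_of_sq_le_sq' ?_ (by linarith) |>.2
    nlinarith
  have hq2 : q ≤ 4 * S / R := by
    rw [hq]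
    calc 2 * |f1| * X ≤ 2 * (S / R ^ 2) * (2 * R) := by gcongr
      _ = 4 * S / R := by field_simp; ring
  set D := 12 * N ^ 2 * (1 + C) * S / R with hD
  have hD0 : 0 ≤ D := by positivity
  have b1 : |2 * t| ≤ D * g := by
    rw [abs_mul, abs_of_pos (by norm_num : (0:ℝ) < 2)]
    calc 2 * |t| ≤ 2 * (N * (N * ((1 + C) * (4 * S / R)) * g)) := by
          have : N * (N * ((1 + C) * q) * g) ≤ N * (N * ((1 + C) * (4 * S / R)) * g) := by gcongr
          linarith
      _ = 8 * N ^ 2 * (1 + C) * S / R * g := by ring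
      _ ≤ D * g := by rw [hD]; gcongr; norm_num
  have b2 : |L| ≤ D := by
    have e1 : |f1| ≤ S / R := hf1.trans (by gcongr; nlinarith)
    have e2 : |f2| * X ^ 2 ≤ 2 * S / R := by
      calc |f2| * X ^ 2 ≤ S / R ^ 4 * (2 * R ^ 2) := by gcongr
        _ = 2 * S / R ^ 2 := by field_simp
        _ ≤ 2 * S / R := by gcongr; nlinarith
    refine hL.trans ?_
    have e3 : C * (2 * |f1|) + (1 + C) * (4 * |f2| * X ^ 2 + 2 * |f1|) ≤ 12 * (1 + C) * (S / R) := by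
      have h1 : 4 * |f2| * X ^ 2 + 2 * |f1| ≤ 10 * (S / R) := by
        have : 2 * S / R = 2 * (S / R) := by ring
        linarith
      have h2 : (1 + C) * (4 * |f2| * X ^ 2 + 2 * |f1|) ≤ (1 + C) * (10 * (S / R)) := by gcongr
      have h3 : C * (2 * |f1|) ≤ C * (2 * (S / R)) := by gcongr
      have h4 : 0 ≤ S / R := by positivity
      linarith
    calc _ ≤ N * (N * (12 * (1 + C) * (S / R))) := by gcongr
      _ = D := by rw [hD]; ring
  have b3 : |2 * t + u * L| ≤ D * g + |u| * D := by
    refine (abs_add_le _ _).trans (add_le_add b1 ?_)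
    rw [abs_mul]; gcongr
  have e : 2 * (12 * N ^ 2 * (1 + C) * S) ^ 2 / R ^ 2 = 2 * D ^ 2 := by rw [hD]; ring
  rw [e, ← sq_abs, ← sq_abs u]
  calc |2 * t + u * L| ^ 2 ≤ (D * g + |u| * D) ^ 2 := by gcongr
    _ ≤ 2 * D ^ 2 * (g ^ 2 + |u| ^ 2) := by nlinarith [sq_nonneg (D * (g - |u|))]

lemma psi_der {S R : ℝ} (hS1 : ∀ t, |deriv Real.smoothTransition t| ≤ S)
    (hS2 : ∀ t, |deriv (deriv Real.smoothTransition) t| ≤ S) (hR0 : 0 < R) :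
    ∃ F1 F2 : ℝ → ℝ, (∀ σ, HasDerivAt (fun σ => 1 - cin (R ^ 2) (2 * R ^ 2) σ) (F1 σ) σ) ∧
      (∀ σ, HasDerivAt F1 (F2 σ) σ) ∧ (∀ σ, |F1 σ| ≤ S / R ^ 2) ∧ (∀ σ, |F2 σ| ≤ S / R ^ 4) := by
  have eR : 2 * R ^ 2 - R ^ 2 = R ^ 2 := by ring
  refine ⟨_, _, fun σ => (cin_deriv (R ^ 2) (2 * R ^ 2) σ).const_sub 1, fun σ => (cin_deriv2 (R ^ 2) (2 * R ^ 2) σ).neg, fun σ => ?_, fun σ => ?_⟩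
  · rw [eR, abs_neg, abs_div, abs_of_pos (show 0 < R ^ 2 by positivity)]
    gcongr; exact hS1 _
  · rw [eR, abs_neg, abs_div, ← pow_mul, abs_of_pos (show 0 < R ^ (2 * 2) by positivity)]
    gcongr; exact hS2 _

lemma psi_pt (hA : EllipticDecay A lam α C) (hα : 0 < α) (hC : 0 < C) :
    ∃ D : ℝ, 0 ≤ D ∧ ∀ u : En n → ℝ, ∀ R : ℝ, 1 ≤ R → ∀ x ∈ OmegaExt n, ‖x‖ ^ 2 ≤ 2 * R ^ 2 →
      Qf A (psiR n R) u x ^ 2 ≤ D / R ^ 2 * (gn u x ^ 2 + u x ^ 2) := by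
  obtain ⟨S, hS, hS1, hS2⟩ := st_bound
  refine ⟨2 * (12 * (n:ℝ) ^ 2 * (1 + C) * S) ^ 2, by positivity, fun u R hR x hx hxR => ?_⟩
  obtain ⟨F1, F2, d1, d2, k1, k2⟩ := psi_der hS1 hS2 (show 0 < R by linarith)
  have r1 : gn (psiR n R) x = 2 * |F1 (‖x‖ ^ 2)| * ‖x‖ := radial_gn (F := fun σ => 1 - cin (R ^ 2) (2 * R ^ 2) σ) (d1 (‖x‖ ^ 2))
  have r2 := gvs_abs (f := psiR n R) (g := u) hA hα hC hx
  have r3 := radial_L (F := fun σ => 1 - cin (R ^ 2) (2 * R ^ 2) σ) hA hα hC hx d1 d2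
  have hgu := gn_nonneg (v := u) (x := x)
  have e : (fun y : En n => 1 - cin (R ^ 2) (2 * R ^ 2) (‖y‖ ^ 2)) = psiR n R := rfl
  rw [e] at r3
  unfold Qf
  exact Q_arith hC hS hR (Nat.cast_nonneg n) (norm_nonneg x) hxR (k1 _) (k2 _) hgu r1 r2 r3

/-- wide shell -/
def shell (n : ℕ) (R : ℝ) : Set (En n) := {x | R ^ 2 / 2 ≤ ‖x‖ ^ 2 ∧ ‖x‖ ^ 2 ≤ 4 * R ^ 2}

def zR (n : ℕ) (R : ℝ) (x : En n) : ℝ := cin (R ^ 2 / 2) (R ^ 2) (‖x‖ ^ 2) * (1 - cin (2 * R ^ 2) (4 * R ^ 2) (‖x‖ ^ 2))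

lemma shell_sub {R : ℝ} (hR : 2 ≤ R) : shell n R ⊆ OmegaExt n := by
  intro x hx
  have := hx.1
  show 1 < ‖x‖
  have h2 : 1 < ‖x‖ ^ 2 := by nlinarith
  nlinarith [norm_nonneg x]

lemma psi_int (hlam : 0 < lam) (hA : EllipticDecay A lam α C) (hα : 0 < α) (hC : 0 < C) (hu : WeakSol A u) :
    ∃ D : ℝ, 0 ≤ D ∧ ∀ R : ℝ, 2 ≤ R →
      Integrable (fun x => Qf A (psiR n R) u x ^ 2) ∧
      ∫ x, Qf A (psiR n R) u x ^ 2 ≤ D / R ^ 2 * ∫ x in shell n R, u x ^ 2 := by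
  obtain ⟨D, hD, hQ⟩ := psi_pt (n := n) hA hα hC
  obtain ⟨Kc, hKc, hcac⟩ := caccio hlam hA hα hC hu
  obtain ⟨S, hS, hS1, hS2⟩ := st_bound
  refine ⟨D * (Kc * (1 + (12 * S) ^ 2) + 1), by positivity, fun R hR => ?_⟩
  have hR0 : 0 < R := by linarith
  have hK : IsCompact (shell n R) := annulus_compact _ _
  have hKO := shell_sub (n := n) hR
  have h12 : R ^ 2 / 2 < R ^ 2 := by nlinarith
  have h34 : 2 * R ^ 2 < 4 * R ^ 2 := by nlinarith
  have hz0 : ∀ x, x ∉ shell n R → zR n R x = 0 := by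
    intro x hx
    by_cases h : R ^ 2 / 2 ≤ ‖x‖ ^ 2
    · have : 4 * R ^ 2 ≤ ‖x‖ ^ 2 := by
        by_contra hh; exact hx ⟨h, by linarith⟩
      simp [zR, cin_one h34 this]
    · simp [zR, cin_zero h12 (le_of_not_ge h)]
  have hzt : tsupport (zR n R) ⊆ shell n R := tsupp_K hK hz0
  have hzc : HasCompactSupport (zR n R) := hK.of_isClosed_subset (isClosed_tsupport _) hzt
  have hzs : ContDiff ℝ 1 (zR n R) :=
    ((cin_smooth _ _ (k := 1)).comp contDiff_normsq).mul (contDiff_const.sub ((cin_smooth _ _ (k := 1)).comp contDiff_normsq))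
  have hzle : ∀ x, zR n R x ^ 2 ≤ 1 := fun x => by
    have a1 := cin_nonneg (R ^ 2 / 2) (R ^ 2) (‖x‖ ^ 2)
    have a2 := cin_le_one (R ^ 2 / 2) (R ^ 2) (‖x‖ ^ 2)
    have a3 := cin_nonneg (2 * R ^ 2) (4 * R ^ 2) (‖x‖ ^ 2)
    have a4 := cin_le_one (2 * R ^ 2) (4 * R ^ 2) (‖x‖ ^ 2)
    refine pow_le_one₀ (mul_nonneg a1 (by linarith)) (mul_le_one₀ a2 (by linarith) (by linarith))
  have hzg : ∀ x ∈ shell n R, gn (zR n R) x ≤ 12 * S := by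
    intro x hx
    have hd := (cin_deriv (R ^ 2 / 2) (R ^ 2) (‖x‖ ^ 2)).mul ((cin_deriv (2 * R ^ 2) (4 * R ^ 2) (‖x‖ ^ 2)).const_sub 1)
    have := radial_gn (n := n) (x := x) (F := fun σ => cin (R ^ 2 / 2) (R ^ 2) σ * (1 - cin (2 * R ^ 2) (4 * R ^ 2) σ)) hd
    change gn (zR n R) x = _ at this
    rw [this]
    have hXR : ‖x‖ ≤ 2 * R := by
      refine abs_le_of_sq_le_sq' ?_ (by linarith) |>.2
      nlinarith [hx.2]
    have e1 : |deriv Real.smoothTransition ((‖x‖ ^ 2 - R ^ 2 / 2) / (R ^ 2 - R ^ 2 / 2)) / (R ^ 2 - R ^ 2 / 2)| ≤ 2 * S / R ^ 2 := by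
      rw [abs_div, abs_of_pos (show 0 < R ^ 2 - R ^ 2 / 2 by linarith)]
      rw [div_le_div_iff₀ (by linarith) (by positivity)]
      nlinarith [hS1 ((‖x‖ ^ 2 - R ^ 2 / 2) / (R ^ 2 - R ^ 2 / 2))]
    have e2 : |deriv Real.smoothTransition ((‖x‖ ^ 2 - 2 * R ^ 2) / (4 * R ^ 2 - 2 * R ^ 2)) / (4 * R ^ 2 - 2 * R ^ 2)| ≤ S / R ^ 2 := by
      rw [abs_div, abs_of_pos (show 0 < 4 * R ^ 2 - 2 * R ^ 2 by linarith)]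
      rw [div_le_div_iff₀ (by linarith) (by positivity)]
      have := hS1 ((‖x‖ ^ 2 - 2 * R ^ 2) / (4 * R ^ 2 - 2 * R ^ 2))
      nlinarith [mul_nonneg hS (sq_nonneg R)]
    have a1 := cin_nonneg (R ^ 2 / 2) (R ^ 2) (‖x‖ ^ 2)
    have a2 := cin_le_one (R ^ 2 / 2) (R ^ 2) (‖x‖ ^ 2)
    have a3 := cin_nonneg (2 * R ^ 2) (4 * R ^ 2) (‖x‖ ^ 2)
    have a4 := cin_le_one (2 * R ^ 2) (4 * R ^ 2) (‖x‖ ^ 2)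
    generalize deriv Real.smoothTransition ((‖x‖ ^ 2 - R ^ 2 / 2) / (R ^ 2 - R ^ 2 / 2)) / (R ^ 2 - R ^ 2 / 2) = p at *
    generalize deriv Real.smoothTransition ((‖x‖ ^ 2 - 2 * R ^ 2) / (4 * R ^ 2 - 2 * R ^ 2)) / (4 * R ^ 2 - 2 * R ^ 2) = q at *
    have e3 : |p * (1 - cin (2 * R ^ 2) (4 * R ^ 2) (‖x‖ ^ 2)) + cin (R ^ 2 / 2) (R ^ 2) (‖x‖ ^ 2) * -q| ≤ 3 * S / R ^ 2 := by
      refine (abs_add_le _ _).trans ?_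
      rw [abs_mul, abs_mul, abs_neg, abs_of_nonneg (show 0 ≤ 1 - cin (2 * R ^ 2) (4 * R ^ 2) (‖x‖ ^ 2) by linarith), abs_of_nonneg a1]
      have f1 : |p| * (1 - cin (2 * R ^ 2) (4 * R ^ 2) (‖x‖ ^ 2)) ≤ |p| := mul_le_of_le_one_right (abs_nonneg _) (by linarith)
      have f2 : cin (R ^ 2 / 2) (R ^ 2) (‖x‖ ^ 2) * |q| ≤ |q| := mul_le_of_le_one_left (abs_nonneg _) a2
      have : 3 * S / R ^ 2 = 2 * S / R ^ 2 + S / R ^ 2 := by ring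
      linarith
    calc _ ≤ 2 * (3 * S / R ^ 2) * (2 * R) := by gcongr
      _ = 12 * S / R := by field_simp; ring
      _ ≤ 12 * S := div_le_self (by positivity) (by linarith)
  have huc : ∀ x ∈ OmegaExt n, ContinuousAt u x := fun x hx => (WS_cd hu hx).continuousAt
  have hpuc : ∀ x ∈ OmegaExt n, ∀ i, ContinuousAt (pd i u) x := fun x hx i => (WS_cd hu hx).pd0
  have hcz : ∀ x, ContinuousAt (zR n R) x := fun x => hzs.continuous.continuousAt
  have hcg : ∀ x, ContinuousAt (gn (zR n R)) x := fun x => cont_gn fun i => (cont_pd hzs).continuousAt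
  have iu : IntegrableOn (fun x => u x ^ 2) (shell n R) :=
    ContinuousOn.integrableOn_compact hK fun x hx => ((huc x (hKO hx)).pow 2).continuousWithinAt
  have i1 : Integrable (fun x => zR n R x ^ 2 * gn u x ^ 2) :=
    int_K hK hKO (fun x hx => ((hcz x).pow 2).mul ((cont_gn (hpuc x hx)).pow 2)) (fun x hx => by simp [hz0 x hx])
  have i2 : Integrable (fun x => zR n R x ^ 2 * u x ^ 2) :=
    int_K hK hKO (fun x hx => ((hcz x).pow 2).mul ((huc x hx).pow 2)) (fun x hx => by simp [hz0 x hx])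
  have hgz : ∀ x, x ∉ shell n R → gn (zR n R) x = 0 := fun x hx => gn_zero fun h => hx (hzt h)
  have i3 : Integrable (fun x => (zR n R x ^ 2 + gn (zR n R) x ^ 2) * u x ^ 2) :=
    int_K hK hKO (fun x hx => (((hcz x).pow 2).add ((hcg x).pow 2)).mul ((huc x hx).pow 2)) (fun x hx => by simp [hz0 x hx, hgz x hx])
  have hQ0 : ∀ x, x ∉ shell n R → Qf A (psiR n R) u x = 0 := fun x hx => by
    refine Qf_psi_zero hR0 ?_
    by_contra hh; push Not at hh; exact hx ⟨by linarith [hh.1], by nlinarith [hh.2]⟩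
  have iQ : Integrable (fun x => Qf A (psiR n R) u x ^ 2) :=
    int_K hK hKO (fun x hx => (cont_Qf hA hu (psiR_smooth (k := 2) _) hx).pow 2) (fun x hx => by simp [hQ0 x hx])
  refine ⟨iQ, ?_⟩
  have hc := hcac (zR n R) hzs hzc (hzt.trans hKO)
  have c1 : ∫ x, (zR n R x ^ 2 + gn (zR n R) x ^ 2) * u x ^ 2 ≤ (1 + (12 * S) ^ 2) * ∫ x in shell n R, u x ^ 2 := by
    rw [← setIntegral_eq_integral_of_forall_compl_eq_zero (s := shell n R) (fun x hx => by simp [hz0 x hx, hgz x hx]), ← integral_const_mul]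
    refine setIntegral_mono_on i3.integrableOn (iu.const_mul _) hK.measurableSet fun x hx => ?_
    have := hzle x
    have h2 := hzg x hx
    have h3 := gn_nonneg (v := zR n R) (x := x)
    gcongr
  have c2 : ∫ x, zR n R x ^ 2 * u x ^ 2 ≤ ∫ x in shell n R, u x ^ 2 := by
    rw [← setIntegral_eq_integral_of_forall_compl_eq_zero (s := shell n R) (fun x hx => by simp [hz0 x hx])]
    refine setIntegral_mono_on i2.integrableOn iu hK.measurableSet fun x hx => ?_
    exact mul_le_of_le_one_left (sq_nonneg _) (hzle x)
  have c3 : ∫ x, Qf A (psiR n R) u x ^ 2 ≤ ∫ x, D / R ^ 2 * (zR n R x ^ 2 * gn u x ^ 2 + zR n R x ^ 2 * u x ^ 2) := by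
    refine integral_mono iQ ((i1.add i2).const_mul _) fun x => ?_
    simp only
    by_cases h : R ^ 2 ≤ ‖x‖ ^ 2 ∧ ‖x‖ ^ 2 ≤ 2 * R ^ 2
    · have e : zR n R x = 1 := by simp [zR, cin_one h12 h.1, cin_zero h34 h.2]
      have hx : x ∈ OmegaExt n := hKO ⟨by linarith [h.1], by nlinarith [h.2]⟩
      rw [e]
      have := hQ u R (by linarith) x hx h.2
      linarith
    · rw [Qf_psi_zero hR0 (by by_contra hh; push Not at hh; exact h hh), zero_pow two_ne_zero]
      positivity
  refine c3.trans ?_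
  rw [integral_const_mul, integral_add i1 i2]
  calc _ ≤ D / R ^ 2 * (Kc * ((1 + (12 * S) ^ 2) * ∫ x in shell n R, u x ^ 2) + ∫ x in shell n R, u x ^ 2) := by
        gcongr
        exact hc.trans (by gcongr)
    _ = _ := by ring
end P13

section P14
variable {n : ℕ} {f g u : En n → ℝ} {i : Fin n} {x : En n}
variable {A : En n → Matrix (Fin n) (Fin n) ℝ} {lam α C : ℝ}

lemma gn_congr (h : f =ᶠ[nhds x] g) : gn f x = gn g x := by
  unfold gn; congr 1
  exact Finset.sum_congr rfl fun i _ => by rw [pd_congr h]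

lemma fderiv_gn (f : En n → ℝ) (x : En n) : ‖fderiv ℝ f x‖ = gn f x := by
  have h1 : ‖gradient f x‖ = ‖fderiv ℝ f x‖ := by
    rw [gradient]; exact LinearIsometryEquiv.norm_map _ _
  rw [← h1, EuclideanSpace.norm_eq, gn]
  congr 1
  exact Finset.sum_congr rfl fun i _ => by rw [gradient_coord, Real.norm_eq_abs, sq_abs]

lemma gn_mul_sq (hf : DifferentiableAt ℝ f x) (hg : DifferentiableAt ℝ g x) :
    gn (fun y => f y * g y) x ^ 2 ≤ 2 * (gn f x ^ 2 * g x ^ 2) + 2 * (f x ^ 2 * gn g x ^ 2) := by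
  rw [gn_sq, gn_sq, gn_sq, Finset.sum_mul, Finset.mul_sum, Finset.mul_sum, Finset.mul_sum, ← Finset.sum_add_distrib]
  refine Finset.sum_le_sum fun i _ => ?_
  rw [pd_mul hf hg]
  nlinarith [sq_nonneg (pd i f x * g x - f x * pd i g x)]

lemma gn_comp {φ : ℝ → ℝ} {φ' : ℝ} (hφ : HasDerivAt φ φ' (f x)) (hf : DifferentiableAt ℝ f x) :
    gn (fun y => φ (f y)) x = |φ'| * gn f x := by
  have e : gn (fun y => φ (f y)) x ^ 2 = (|φ'| * gn f x) ^ 2 := by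
    rw [mul_pow, gn_sq, gn_sq, Finset.mul_sum, sq_abs]
    exact Finset.sum_congr rfl fun i _ => by rw [pd_comp hφ hf]; ring
  exact (sq_eq_sq₀ gn_nonneg (mul_nonneg (abs_nonneg _) gn_nonneg)).1 e

lemma big_cut (n : ℕ) : ∃ G : ℝ, 0 ≤ G ∧ ∀ R : ℝ, 2 ≤ R → ∃ ζ : En n → ℝ, ContDiff ℝ 1 ζ ∧ HasCompactSupport ζ ∧
    tsupport ζ ⊆ OmegaExt n ∧ (∀ x, 0 ≤ ζ x) ∧ (∀ x, ζ x ≤ 1) ∧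
    (∀ x, 4 ≤ ‖x‖ ^ 2 → ‖x‖ ^ 2 ≤ R ^ 2 → ζ x = 1) ∧ ∀ x, gn ζ x ≤ G := by
  obtain ⟨S, hS, hS1, hS2⟩ := st_bound
  refine ⟨8 * S, by positivity, fun R hR => ?_⟩
  have hR2 : 4 ≤ R ^ 2 := by nlinarith
  have h12 : (2:ℝ) < 4 := by norm_num
  have h34 : R ^ 2 < 4 * R ^ 2 := by linarith
  set F : ℝ → ℝ := fun σ => cin 2 4 σ * (1 - cin (R ^ 2) (4 * R ^ 2) σ) with hF
  have hK : IsCompact {x : En n | 2 ≤ ‖x‖ ^ 2 ∧ ‖x‖ ^ 2 ≤ 4 * R ^ 2} := annulus_compact _ _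
  have hz0 : ∀ x, x ∉ {x : En n | 2 ≤ ‖x‖ ^ 2 ∧ ‖x‖ ^ 2 ≤ 4 * R ^ 2} → F (‖x‖ ^ 2) = 0 := by
    intro x hx
    by_cases h : 2 ≤ ‖x‖ ^ 2
    · have : 4 * R ^ 2 ≤ ‖x‖ ^ 2 := by
        by_contra hh; exact hx ⟨h, by linarith⟩
      simp [hF, cin_one h34 this]
    · simp [hF, cin_zero h12 (le_of_not_ge h)]
  have ht := tsupp_K (F := fun x : En n => F (‖x‖ ^ 2)) hK hz0
  refine ⟨fun x => F (‖x‖ ^ 2), ?_, hK.of_isClosed_subset (isClosed_tsupport _) ht, ht.trans ?_, ?_, ?_, ?_, ?_⟩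
  · exact ((cin_smooth _ _ (k := 1)).comp contDiff_normsq).mul (contDiff_const.sub ((cin_smooth _ _ (k := 1)).comp contDiff_normsq))
  · intro x hx
    have := hx.1
    show 1 < ‖x‖
    nlinarith [norm_nonneg x]
  · intro x
    exact mul_nonneg (cin_nonneg _ _ _) (by linarith [cin_le_one (R ^ 2) (4 * R ^ 2) (‖x‖ ^ 2)])
  · intro x
    exact mul_le_one₀ (cin_le_one _ _ _) (by linarith [cin_le_one (R ^ 2) (4 * R ^ 2) (‖x‖ ^ 2)]) (by linarith [cin_nonneg (R ^ 2) (4 * R ^ 2) (‖x‖ ^ 2)])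
  · intro x h1 h2
    simp [hF, cin_one h12 h1, cin_zero h34 h2]
  · intro x
    by_cases hx : x ∈ {x : En n | 2 ≤ ‖x‖ ^ 2 ∧ ‖x‖ ^ 2 ≤ 4 * R ^ 2}
    swap
    · rw [gn_zero fun h => hx (ht h)]; positivity
    have hXR : ‖x‖ ≤ 2 * R := by
      refine abs_le_of_sq_le_sq' ?_ (by linarith) |>.2
      have := hx.2
      nlinarith
    by_cases h4 : 4 < ‖x‖ ^ 2
    · have e : (fun x : En n => F (‖x‖ ^ 2)) =ᶠ[nhds x] fun x => 1 - cin (R ^ 2) (4 * R ^ 2) (‖x‖ ^ 2) := by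
        filter_upwards [nsq_cont.continuousAt.eventually (Ioi_mem_nhds h4)] with y hy
        simp [hF, cin_one h12 (le_of_lt hy)]
      rw [gn_congr e, radial_gn (F := fun σ => 1 - cin (R ^ 2) (4 * R ^ 2) σ) ((cin_deriv _ _ _).const_sub 1), abs_neg, abs_div]
      have p1 : 0 < 4 * R ^ 2 - R ^ 2 := by linarith
      rw [abs_of_pos p1]
      calc _ ≤ 2 * (S / (4 * R ^ 2 - R ^ 2)) * (2 * R) := by
            gcongr; exact hS1 _
        _ = 4 * S * (R / (4 * R ^ 2 - R ^ 2)) := by ring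
        _ ≤ 4 * S * 1 := by
            gcongr
            rw [div_le_one p1]; nlinarith
        _ ≤ 8 * S := by linarith
    · push Not at h4
      have hx2 : ‖x‖ ≤ 2 := by nlinarith [norm_nonneg x]
      have e : (fun x : En n => F (‖x‖ ^ 2)) x = (fun x : En n => F (‖x‖ ^ 2)) x := rfl
      have hd := (cin_deriv 2 4 (‖x‖ ^ 2))
      have e3 : gn (fun x : En n => F (‖x‖ ^ 2)) x = gn (fun x : En n => cin 2 4 (‖x‖ ^ 2)) x ∨ ‖x‖ ^ 2 = 4 := by
        rcases h4.lt_or_eq with h | h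
        · left
          refine gn_congr ?_
          filter_upwards [nsq_cont.continuousAt.eventually (Iio_mem_nhds h)] with y hy
          have : ‖y‖ ^ 2 ≤ R ^ 2 := by have : ‖y‖ ^ 2 < 4 := hy
                                       linarith
          simp [hF, cin_zero h34 this]
        · right; exact h
      have hd2 := hd.mul ((cin_deriv (R ^ 2) (4 * R ^ 2) (‖x‖ ^ 2)).const_sub 1)
      have e1 := cin_zero h34 (show ‖x‖ ^ 2 ≤ R ^ 2 by linarith)
      rw [e1] at hd2
      rw [radial_gn (F := F) hd2]
      have b1 : |deriv Real.smoothTransition ((‖x‖ ^ 2 - 2) / (4 - 2)) / (4 - 2)| ≤ S := by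
        rw [abs_div, abs_of_pos (show (0:ℝ) < 4 - 2 by norm_num)]
        refine (div_le_self (abs_nonneg _) (by norm_num)).trans (hS1 _)
      have b2 : |deriv Real.smoothTransition ((‖x‖ ^ 2 - R ^ 2) / (4 * R ^ 2 - R ^ 2)) / (4 * R ^ 2 - R ^ 2)| ≤ S := by
        rw [abs_div, abs_of_pos (show 0 < 4 * R ^ 2 - R ^ 2 by linarith)]
        refine (div_le_self (abs_nonneg _) (by linarith)).trans (hS1 _)
      have a1 := cin_nonneg 2 4 (‖x‖ ^ 2)
      have a2 := cin_le_one 2 4 (‖x‖ ^ 2)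
      have b3 : |deriv Real.smoothTransition ((‖x‖ ^ 2 - 2) / (4 - 2)) / (4 - 2) * (1 - 0) + cin 2 4 (‖x‖ ^ 2) * -(deriv Real.smoothTransition ((‖x‖ ^ 2 - R ^ 2) / (4 * R ^ 2 - R ^ 2)) / (4 * R ^ 2 - R ^ 2))| ≤ 2 * S := by
        refine (abs_add_le _ _).trans ?_
        rw [abs_mul, abs_mul, abs_neg, abs_of_nonneg a1]
        have := mul_le_mul a2 b2 (abs_nonneg _) zero_le_one
        simp only [sub_zero, abs_one, mul_one]
        linarith
      calc _ ≤ 2 * (2 * S) * 2 := by gcongr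
        _ = 8 * S := by ring

lemma grad_bound (hlam : 0 < lam) (hA : EllipticDecay A lam α C) (hα : 0 < α) (hC : 0 < C) (hu : WeakSol A u) :
    ∃ K1, 0 ≤ K1 ∧ ∀ η : En n → ℝ, ContDiff ℝ 1 η → HasCompactSupport η → tsupport η ⊆ OmegaExt n →
      ContDiff ℝ 1 (fun x => (η x * u x) ^ 2) ∧ HasCompactSupport (fun x => (η x * u x) ^ 2) ∧
      ∫⁻ x, ‖fderiv ℝ (fun x => (η x * u x) ^ 2) x‖ₑ ≤ ENNReal.ofReal (K1 * ∫ x, (η x ^ 2 + gn η x ^ 2) * u x ^ 2) := by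
  obtain ⟨Kc, hKc, hcac⟩ := caccio hlam hA hα hC hu
  refine ⟨2 + 2 * Kc, by positivity, fun η hη hηc hηt => ?_⟩
  have hf1 : ContDiff ℝ 1 (fun x => η x * u x) := cd_cut hη hηt fun x hx => WS_cd hu hx
  have hfc : HasCompactSupport (fun x => η x * u x) := hηc.mul_right
  have hh1 : ContDiff ℝ 1 (fun x => (η x * u x) ^ 2) := hf1.pow 2
  have hhc : HasCompactSupport (fun x => (η x * u x) ^ 2) := by
    have : (fun x => (η x * u x) ^ 2) = fun x => (η x * u x) * (η x * u x) := by ext; ring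
    rw [this]; exact hfc.mul_right
  refine ⟨hh1, hhc, ?_⟩
  have hK : IsCompact (tsupport η) := hηc
  have huc : ∀ x ∈ OmegaExt n, ContinuousAt u x := fun x hx => (WS_cd hu hx).continuousAt
  have hpuc : ∀ x ∈ OmegaExt n, ∀ i, ContinuousAt (pd i u) x := fun x hx i => (WS_cd hu hx).pd0
  have hη0 : ∀ x, x ∉ tsupport η → η x = 0 := fun x hx => image_eq_zero_of_notMem_tsupport hx
  have hcz : ∀ x, ContinuousAt η x := fun x => hη.continuous.continuousAt
  have hcg : ∀ x, ContinuousAt (gn η) x := fun x => cont_gn fun i => (cont_pd hη).continuousAt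
  have i1 : Integrable (fun x => η x ^ 2 * gn u x ^ 2) :=
    int_K hK hηt (fun x hx => ((hcz x).pow 2).mul ((cont_gn (hpuc x hx)).pow 2)) (fun x hx => by simp [hη0 x hx])
  have i2 : Integrable (fun x => (η x ^ 2 + gn η x ^ 2) * u x ^ 2) :=
    int_K hK hηt (fun x hx => (((hcz x).pow 2).add ((hcg x).pow 2)).mul ((huc x hx).pow 2)) (fun x hx => by simp [hη0 x hx, gn_zero hx])
  have hpt : ∀ x, gn (fun x => (η x * u x) ^ 2) x ≤ 2 * ((η x ^ 2 + gn η x ^ 2) * u x ^ 2) + 2 * (η x ^ 2 * gn u x ^ 2) := by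
    intro x
    by_cases hx : x ∈ tsupport η
    · have hdz := hη.differentiable one_ne_zero x
      have hdu := (WS_cd hu (hηt hx)).differentiableAt one_ne_zero
      have e := gn_comp (f := fun x => η x * u x) (φ := fun t => t ^ 2) (φ' := 2 * (η x * u x)) (x := x)
        (by simpa using hasDerivAt_pow 2 (η x * u x)) (hdz.mul hdu)
      rw [e]
      have e2 := gn_mul_sq hdz hdu
      rw [abs_mul, abs_of_pos (by norm_num : (0:ℝ) < 2)]
      have e3 : 2 * |η x * u x| * gn (fun x => η x * u x) x ≤ (η x * u x) ^ 2 + gn (fun x => η x * u x) x ^ 2 := by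
        rw [← sq_abs (η x * u x)]
        nlinarith [sq_nonneg (|η x * u x| - gn (fun x => η x * u x) x)]
      nlinarith [sq_nonneg (η x * u x)]
    · have : x ∉ tsupport (fun x => (η x * u x) ^ 2) := by
        intro h
        apply hx
        refine closure_mono ?_ h
        intro y hy hy0
        apply hy
        simp [hy0]
      rw [gn_zero this]; positivity
  have hI : Integrable (fun x => 2 * ((η x ^ 2 + gn η x ^ 2) * u x ^ 2) + 2 * (η x ^ 2 * gn u x ^ 2)) :=
    (i2.const_mul 2).add (i1.const_mul 2)
  calc ∫⁻ x, ‖fderiv ℝ (fun x => (η x * u x) ^ 2) x‖ₑ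
      ≤ ∫⁻ x, ENNReal.ofReal (2 * ((η x ^ 2 + gn η x ^ 2) * u x ^ 2) + 2 * (η x ^ 2 * gn u x ^ 2)) := by
        refine lintegral_mono fun x => ?_
        rw [← ofReal_norm, fderiv_gn]
        exact ENNReal.ofReal_le_ofReal (hpt x)
    _ = ENNReal.ofReal (∫ x, 2 * ((η x ^ 2 + gn η x ^ 2) * u x ^ 2) + 2 * (η x ^ 2 * gn u x ^ 2)) :=
        (ofReal_integral_eq_lintegral_ofReal hI (Eventually.of_forall fun x => by simp only [Pi.zero_apply]; positivity)).symm
    _ ≤ _ := by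
        refine ENNReal.ofReal_le_ofReal ?_
        rw [integral_add (i2.const_mul 2) (i1.const_mul 2), integral_const_mul, integral_const_mul]
        have := hcac η hη hηc hηt
        linarith
end P14

section P15
variable {n : ℕ} {f g u : En n → ℝ} {i : Fin n} {x : En n}
variable {A : En n → Matrix (Fin n) (Fin n) ℝ} {lam α C : ℝ}

lemma absorb {Y K θ : ℝ} (hY : 0 ≤ Y) (hK : 0 ≤ K) (hθ : θ < 1) (h : Y ≤ K * Y ^ θ) : Y ≤ K ^ (1 / (1 - θ)) := by
  rcases hY.eq_or_lt with h0 | h0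
  · rw [← h0]; positivity
  have h1 : Y ^ (1 - θ) ≤ K := by
    rw [Real.rpow_sub h0, Real.rpow_one, div_le_iff₀ (by positivity)]; exact h
  calc Y = (Y ^ (1 - θ)) ^ (1 / (1 - θ)) := by
        rw [← Real.rpow_mul hY, mul_one_div_cancel (by linarith), Real.rpow_one]
    _ ≤ _ := Real.rpow_le_rpow (by positivity) h1 (by apply one_div_nonneg.2; linarith)

lemma hol_pt {a z p k t : ℝ} {m : ℕ} (ha : 0 ≤ a) (hz : 0 ≤ z) (hz1 : z ≤ 1)
    (ht : (1 - t) * p + 2 * k * t = 2) (hm : 2 ≤ m) (hmk : 2 * m * (k * t) ≤ 2 * m - 2) :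
    z ^ (2 * m - 2) * a ^ 2 ≤ (a ^ p) ^ (1 - t) * (((z ^ m * a) ^ 2) ^ k) ^ t := by
  rcases ha.eq_or_lt with h0 | h0
  · rw [← h0]; simp; positivity
  rcases hz.eq_or_lt with h1 | h1
  · rw [← h1, zero_pow (by omega)]; simp; positivity
  have e1 : (a ^ p) ^ (1 - t) * (((z ^ m * a) ^ 2) ^ k) ^ t = z ^ (2 * m * (k * t)) * a ^ (2 : ℝ) := by
    have e2 : a ^ (2 : ℝ) = a ^ ((1 - t) * p) * a ^ (2 * k * t) := by rw [← Real.rpow_add h0, ht]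
    rw [e2, ← Real.rpow_mul h0.le, ← Real.rpow_mul (by positivity), mul_pow, ← pow_mul,
      Real.mul_rpow (by positivity) (by positivity), ← Real.rpow_natCast, ← Real.rpow_natCast, ← Real.rpow_mul h1.le, ← Real.rpow_mul h0.le]
    push_cast
    rw [show (m:ℝ) * 2 * (k * t) = 2 * m * (k * t) by ring, show 2 * (k * t) = 2 * k * t by ring, show p * (1 - t) = (1 - t) * p by ring]
    ring
  rw [e1, Real.rpow_two]
  refine mul_le_mul_of_nonneg_right ?_ (by positivity)
  rw [← Real.rpow_natCast]
  refine Real.rpow_le_rpow_of_exponent_ge h1 hz1 ?_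
  rw [Nat.cast_sub (by omega)]
  push_cast
  exact hmk

lemma u_meas (hu : WeakSol A u) : AEMeasurable u (volume.restrict (OmegaExt n)) :=
  (hu.1.continuousOn).aemeasurable (isOpen_OmegaExt n).measurableSet

lemma caseB (hn : 2 ≤ n) (hlam : 0 < lam) (hA : EllipticDecay A lam α C) (hα : 0 < α) (hC : 0 < C) (hu : WeakSol A u)
    {p : ℝ} (hp0 : 0 < p) (hp2 : p < 2) (hLp : (∫⁻ x in OmegaExt n, ENNReal.ofReal (|u x| ^ p)) < ⊤) :
    ∃ K : ℝ, 0 ≤ K ∧ ∀ R : ℝ, 4 ≤ R → ∫ x in shell n R, u x ^ 2 ≤ K := by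
  have hn1 : (2:ℝ) ≤ n := by exact_mod_cast hn
  obtain ⟨K1, hK1, hgb⟩ := grad_bound hlam hA hα hC hu
  obtain ⟨G, hG, hcut⟩ := big_cut n
  set k : ℝ := n / ((n:ℝ) - 1) with hk
  have hk1 : 1 < k := by rw [hk, one_lt_div (by linarith)]; linarith
  have hconj : Real.HolderConjugate (Module.finrank ℝ (En n)) k := by
    rw [finrank_euclideanSpace_fin, Real.holderConjugate_iff]
    refine ⟨by linarith, ?_⟩
    rw [hk, inv_div]
    field_simp
    ring
  set t : ℝ := (2 - p) / (2 * k - p) with ht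
  have hd : 0 < 2 * k - p := by linarith
  have ht0 : 0 < t := div_pos (by linarith) hd
  have ht1 : t < 1 := by rw [ht, div_lt_one hd]; linarith
  have hkt : k * t < 1 := by
    rw [ht, mul_div_assoc', div_lt_one hd]; nlinarith
  have hkt0 : 0 < k * t := by positivity
  have hte : (1 - t) * p + 2 * k * t = 2 := by rw [ht]; field_simp; ring
  obtain ⟨m, hm⟩ := exists_nat_ge (max 2 (1 / (1 - k * t)))
  have hm2 : 2 ≤ m := by exact_mod_cast (le_max_left _ _).trans hm
  have hmk : 2 * m * (k * t) ≤ 2 * m - 2 := by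
    have := (le_max_right _ _).trans hm
    rw [div_le_iff₀ (by linarith)] at this
    linarith
  set P := ∫⁻ x in OmegaExt n, ENNReal.ofReal (|u x| ^ p) with hP
  set c0 := lintegralPowLePowLIntegralFDerivConst (volume : Measure (En n)) k with hc0
  set B : ℝ := (P ^ (1 - t)).toReal * ((c0 : ℝ) ^ t * (K1 * (1 + (m * G) ^ 2)) ^ (k * t)) with hB
  have hB0 : 0 ≤ B := by positivity
  refine ⟨B ^ (1 / (1 - k * t)), by positivity, fun R hR => ?_⟩
  obtain ⟨ζ, z1, zc, zt, zn, zle, zone, zg⟩ := hcut (2 * R) (by linarith)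
  set Y := ∫ x, ζ x ^ (2 * m - 2) * u x ^ 2 with hY
  have hKc : IsCompact (tsupport ζ) := zc
  have huc : ∀ x ∈ OmegaExt n, ContinuousAt u x := fun x hx => (WS_cd hu hx).continuousAt
  have hζ0 : ∀ x, x ∉ tsupport ζ → ζ x = 0 := fun x hx => image_eq_zero_of_notMem_tsupport hx
  have hcz : ∀ x, ContinuousAt ζ x := fun x => z1.continuous.continuousAt
  have iY : Integrable (fun x => ζ x ^ (2 * m - 2) * u x ^ 2) :=
    int_K hKc zt (fun x hx => ((hcz x).pow _).mul ((huc x hx).pow 2)) (fun x hx => by simp [hζ0 x hx]; omega)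
  have hYpos : ∀ x, 0 ≤ ζ x ^ (2 * m - 2) * u x ^ 2 := fun x => by have := zn x; positivity
  have hY0 : 0 ≤ Y := integral_nonneg hYpos
  have lower : ∫ x in shell n R, u x ^ 2 ≤ Y := by
    have hK : IsCompact (shell n R) := annulus_compact _ _
    have hKO := shell_sub (n := n) (show 2 ≤ R by linarith)
    refine le_trans (setIntegral_mono_on ?_ iY.integrableOn hK.measurableSet fun x hx => ?_)
      (setIntegral_le_integral iY (Eventually.of_forall hYpos))
    · exact ContinuousOn.integrableOn_compact hK fun x hx => ((huc x (hKO hx)).pow 2).continuousWithinAt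
    · rw [zone x (by nlinarith [hx.1]) (by nlinarith [hx.2])]; simp
  refine lower.trans (absorb hY0 hB0 hkt ?_)
  -- the Sobolev step
  set η : En n → ℝ := fun x => ζ x ^ m with hη
  have η1 : ContDiff ℝ 1 η := z1.pow m
  have ηsub : tsupport η ⊆ tsupport ζ := closure_mono fun y hy hy0 => hy (by simp only [hη]; rw [hy0, zero_pow (by omega)])
  have ηc : HasCompactSupport η := hKc.of_isClosed_subset (isClosed_tsupport _) ηsub
  obtain ⟨h1, h2, h3⟩ := hgb η η1 ηc (ηsub.trans zt)
  have hW : ∫ x, (η x ^ 2 + gn η x ^ 2) * u x ^ 2 ≤ (1 + (m * G) ^ 2) * Y := by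
    rw [hY, ← integral_const_mul]
    refine integral_mono ?_ (iY.const_mul _) fun x => ?_
    · refine int_K hKc zt (fun x hx => ContinuousAt.mul (ContinuousAt.add ?_ ?_) ((huc x hx).pow 2)) fun x hx => ?_
      · exact η1.continuous.continuousAt.pow 2
      · exact (cont_gn fun i => (cont_pd η1).continuousAt).pow 2
      · rw [gn_zero fun h => hx (ηsub h)]
        simp only [hη, hζ0 x hx]
        rw [zero_pow (by omega)]; simp
    · have e1 : gn η x = |(m:ℝ) * ζ x ^ (m - 1)| * gn ζ x :=
        gn_comp (φ := fun s => s ^ m) (hasDerivAt_pow m (ζ x)) (z1.differentiable one_ne_zero x)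
      have e2 : ζ x ^ (m - 1) * ζ x ^ (m - 1) = ζ x ^ (2 * m - 2) := by rw [← pow_add]; congr 1; omega
      have e3 : gn η x ^ 2 ≤ ζ x ^ (2 * m - 2) * (m * G) ^ 2 := by
        have a0 := zn x
        have a1 := zg x
        have a2 := gn_nonneg (v := ζ) (x := x)
        rw [e1, mul_pow, sq_abs, ← e2]
        calc (m * ζ x ^ (m - 1)) ^ 2 * gn ζ x ^ 2 ≤ (m * ζ x ^ (m - 1)) ^ 2 * G ^ 2 := by gcongr
          _ = _ := by ring
      have e4 : η x ^ 2 ≤ ζ x ^ (2 * m - 2) := by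
        simp only [hη]
        rw [← pow_mul]
        exact pow_le_pow_of_le_one (zn x) (zle x) (by omega)
      have := mul_le_mul_of_nonneg_right (add_le_add e4 e3) (sq_nonneg (u x))
      simp only
      linarith
  have h4 := lintegral_pow_le_pow_lintegral_fderiv (volume : Measure (En n)) h1 h2 hconj
  have h5 : ∫⁻ x, ‖(η x * u x) ^ 2‖ₑ ^ k ≤ c0 * (ENNReal.ofReal (K1 * (1 + (m * G) ^ 2) * Y)) ^ k := by
    refine h4.trans ?_
    gcongr
    refine h3.trans (ENNReal.ofReal_le_ofReal ?_)
    rw [mul_assoc]; gcongr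
  have h6 : ENNReal.ofReal Y ≤ P ^ (1 - t) * (c0 * (ENNReal.ofReal (K1 * (1 + (m * G) ^ 2) * Y)) ^ k) ^ t := by
    rw [hY, ofReal_integral_eq_lintegral_ofReal iY (Eventually.of_forall hYpos)]
    have s1 : ∫⁻ x, ENNReal.ofReal (ζ x ^ (2 * m - 2) * u x ^ 2) = ∫⁻ x in OmegaExt n, ENNReal.ofReal (ζ x ^ (2 * m - 2) * u x ^ 2) := by
      refine (setLIntegral_eq_of_support_subset ?_).symm
      intro x hx
      by_contra hh
      apply hx
      show ENNReal.ofReal (ζ x ^ (2 * m - 2) * u x ^ 2) = 0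
      rw [hζ0 x fun h => hh (zt h), zero_pow (by omega)]; simp
    rw [s1]
    have s2 : ∀ x, ENNReal.ofReal (ζ x ^ (2 * m - 2) * u x ^ 2) ≤ ENNReal.ofReal (|u x| ^ p) ^ (1 - t) * (‖(η x * u x) ^ 2‖ₑ ^ k) ^ t := by
      intro x
      have q1 : ‖(η x * u x) ^ 2‖ₑ = ENNReal.ofReal ((ζ x ^ m * |u x|) ^ 2) := by
        rw [← ofReal_norm, Real.norm_eq_abs, abs_of_nonneg (sq_nonneg _), mul_pow, mul_pow, sq_abs]
      rw [q1, ENNReal.ofReal_rpow_of_nonneg (by positivity) (by linarith), ENNReal.ofReal_rpow_of_nonneg (by positivity) (by linarith),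
        ENNReal.ofReal_rpow_of_nonneg (by positivity) ht0.le, ← ENNReal.ofReal_mul (by positivity)]
      refine ENNReal.ofReal_le_ofReal ?_
      rw [← sq_abs (u x)]
      exact hol_pt (abs_nonneg _) (zn x) (zle x) hte hm2 hmk
    have um := u_meas hu
    refine (lintegral_mono s2).trans ((ENNReal.lintegral_mul_norm_pow_le ?_ ?_ (by linarith) ht0.le (by ring)).trans ?_)
    · exact (um.abs.pow_const p).ennreal_ofReal
    · exact (h1.continuous.measurable.enorm.pow_const k).aemeasurable
    · gcongr
      exact (setLIntegral_le_lintegral _ _).trans h5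
  have hPt : P ^ (1 - t) ≠ ⊤ := ENNReal.rpow_ne_top_of_nonneg (by linarith) hLp.ne
  have h7 : P ^ (1 - t) * (c0 * (ENNReal.ofReal (K1 * (1 + (m * G) ^ 2) * Y)) ^ k) ^ t = ENNReal.ofReal (B * Y ^ (k * t)) := by
    have q0 : 0 ≤ K1 * (1 + (m * G) ^ 2) := by positivity
    rw [ENNReal.mul_rpow_of_nonneg _ _ ht0.le, ← ENNReal.rpow_mul, ENNReal.ofReal_rpow_of_nonneg (by positivity) hkt0.le,
      Real.mul_rpow q0 hY0, ← ENNReal.ofReal_toReal hPt, ← ENNReal.ofReal_coe_nnreal (p := c0),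
      ENNReal.ofReal_rpow_of_nonneg (by positivity) ht0.le, ← ENNReal.ofReal_mul (by positivity), ← ENNReal.ofReal_mul (by positivity)]
    rw [hB]
    congr 1
    ring
  rw [h7] at h6
  exact (ENNReal.ofReal_le_ofReal_iff (by positivity)).1 h6

lemma caseA (hn : 2 ≤ n) (hu : WeakSol A u)
    {p : ℝ} (hp2 : 2 ≤ p) (hLp : (∫⁻ x in OmegaExt n, ENNReal.ofReal (|u x| ^ p)) < ⊤) :
    ∃ K : ℝ, 0 ≤ K ∧ ∀ R : ℝ, 4 ≤ R → ∫ x in shell n R, u x ^ 2 ≤ K * R ^ ((n:ℝ) * (1 - 2 / p)) := by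
  have hp0 : 0 < p := by linarith
  set P := ∫⁻ x in OmegaExt n, ENNReal.ofReal (|u x| ^ p) with hP
  set b : ℝ := 1 - 2 / p with hb
  have h2p : 2 / p ≤ 1 := by rw [div_le_one hp0]; exact hp2
  have hb0 : 0 ≤ b := by linarith
  set v : ENNReal := volume (ball (0 : En n) 1) with hv
  have hvt : v ≠ ⊤ := measure_ball_lt_top.ne
  have hPt : P ^ (2 / p) ≠ ⊤ := ENNReal.rpow_ne_top_of_nonneg (by positivity) hLp.ne
  have hvt2 : (ENNReal.ofReal (2 ^ n) * v) ^ b ≠ ⊤ := ENNReal.rpow_ne_top_of_nonneg hb0 (ENNReal.mul_ne_top ENNReal.ofReal_ne_top hvt)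
  refine ⟨(P ^ (2 / p) * (ENNReal.ofReal (2 ^ n) * v) ^ b).toReal, by positivity, fun R hR => ?_⟩
  have hR0 : 0 < R := by linarith
  have hK : IsCompact (shell n R) := annulus_compact _ _
  have hKO := shell_sub (n := n) (show 2 ≤ R by linarith)
  have huc : ∀ x ∈ OmegaExt n, ContinuousAt u x := fun x hx => (WS_cd hu hx).continuousAt
  have iu : IntegrableOn (fun x => u x ^ 2) (shell n R) :=
    ContinuousOn.integrableOn_compact hK fun x hx => ((huc x (hKO hx)).pow 2).continuousWithinAt
  have e0 := ofReal_integral_eq_lintegral_ofReal iu (Eventually.of_forall fun x => sq_nonneg _)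
  have hvol : volume (shell n R) ≤ ENNReal.ofReal (R ^ n) * (ENNReal.ofReal (2 ^ n) * v) := by
    have : shell n R ⊆ closedBall (0 : En n) (2 * R) := by
      intro x hx
      rw [mem_closedBall_zero_iff]
      refine abs_le_of_sq_le_sq' ?_ (by linarith) |>.2
      nlinarith [hx.2]
    refine (measure_mono this).trans ?_
    rw [Measure.addHaar_closedBall _ _ (by linarith), finrank_euclideanSpace_fin, mul_pow, mul_comm (2 ^ n : ℝ), ENNReal.ofReal_mul (by positivity), mul_assoc]
  have h1 : ∫⁻ x in shell n R, ENNReal.ofReal (u x ^ 2) ≤ P ^ (2 / p) * (ENNReal.ofReal (R ^ n) * (ENNReal.ofReal (2 ^ n) * v)) ^ b := by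
    have s2 : ∀ x, ENNReal.ofReal (u x ^ 2) = ENNReal.ofReal (|u x| ^ p) ^ (2 / p) * (1 : ENNReal) ^ b := by
      intro x
      rw [ENNReal.one_rpow, mul_one, ENNReal.ofReal_rpow_of_nonneg (by positivity) (by positivity), ← Real.rpow_mul (abs_nonneg _),
        mul_div_cancel₀ _ hp0.ne', Real.rpow_two, sq_abs]
    simp_rw [s2]
    have um := (u_meas hu).mono_measure (Measure.restrict_mono hKO le_rfl)
    refine (ENNReal.lintegral_mul_norm_pow_le (f := fun x => ENNReal.ofReal (|u x| ^ p)) (g := fun _ => 1) ?_ aemeasurable_const (by positivity) hb0 (by rw [hb]; ring)).trans ?_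
    · exact (um.abs.pow_const p).ennreal_ofReal
    · rw [lintegral_one, Measure.restrict_apply_univ]
      gcongr
      exact lintegral_mono_set hKO
  have h2 : P ^ (2 / p) * (ENNReal.ofReal (R ^ n) * (ENNReal.ofReal (2 ^ n) * v)) ^ b =
      ENNReal.ofReal ((P ^ (2 / p) * (ENNReal.ofReal (2 ^ n) * v) ^ b).toReal * R ^ ((n:ℝ) * b)) := by
    rw [ENNReal.mul_rpow_of_nonneg _ _ hb0, ENNReal.ofReal_mul (by positivity), ENNReal.ofReal_toReal (ENNReal.mul_ne_top hPt hvt2),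
      ENNReal.ofReal_rpow_of_nonneg (by positivity) hb0, ← Real.rpow_natCast, ← Real.rpow_mul hR0.le]
    ring
  rw [← e0, h2] at h1
  exact (ENNReal.ofReal_le_ofReal_iff (by positivity)).1 h1

lemma M_decay (hn : 2 ≤ n) (hlam : 0 < lam) (hA : EllipticDecay A lam α C) (hα : 0 < α) (hC : 0 < C) (hu : WeakSol A u)
    {p : ℝ} (hp0 : 0 < p) (hp1 : p < 2 * (n:ℝ) / ((n:ℝ) - 1))
    (hLp : (∫⁻ x in OmegaExt n, ENNReal.ofReal (|u x| ^ p)) < ⊤) :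
    ∃ a : ℝ, 0 < a ∧ a ≤ 1 ∧ Tendsto (fun R : ℝ => R ^ (a - 1) * ∫ x in shell n R, u x ^ 2) atTop (nhds 0) := by
  have hn1 : (2:ℝ) ≤ n := by exact_mod_cast hn
  obtain ⟨K, b, hK, hb0, hb1, hM⟩ : ∃ K b : ℝ, 0 ≤ K ∧ 0 ≤ b ∧ b < 1 ∧ ∀ R : ℝ, 4 ≤ R → ∫ x in shell n R, u x ^ 2 ≤ K * R ^ b := by
    rcases lt_or_ge p 2 with h | h
    · obtain ⟨K, hK, hM⟩ := caseB hn hlam hA hα hC hu hp0 h hLp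
      exact ⟨K, 0, hK, le_rfl, one_pos, fun R hR => by simpa using hM R hR⟩
    · obtain ⟨K, hK, hM⟩ := caseA hn hu h hLp
      refine ⟨K, _, hK, ?_, ?_, hM⟩
      · have : 2 / p ≤ 1 := by rw [div_le_one hp0]; exact h
        exact mul_nonneg (by linarith) (by linarith)
      · rw [lt_div_iff₀ (by linarith)] at hp1
        have : (n:ℝ) * (1 - 2 / p) = (n * (p - 2)) / p := by field_simp
        rw [this, div_lt_one hp0]
        linarith
  refine ⟨(1 - b) / 2, by linarith, by linarith, ?_⟩
  have ht : Tendsto (fun R : ℝ => K * R ^ (-((1 - b) / 2))) atTop (nhds 0) := by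
    simpa using (tendsto_rpow_neg_atTop (show 0 < (1 - b) / 2 by linarith)).const_mul K
  refine squeeze_zero' ?_ ?_ ht
  · filter_upwards [eventually_ge_atTop 4] with R hR
    exact mul_nonneg (by positivity) (integral_nonneg fun x => sq_nonneg _)
  · filter_upwards [eventually_ge_atTop 4] with R hR
    have hR0 : 0 < R := by linarith
    calc R ^ ((1 - b) / 2 - 1) * ∫ x in shell n R, u x ^ 2 ≤ R ^ ((1 - b) / 2 - 1) * (K * R ^ b) := by
          gcongr; exact hM R hR
      _ = K * (R ^ ((1 - b) / 2 - 1) * R ^ b) := by ring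
      _ = K * R ^ (-((1 - b) / 2)) := by rw [← Real.rpow_add hR0]; congr 2; ring
end P15

section P16
variable {n : ℕ} {f g u : En n → ℝ} {i : Fin n} {x : En n}
variable {A : En n → Matrix (Fin n) (Fin n) ℝ} {lam α C : ℝ}

lemma exp_zero {X Y c τ0 : ℝ} (hc : 0 < c) (h : ∀ τ, τ0 ≤ τ → X ≤ Real.exp (-(τ * c)) * Y) : X ≤ 0 := by
  have h1 : Tendsto (fun τ : ℝ => Real.exp (-(τ * c)) * Y) atTop (nhds (0 * Y)) := by
    refine Tendsto.mul_const Y (Real.tendsto_exp_neg_atTop_nhds_zero.comp ?_)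
    exact tendsto_id.atTop_mul_const hc
  rw [zero_mul] at h1
  refine ge_of_tendsto h1 ?_
  filter_upwards [eventually_ge_atTop τ0] with τ hτ using h τ hτ

lemma exp_step {X Y a b c : ℝ} (hY : 0 ≤ Y) (hab : c ≤ a - b) (h : Real.exp a ^ 2 * X ≤ Real.exp b ^ 2 * Y) :
    X ≤ Real.exp (-(2 * c)) * Y := by
  have ha : 0 < Real.exp a ^ 2 := by positivity
  have e : Real.exp b ^ 2 ≤ Real.exp a ^ 2 * Real.exp (-(2 * c)) := by
    rw [← Real.exp_nat_mul, ← Real.exp_nat_mul, ← Real.exp_add]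
    apply Real.exp_le_exp.2
    push_cast
    linarith
  have h2 := h.trans (mul_le_mul_of_nonneg_right e hY)
  rw [mul_assoc] at h2
  exact le_of_mul_le_mul_left h2 ha

lemma zero_of_int (hu : WeakSol A u) {w : En n → ℝ} {s3 s4 : ℝ} (hs : 1 < s3)
    (hw : ∀ x, s3 ≤ ‖x‖ ^ 2 → ContinuousAt w x) (hw0 : ∀ x, s3 ≤ ‖x‖ ^ 2 → 0 < w x)
    (h : ∫ x in {x : En n | s3 ≤ ‖x‖ ^ 2 ∧ ‖x‖ ^ 2 ≤ s4}, w x * u x ^ 2 ≤ 0) (hx1 : s3 < ‖x‖ ^ 2) (hx2 : ‖x‖ ^ 2 < s4) : u x = 0 := by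
  have hO : ∀ x : En n, s3 ≤ ‖x‖ ^ 2 → x ∈ OmegaExt n := fun x hx => by
    show 1 < ‖x‖
    nlinarith [norm_nonneg x]
  set K := {x : En n | s3 ≤ ‖x‖ ^ 2 ∧ ‖x‖ ^ 2 ≤ s4} with hKd
  have hK : IsCompact K := annulus_compact _ _
  have hc : ContinuousOn (fun x => w x * u x ^ 2) K := fun y hy =>
    ((hw y hy.1).mul ((WS_cd hu (hO y hy.1)).continuousAt.pow 2)).continuousWithinAt
  have hi : IntegrableOn (fun x => w x * u x ^ 2) K := hc.integrableOn_compact hK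
  have hnn : 0 ≤ᵐ[volume.restrict K] fun x => w x * u x ^ 2 := by
    filter_upwards [ae_restrict_mem hK.measurableSet] with y hy
    exact mul_nonneg (hw0 y hy.1).le (sq_nonneg _)
  have h0 : ∫ x in K, w x * u x ^ 2 = 0 := le_antisymm h (integral_nonneg_of_ae hnn)
  have h1 := (setIntegral_eq_zero_iff_of_nonneg_ae hnn hi).1 h0
  set U := {x : En n | s3 < ‖x‖ ^ 2 ∧ ‖x‖ ^ 2 < s4} with hUd
  have hU : IsOpen U := (isOpen_lt continuous_const nsq_cont).inter (isOpen_lt nsq_cont continuous_const)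
  have hUK : U ⊆ K := fun y hy => ⟨hy.1.le, hy.2.le⟩
  have h2 := ae_restrict_of_ae_restrict_of_subset hUK h1
  have h3 := Measure.eqOn_open_of_ae_eq h2 hU (hc.mono hUK) continuousOn_const
  have h4 : w x * u x ^ 2 = 0 := h3 ⟨hx1, hx2⟩
  rcases mul_eq_zero.1 h4 with h5 | h5
  · exact absurd h5 (hw0 x hx1.le).ne'
  · exact pow_eq_zero_iff (two_ne_zero) |>.1 h5

lemma cont_nrpow {l : ℝ} (hx : 0 < ‖x‖) : ContinuousAt (fun x : En n => (‖x‖ ^ 2) ^ l) x :=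
  nsq_cont.continuousAt.rpow_const (Or.inl (by positivity))

lemma far_zero (hn : 2 ≤ n) (hlam : 0 < lam) (hA : EllipticDecay A lam α C) (hα : 0 < α) (hC : 0 < C) (hu : WeakSol A u)
    {p : ℝ} (hp0 : 0 < p) (hp1 : p < 2 * (n:ℝ) / ((n:ℝ) - 1))
    (hLp : (∫⁻ x in OmegaExt n, ENNReal.ofReal (|u x| ^ p)) < ⊤) :
    ∃ S : ℝ, 1 ≤ S ∧ ∀ x : En n, S < ‖x‖ ^ 2 → u x = 0 := by
  obtain ⟨a, ha0, ha1, hM⟩ := M_decay hn hlam hA hα hC hu hp0 hp1 hLp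
  obtain ⟨l, hl⟩ : ∃ l : ℝ, 2 * l = 1 - a / 8 := ⟨(1 - a / 8) / 2, by ring⟩
  have hl0 : 0 < l := by linarith
  obtain ⟨R0, hR0, hcar⟩ := carleman_far hn hA hα ha0 ha1 hl
  obtain ⟨D, hD, hpsi⟩ := psi_int hlam hA hα hC hu
  set S := R0 ^ 2 with hS
  have hS1 : 1 ≤ S := by nlinarith
  refine ⟨S + 3, by linarith, fun x hx => ?_⟩
  set w1 : En n → ℝ := fun x => a / 4 * (‖x‖ ^ 2) ^ ((a - 1) / 2) with hw1
  set w2 : En n → ℝ := fun x => 64 * (n:ℝ) ^ 2 / a * ((‖x‖ ^ 2) ^ ((a - 1) / 2) * ‖x‖ ^ 2) with hw2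
  have hV0 : ∀ y : En n, R0 < ‖y‖ → 0 < ‖y‖ := fun y hy => by linarith
  have hVS : ∀ y : En n, S < ‖y‖ ^ 2 → R0 < ‖y‖ := fun y hy => lt_of_pow_lt_pow_left₀ 2 (norm_nonneg _) hy
  set V : Set (En n) := {x | R0 < ‖x‖} with hV
  have hw1c : ∀ y ∈ V, ContinuousAt w1 y := fun y hy => continuousAt_const.mul (cont_nrpow (hV0 y hy))
  have hw2c : ∀ y ∈ V, ContinuousAt w2 y := fun y hy =>
    continuousAt_const.mul ((cont_nrpow (hV0 y hy)).mul nsq_cont.continuousAt)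
  have hw1n : ∀ y, 0 ≤ w1 y := fun y => by simp only [hw1]; positivity
  have hw2n : ∀ y, 0 ≤ w2 y := fun y => by simp only [hw2]; positivity
  set Y := ∫ x, w2 x * Qf A (chin n (S + 1) (S + 2)) u x ^ 2 with hY
  have hY0 : 0 ≤ Y := integral_nonneg fun y => mul_nonneg (hw2n y) (sq_nonneg _)
  set s4 := ‖x‖ ^ 2 + 1 with hs4
  set X := ∫ x in {x : En n | S + 3 ≤ ‖x‖ ^ 2 ∧ ‖x‖ ^ 2 ≤ s4}, w1 x * u x ^ 2 with hX
  set c := ((S + 3) ^ l - (S + 2) ^ l) / (1 + (S + 3) ^ l) ^ 2 with hc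
  have hc0 : 0 < c := by
    have : (S + 2) ^ l < (S + 3) ^ l := Real.rpow_lt_rpow (by linarith) (by linarith) hl0
    have h3 : 0 < (S + 3) ^ l := by positivity
    rw [hc]
    apply div_pos (by linarith) (by positivity)
  have key : ∀ τ : ℝ, 0 ≤ τ → X ≤ Real.exp (-(τ * (2 * c))) * Y := by
    intro τ hτ
    obtain ⟨ε, hε, hε1, hz⟩ := hcar τ hτ
    have hd := fphi_mono (l := l) (s1 := S + 2) (s2 := S + 3) (by linarith) (by linarith) hε.le hε1 hτ hl0.le
    have hmono : MonotoneOn (fphi τ ε l) (Set.Ioi 0) := by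
      intro s1 h1 s2 _ h12
      have q := fphi_mono (l := l) h1 h12 hε.le hε1 hτ hl0.le
      have h1' : (0:ℝ) < s1 := h1
      have q1 : s1 ^ l ≤ s2 ^ l := Real.rpow_le_rpow h1'.le h12 hl0.le
      have q2 : 0 ≤ τ * ((s2 ^ l - s1 ^ l) / (1 + s2 ^ l) ^ 2) :=
        mul_nonneg hτ (div_nonneg (by linarith) (sq_nonneg _))
      linarith
    have hφc : ∀ y ∈ V, ContinuousAt (fun x : En n => fphi τ ε l (‖x‖ ^ 2)) y := fun y hy =>
      ContinuousAt.comp (f := fun x : En n => ‖x‖ ^ 2)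
        (hd_fphi (by have := hV0 y hy; positivity) hε.le).continuousAt nsq_cont.continuousAt
    have hCar : ∀ z : En n → ℝ, ContDiff ℝ 2 z → HasCompactSupport z → tsupport z ⊆ V →
        ∫ x, w1 x * Real.exp (fphi τ ε l (‖x‖ ^ 2)) ^ 2 * z x ^ 2 ≤ ∫ x, w2 x * Real.exp (fphi τ ε l (‖x‖ ^ 2)) ^ 2 * (Lop A z x + z x) ^ 2 := by
      intro z z1 z2 z3
      have h := hz z z1 z2 z3
      refine le_trans (le_of_eq (integral_congr_ae (Eventually.of_forall fun y => ?_)))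
        (h.trans (le_of_eq (integral_congr_ae (Eventually.of_forall fun y => ?_))))
      · simp only [hw1]; ring
      · simp only [hw2]; ring
    refine le_trans (exp_step hY0 hd ?_) (le_of_eq (by rw [show τ * (2 * c) = 2 * (τ * c) by ring]))
    set Kc := 64 * (n:ℝ) ^ 2 / a * 2 * Real.exp (τ / ε) ^ 2 * D with hKc
    have hlim : Tendsto (fun R : ℝ => Real.exp (fphi τ ε l (S + 2)) ^ 2 * Y + Kc * (R ^ (a - 1) * ∫ x in shell n R, u x ^ 2)) atTop
        (nhds (Real.exp (fphi τ ε l (S + 2)) ^ 2 * Y)) := by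
      simpa using (hM.const_mul Kc).const_add (Real.exp (fphi τ ε l (S + 2)) ^ 2 * Y)
    refine ge_of_tendsto hlim ?_
    filter_upwards [eventually_ge_atTop 2, eventually_ge_atTop s4] with R hR hR4
    have hRp : 0 < R := by linarith
    have hp := push hA hu (V := V) (fun y hy => lt_of_le_of_lt hR0 hy) hw1c hw2c hw1n hw2n hφc hmono hCar
      (s1 := S + 1) (s2 := S + 2) (s3 := S + 3) (s4 := s4) (R := R) (by linarith) (by linarith) (by linarith) (by linarith)
      hRp (by nlinarith) (fun y hy => hVS y (by linarith [hy.1]))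
    refine hp.trans (add_le_add le_rfl ?_)
    obtain ⟨hi, hb⟩ := hpsi R hR
    set B := 64 * (n:ℝ) ^ 2 / a * (R ^ (a - 1) * (2 * R ^ 2)) * Real.exp (τ / ε) ^ 2 with hB
    have hpt : ∀ y : En n, w2 y * Real.exp (fphi τ ε l (‖y‖ ^ 2)) ^ 2 * Qf A (psiR n R) u y ^ 2 ≤ B * Qf A (psiR n R) u y ^ 2 := by
      intro y
      by_cases h : ‖y‖ ^ 2 < R ^ 2 ∨ 2 * R ^ 2 < ‖y‖ ^ 2
      · rw [Qf_psi_zero hRp h]; simp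
      · push Not at h
        have hyp : 0 < ‖y‖ ^ 2 := by nlinarith
        have e1 : (‖y‖ ^ 2) ^ ((a - 1) / 2) ≤ R ^ (a - 1) := by
          calc (‖y‖ ^ 2) ^ ((a - 1) / 2) ≤ (R ^ 2) ^ ((a - 1) / 2) :=
                Real.rpow_le_rpow_of_nonpos (by positivity) h.1 (by linarith)
            _ = R ^ (a - 1) := by
                rw [← Real.rpow_two, ← Real.rpow_mul hRp.le]; congr 1; ring
        have e2 := fphi_le (l := l) hyp hε hτ
        refine mul_le_mul_of_nonneg_right ?_ (sq_nonneg _)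
        simp only [hw2, hB]
        gcongr
        exact h.2
    have hB0 : 0 ≤ B := by rw [hB]; positivity
    calc ∫ y, w2 y * Real.exp (fphi τ ε l (‖y‖ ^ 2)) ^ 2 * Qf A (psiR n R) u y ^ 2 ≤ ∫ y, B * Qf A (psiR n R) u y ^ 2 :=
          integral_mono_of_nonneg (Eventually.of_forall fun y =>
            mul_nonneg (mul_nonneg (hw2n y) (sq_nonneg _)) (sq_nonneg _)) (hi.const_mul B) (Eventually.of_forall hpt)
      _ = B * ∫ y, Qf A (psiR n R) u y ^ 2 := integral_const_mul _ _
      _ ≤ B * (D / R ^ 2 * ∫ x in shell n R, u x ^ 2) := mul_le_mul_of_nonneg_left hb hB0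
      _ = Kc * (R ^ (a - 1) * ∫ x in shell n R, u x ^ 2) := by
          rw [hB, hKc]; field_simp
  have hX0 : X ≤ 0 := exp_zero (by linarith : 0 < 2 * c) key
  have hVS3 : ∀ y : En n, S + 3 ≤ ‖y‖ ^ 2 → R0 < ‖y‖ := fun y hy => hVS y (by linarith)
  refine zero_of_int hu (w := w1) (by linarith) (fun y hy => hw1c y (hVS3 y hy)) (fun y hy => ?_) hX0 hx (by rw [hs4]; linarith)
  have := hV0 y (hVS3 y hy)
  simp only [hw1]
  positivity

lemma near_zero (hlam : 0 < lam) (hA : EllipticDecay A lam α C) (hα : 0 < α) (hC : 0 < C) (hu : WeakSol A u)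
    {S : ℝ} (hS : 1 ≤ S) (hz : ∀ x : En n, S < ‖x‖ ^ 2 → u x = 0) (hx : x ∈ OmegaExt n) : u x = 0 := by
  have hx1 : 1 < ‖x‖ := hx
  set q := ‖x‖ ^ 2 with hq
  have hq1 : 1 < q := by nlinarith
  obtain ⟨R, hR2, hRS, hRx⟩ : ∃ R : ℝ, 2 ≤ R ∧ S < R ^ 2 ∧ q + 1 ≤ R ^ 2 :=
    ⟨S + q + 2, by linarith, by nlinarith, by nlinarith⟩
  have hRp : 0 < R := by linarith
  obtain ⟨K, γ, τ0, hγ, hτ0, hcar⟩ := carleman_near (n := n) hlam hA hα hC (R1 := 2 * R) (by linarith)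
  set w : En n → ℝ := fun x => (‖x‖ ^ 2) ^ (-K / 2) with hw
  set V : Set (En n) := {x | 1 < ‖x‖ ∧ ‖x‖ < 2 * R} with hV
  have hwc : ∀ y : En n, 1 < ‖y‖ → ContinuousAt w y := fun y hy => cont_nrpow (by linarith)
  have hwn : ∀ y, 0 ≤ w y := fun y => by simp only [hw]; positivity
  obtain ⟨e, he0, he⟩ : ∃ e : ℝ, 0 < e ∧ q = 1 + 4 * e := ⟨(q - 1) / 4, by linarith, by ring⟩
  set Y := ∫ x, w x * Qf A (chin n (1 + e) (1 + 2 * e)) u x ^ 2 with hY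
  have hY0 : 0 ≤ Y := integral_nonneg fun y => mul_nonneg (hwn y) (sq_nonneg _)
  set X := ∫ x in {x : En n | 1 + 3 * e ≤ ‖x‖ ^ 2 ∧ ‖x‖ ^ 2 ≤ q + 1}, w x * u x ^ 2 with hX
  set c := (1 + 3 * e) ^ γ - (1 + 2 * e) ^ γ with hc
  have hc0 : 0 < c := by
    have : (1 + 2 * e) ^ γ < (1 + 3 * e) ^ γ := Real.rpow_lt_rpow (by linarith) (by linarith) (by linarith)
    rw [hc]; linarith
  have h1n : ∀ y : En n, ∀ t : ℝ, 1 < t → t ≤ ‖y‖ ^ 2 → 1 < ‖y‖ := fun y t h1 h2 => by nlinarith [norm_nonneg y]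
  have key : ∀ τ : ℝ, τ0 ≤ τ → X ≤ Real.exp (-(τ * (2 * c))) * Y := by
    intro τ hτ
    have hτp : 0 ≤ τ := by linarith
    have hp := push hA hu (V := V) (w1 := w) (w2 := w) (φ := fun s => τ * s ^ γ) (fun y hy => hy.1) (fun y hy => hwc y hy.1) (fun y hy => hwc y hy.1)
      hwn hwn (fun y hy => continuousAt_const.mul (cont_nrpow (by linarith [hy.1])))
      (fun s1 h1 s2 _ h12 => mul_le_mul_of_nonneg_left (Real.rpow_le_rpow (le_of_lt h1) h12 (by linarith)) hτp)
      (hcar τ hτ) (s1 := 1 + e) (s2 := 1 + 2 * e) (s3 := 1 + 3 * e) (s4 := q + 1) (R := R) (by linarith) (by linarith) (by linarith) (by linarith)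
      hRp hRx (fun y hy => ⟨h1n y _ (by linarith) hy.1, by
        have := hy.2
        refine lt_of_pow_lt_pow_left₀ 2 (by linarith) ?_
        nlinarith⟩)
    have hz0 : ∀ y : En n, Qf A (psiR n R) u y = 0 := by
      intro y
      by_cases h : ‖y‖ ^ 2 < R ^ 2
      · exact Qf_psi_zero hRp (Or.inl h)
      · refine Qf_u_zero ?_
        filter_upwards [nsq_cont.continuousAt.eventually (Ioi_mem_nhds (show S < ‖y‖ ^ 2 by linarith))] with v hv using hz v hv
    simp only [hz0] at hp
    simp only [ne_eq, OfNat.ofNat_ne_zero, not_false_eq_true, zero_pow, mul_zero, integral_zero, add_zero] at hp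
    refine (exp_step (c := τ * c) hY0 ?_ hp).trans (le_of_eq (by rw [show τ * (2 * c) = 2 * (τ * c) by ring]))
    rw [hc]; linarith
  have hX0 : X ≤ 0 := exp_zero (by linarith : 0 < 2 * c) key
  refine zero_of_int hu (w := w) (by linarith) (fun y hy => hwc y (h1n y _ (by linarith) hy)) (fun y hy => ?_) hX0
    (show 1 + 3 * e < q by linarith) (show q < q + 1 by linarith)
  have := h1n y _ (by linarith) hy
  simp only [hw]
  positivity
end P16

theorem lp_absence_of_spectrum
    (n : ℕ) (hn : 2 ≤ n)
    (A : En n → Matrix (Fin n) (Fin n) ℝ) (lam α C : ℝ)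
    (hlam0 : 0 < lam) (hlam1 : lam < 1) (hα : 0 < α) (hC : 0 < C)
    (hA : EllipticDecay A lam α C)
    (u : En n → ℝ) (hu : WeakSol A u)
    (p : ℝ) (hp0 : 0 < p) (hp1 : p < 2 * (n : ℝ) / ((n : ℝ) - 1))
    (hLp : (∫⁻ x in OmegaExt n, ENNReal.ofReal (|u x| ^ p)) < ⊤) :
    ∀ x ∈ OmegaExt n, u x = 0 := by
  obtain ⟨S, hS, hz⟩ := far_zero hn hlam0 hA hα hC hu hp0 hp1 hLp
  exact fun x hx => near_zero hlam0 hA hα hC hu hS hz hx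

end
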